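/- Let M be a smooth hypersurface of R^{n+1}, p ∈ [1,n), and b ∈ [0,1]. Then there exists C = C(n,p) > 0 such that for every φ ∈ C^1_c(M): (∫_M |φ|^{p(n−bp)/(n−p)} / |x|^{bp} dV)^{(n−p)/(n−bp)} ≤ C ∫_M (|∇_T φ|^p + |Hφ|^p) dV. -/

import Mathlib

open MeasureTheory
open scoped RealInnerProductSpace

noncomputable section

/-- Ambient Euclidean space `ℝ^{n+1}`. -/
abbrev Eu (n : ℕ) := EuclideanSpace ℝ (Fin (n + 1))

/-- A smooth `n`-dimensional hypersurface of `ℝ^{n+1}`, described by its carrier set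
together with a smooth unit normal field; locally it is a regular level set of a
smooth function. -/
structure Hypersurface (n : ℕ) where
  carrier : Set (Eu n)
  nu : Eu n → Eu n
  smooth_nu : ContDiff ℝ (⊤ : ℕ∞) nu
  unit_nu : ∀ x ∈ carrier, ‖nu x‖ = 1
  locally_level_set : ∀ x ∈ carrier, ∃ U : Set (Eu n), IsOpen U ∧ x ∈ U ∧
    ∃ f : Eu n → ℝ, ContDiff ℝ (⊤ : ℕ∞) f ∧
      carrier ∩ U = {y ∈ U | f y = 0} ∧
      (∀ y ∈ U, gradient f y ≠ 0) ∧
      (∀ y ∈ carrier ∩ U, nu y = ‖gradient f y‖⁻¹ • gradient f y)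

variable {n : ℕ}

/-- The `i`-th tangential derivative `δ_i φ = ∂_i φ − ν^i ∑_j (∂_j φ) ν^j`. -/
def tderiv (ν : Eu n → Eu n) (i : Fin (n + 1)) (φ : Eu n → ℝ) (x : Eu n) : ℝ :=
  fderiv ℝ φ x (EuclideanSpace.single i 1)
    - ν x i * ∑ j, fderiv ℝ φ x (EuclideanSpace.single j 1) * ν x j

/-- The tangential gradient `∇_T φ = ∇φ − (∇φ·ν)ν`. -/
def tgrad (ν : Eu n → Eu n) (φ : Eu n → ℝ) (x : Eu n) : Eu n :=
  gradient φ x - ⟪gradient φ x, ν x⟫ • ν x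

/-- The tangential divergence `div_T Z = ∑ i δ_i Z^i`. -/
def tdiv (ν : Eu n → Eu n) (Z : Eu n → Eu n) (x : Eu n) : ℝ :=
  ∑ i, tderiv ν i (fun y => Z y i) x

/-- The mean curvature `H = div_T ν` (sum of the principal curvatures). -/
def meanCurv (M : Hypersurface n) (x : Eu n) : ℝ := tdiv M.nu M.nu x

/-- The Laplace–Beltrami operator `Δφ = div_T (∇_T φ)`. -/
def lapBel (ν : Eu n → Eu n) (φ : Eu n → ℝ) (x : Eu n) : ℝ := tdiv ν (tgrad ν φ) x

/-- The surface measure on `M`: the `n`-dimensional Hausdorff measure restricted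
to the carrier of `M`. -/
def surfMeasure (M : Hypersurface n) : Measure (Eu n) :=
  (μH[(n : ℝ)]).restrict M.carrier

/-- `C^1` functions with compact support in a set `S`: ambient `C^1` functions
vanishing on `S` outside a compact subset `K ⊆ S`. -/
def C1cOn (S : Set (Eu n)) (φ : Eu n → ℝ) : Prop :=
  ContDiff ℝ 1 φ ∧ ∃ K : Set (Eu n), IsCompact K ∧ K ⊆ S ∧ ∀ x ∈ S, x ∉ K → φ x = 0

namespace HS
open Set Filter Topology Module

abbrev Fu (n : ℕ) := EuclideanSpace ℝ (Fin n)

/-- graph map -/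
def gmap (i : Fin (n + 1)) (g : Fu n → ℝ) (u : Fu n) : Eu n :=
  WithLp.toLp 2 (i.insertNth (g u) (fun k => u k))

/-- projection -/
def prj (i : Fin (n + 1)) (x : Eu n) : Fu n := WithLp.toLp 2 (fun k => x (i.succAbove k))

@[simp] lemma gmap_same (i : Fin (n + 1)) (g : Fu n → ℝ) (u : Fu n) : gmap i g u i = g u := by
  simp [gmap]

@[simp] lemma gmap_succ (i : Fin (n + 1)) (g : Fu n → ℝ) (u : Fu n) (k : Fin n) :
    gmap i g u (i.succAbove k) = u k := by
  simp [gmap]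

@[simp] lemma prj_apply (i : Fin (n + 1)) (x : Eu n) (k : Fin n) :
    prj i x k = x (i.succAbove k) := rfl

@[simp] lemma prj_gmap (i : Fin (n + 1)) (g : Fu n → ℝ) (u : Fu n) : prj i (gmap i g u) = u := by
  ext k; simp

lemma continuous_prj (i : Fin (n + 1)) : Continuous (prj (n := n) i) := by
  unfold prj; fun_prop

lemma gmap_dist_sq (i : Fin (n + 1)) (g : Fu n → ℝ) (u v : Fu n) :
    ‖gmap i g u - gmap i g v‖ ^ 2 = (g u - g v) ^ 2 + ‖u - v‖ ^ 2 := by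
  rw [EuclideanSpace.norm_sq_eq, EuclideanSpace.norm_sq_eq, Fin.sum_univ_succAbove _ i]
  simp

def glin (i : Fin (n + 1)) (l : Fu n →L[ℝ] ℝ) : Fu n →ₗ[ℝ] Eu n where
  toFun := gmap i l
  map_add' u v := by
    ext j; refine Fin.succAboveCases i ?_ ?_ j <;> simp
  map_smul' u v := by
    ext j; refine Fin.succAboveCases i ?_ ?_ j <;> simp

lemma glin_norm_sq (i : Fin (n + 1)) (l : Fu n →L[ℝ] ℝ) (u : Fu n) :
    ‖glin i l u‖ ^ 2 = (l u) ^ 2 + ‖u‖ ^ 2 := by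
  rw [EuclideanSpace.norm_sq_eq, EuclideanSpace.norm_sq_eq, Fin.sum_univ_succAbove _ i]
  simp [glin]

lemma norm_dual_sq (l : Fu n →L[ℝ] ℝ) :
    ‖l‖ ^ 2 = ∑ k, (l (EuclideanSpace.single k 1)) ^ 2 := by
  obtain ⟨a, rfl⟩ := (InnerProductSpace.toDual ℝ (Fu n)).surjective l
  rw [LinearIsometryEquiv.norm_map, EuclideanSpace.norm_sq_eq]
  simp [EuclideanSpace.inner_single_right]

lemma normDet_glin (i : Fin (n + 1)) (l : Fu n →L[ℝ] ℝ) :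
    (glin i l).normDet = Real.sqrt (1 + ‖l‖ ^ 2) := by
  have h := (glin i l).normDet_sq_eq_det_gram (EuclideanSpace.basisFun (Fin n) ℝ)
  have h2 : (Matrix.gram ℝ fun k => glin i l (EuclideanSpace.basisFun (Fin n) ℝ k)) =
      1 + Matrix.replicateCol Unit (fun k => l (EuclideanSpace.single k 1)) *
        Matrix.replicateRow Unit (fun k => l (EuclideanSpace.single k 1)) := by
    ext j k
    simp only [Matrix.gram, Matrix.of_apply, Matrix.add_apply, Matrix.mul_apply]
    simp only [PiLp.inner_apply, Fin.sum_univ_succAbove _ i]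
    simp [glin, Matrix.one_apply, mul_comm, add_comm, eq_comm]
  rw [h2, Matrix.det_one_add_replicateCol_mul_replicateRow] at h
  have h3 : (glin i l).normDet ^ 2 = 1 + ‖l‖ ^ 2 := by
    rw [norm_dual_sq]
    simpa [dotProduct, sq] using h
  rw [← h3, Real.sqrt_sq (LinearMap.normDet_nonneg _)]

lemma hausdorff_compare {X Y Z : Type*} [MetricSpace Y] [MetricSpace Z]
    [MeasurableSpace Y] [BorelSpace Y] [MeasurableSpace Z] [BorelSpace Z]
    (a : X → Y) (b : X → Z) (E : Set X) (K : NNReal)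
    (h : ∀ u ∈ E, ∀ v ∈ E, dist (a u) (a v) ≤ K * dist (b u) (b v)) (d : ℝ) (hd : 0 ≤ d) :
    μH[d] (a '' E) ≤ (K : ENNReal) ^ d * μH[d] (b '' E) := by
  classical
  rcases E.eq_empty_or_nonempty with rfl | ⟨x0, hx0⟩
  · simp
  let t : Z → Y := fun z => if hz : ∃ u ∈ E, b u = z then a hz.choose else a x0
  have ht : ∀ u ∈ E, t (b u) = a u := by
    intro u hu
    have hz : ∃ v ∈ E, b v = b u := ⟨u, hu, rfl⟩
    have : t (b u) = a hz.choose := by simp only [t]; rw [dif_pos hz]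
    rw [this]
    have h1 := h _ hz.choose_spec.1 _ hu
    rw [hz.choose_spec.2, dist_self, mul_zero] at h1
    exact dist_le_zero.1 h1
  have hL : LipschitzOnWith K t (b '' E) := by
    apply LipschitzOnWith.of_dist_le_mul
    rintro _ ⟨u, hu, rfl⟩ _ ⟨v, hv, rfl⟩
    rw [ht u hu, ht v hv]; exact h u hu v hv
  have := hL.hausdorffMeasure_image_le hd
  rwa [image_image, image_congr ht] at this

lemma glin_dist (i : Fin (n + 1)) (g : Fu n → ℝ) (l : Fu n →L[ℝ] ℝ) (u v : Fu n) (ε : ℝ)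
    (hε : 0 ≤ ε) (h : |g u - g v - l (u - v)| ≤ ε * ‖u - v‖) :
    dist (gmap i g u) (gmap i g v) ≤ (1 + ε) * dist (glin i l u) (glin i l v) ∧
    (1 - ε) * dist (glin i l u) (glin i l v) ≤ dist (gmap i g u) (gmap i g v) := by
  have key : ‖(gmap i g u - gmap i g v) - glin i l (u - v)‖ ≤ ε * ‖glin i l (u - v)‖ := by
    have e : (gmap i g u - gmap i g v) - glin i l (u - v) =
        EuclideanSpace.single i (g u - g v - l (u - v)) := by
      ext j; refine Fin.succAboveCases i ?_ ?_ j <;> simp [glin]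
    rw [e, PiLp.norm_single, Real.norm_eq_abs]
    refine h.trans (mul_le_mul_of_nonneg_left ?_ hε)
    have := glin_norm_sq i l (u - v)
    apply le_of_sq_le_sq _ (norm_nonneg _)
    rw [this]; nlinarith [sq_nonneg (l (u - v))]
  rw [dist_eq_norm, dist_eq_norm, ← map_sub]
  constructor
  · have := norm_sub_norm_le (gmap i g u - gmap i g v) (glin i l (u - v))
    linarith
  · have := norm_sub_norm_le (glin i l (u - v)) (gmap i g u - gmap i g v)
    rw [norm_sub_rev (glin i l (u - v))] at this
    linarith

/-- local two sided estimate -/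
lemma local_area (i : Fin (n + 1)) (g : Fu n → ℝ) (u0 : Fu n) (l : Fu n →L[ℝ] ℝ)
    (hg : HasStrictFDerivAt g l u0) (ε : NNReal) (hε : 0 < ε) (hε1 : ε < 1) :
    ∃ N ∈ 𝓝 u0, (∀ u ∈ N, ∀ v ∈ N, |g u - g v - l (u - v)| ≤ ε * ‖u - v‖) ∧ ∀ E ⊆ N,
      μH[n] (gmap i g '' E) ≤ ((1 + ε : NNReal) : ENNReal) ^ n *
        (ENNReal.ofReal (Real.sqrt (1 + ‖l‖ ^ 2)) * μH[n] E) ∧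
      ENNReal.ofReal (Real.sqrt (1 + ‖l‖ ^ 2)) * μH[n] E ≤
        (((1 - ε)⁻¹ : NNReal) : ENNReal) ^ n * μH[n] (gmap i g '' E) := by
  obtain ⟨N, hN, hN2⟩ := hg.approximates_deriv_on_nhds (c := ε) (Or.inr hε)
  have hN3 : ∀ u ∈ N, ∀ v ∈ N, |g u - g v - l (u - v)| ≤ ε * ‖u - v‖ :=
    fun u hu v hv => hN2 u hu v hv
  refine ⟨N, hN, hN3, fun E hE => ?_⟩
  have hA : μH[n] (glin i l '' E) =
      ENNReal.ofReal (Real.sqrt (1 + ‖l‖ ^ 2)) * μH[n] E := by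
    have := (glin i l).hausdorffMeasure_image E
    rwa [normDet_glin, finrank_euclideanSpace_fin] at this
  rw [← hA]
  have hd : ∀ u ∈ E, ∀ v ∈ E, _ := fun u hu v hv =>
    glin_dist i g l u v ε ε.2 (hN3 u (hE hu) v (hE hv))
  rw [← ENNReal.rpow_natCast, ← ENNReal.rpow_natCast]
  constructor
  · apply hausdorff_compare _ _ _ _ _ _ (by positivity)
    intro u hu v hv
    simpa using (hd u hu v hv).1
  · apply hausdorff_compare _ _ _ _ _ _ (by positivity)
    intro u hu v hv
    have := (hd u hu v hv).2
    have h1 : (0:ℝ) < 1 - ε := by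
      have : (ε:ℝ) < 1 := by exact_mod_cast hε1
      linarith
    rw [NNReal.coe_inv, NNReal.coe_sub hε1.le, NNReal.coe_one, inv_mul_eq_div, le_div_iff₀ h1]
    linarith

/-- Jacobian of the graph map -/
def Wg (g : Fu n → ℝ) (u : Fu n) : ℝ := Real.sqrt (1 + ‖fderiv ℝ g u‖ ^ 2)

lemma Wg_pos (g : Fu n → ℝ) (u : Fu n) : 0 < Wg g u := Real.sqrt_pos.2 (by positivity)

lemma contOn_Wg {g : Fu n → ℝ} {V : Set (Fu n)} (hV : IsOpen V) (hg : ContDiffOn ℝ 1 g V) :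
    ContinuousOn (Wg g) V := by
  have := hg.continuousOn_fderiv_of_isOpen hV le_rfl
  unfold Wg
  fun_prop

/-- local density: lower bound for the area of the graph -/
lemma graph_density (i : Fin (n + 1)) {g : Fu n → ℝ} {V : Set (Fu n)} (hV : IsOpen V)
    (hg : ContDiffOn ℝ 1 g V) {u0 : Fu n} (hu0 : u0 ∈ V) :
    ∃ r0 > 0, ∀ r > 0, r < r0 →
      ENNReal.ofReal (r / 4) ^ n * μH[n] (Metric.ball (0 : Fu n) 1) ≤
        μH[n] (gmap i g '' V ∩ Metric.closedBall (gmap i g u0) r) := by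
  have hs : HasStrictFDerivAt g (fderiv ℝ g u0) u0 :=
    (hg.contDiffAt (hV.mem_nhds hu0)).hasStrictFDerivAt one_ne_zero
  obtain ⟨N, hN, hN2, hN3⟩ := local_area i g u0 _ hs (1/2) (by norm_num)
    (by rw [← NNReal.coe_lt_coe]; norm_num)
  obtain ⟨δ, hδ, hδN⟩ := Metric.mem_nhds_iff.1 (inter_mem hN (hV.mem_nhds hu0))
  set l := fderiv ℝ g u0
  refine ⟨δ, hδ, fun r hr hrδ => ?_⟩
  let E : Set (Fu n) := {u | ‖glin i l (u - u0)‖ ≤ r / 2}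
  have hge : ∀ w, ‖w‖ ≤ ‖glin i l w‖ := fun w => by
    apply le_of_sq_le_sq _ (norm_nonneg _)
    rw [glin_norm_sq]; nlinarith [sq_nonneg (l w)]
  have hE : E ⊆ N ∩ V := by
    intro u hu
    apply hδN
    rw [Metric.mem_ball, dist_eq_norm]
    have := hge (u - u0)
    simp only [E, mem_ofPred_eq] at hu
    linarith
  have h1 := (hN3 E (hE.trans inter_subset_left)).2
  have hsub : gmap i g '' E ⊆ gmap i g '' V ∩ Metric.closedBall (gmap i g u0) r := by
    rintro _ ⟨u, hu, rfl⟩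
    refine ⟨⟨u, (hE hu).2, rfl⟩, ?_⟩
    have := (glin_dist i g l u u0 (1/2) (by norm_num)
      (by simpa using hN2 u (hE hu).1 u0 (mem_of_mem_nhds hN))).1
    rw [Metric.mem_closedBall]
    rw [dist_eq_norm (glin i l u), ← map_sub] at this
    simp only [E, mem_ofPred_eq] at hu
    linarith
  have hinj : Function.Injective (glin i l) := by
    rw [injective_iff_map_eq_zero]
    intro w hw
    have := hge w
    rw [hw, norm_zero] at this
    exact norm_le_zero_iff.1 this
  have hfr : finrank ℝ (LinearMap.range (glin i l)) = n := by
    rw [LinearMap.finrank_range_of_inj hinj, finrank_euclideanSpace_fin]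
  let j : LinearMap.range (glin i l) ≃ₗᵢ[ℝ] Fu n := 
    ((stdOrthonormalBasis ℝ (LinearMap.range (glin i l))).reindex (finCongr hfr)).repr
  have h2 : μH[n] (Metric.ball (0 : Fu n) (r / 2)) ≤ μH[n] (glin i l '' E) := by
    have h3 := hausdorff_compare (fun y : Fu n => y)
      (fun y : Fu n => glin i l u0 + (j.symm y : Eu n)) (Metric.ball 0 (r / 2)) 1
      (by
        intro u _ v _
        rw [dist_add_left, ← Subtype.dist_eq, j.symm.dist_map]; simp) n (by positivity)
    rw [ENNReal.coe_one, ENNReal.one_rpow, one_mul, image_id'] at h3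
    refine h3.trans (measure_mono ?_)
    rintro _ ⟨y, hy, rfl⟩
    obtain ⟨w, hw⟩ := (j.symm y).2
    refine ⟨u0 + w, ?_, by simp only [map_add, hw]⟩
    simp only [E, mem_ofPred_eq, add_sub_cancel_left, hw]
    rw [← Submodule.coe_norm, j.symm.norm_map]
    simpa using (mem_ball_zero_iff.1 hy).le
  have hA : μH[n] (glin i l '' E) =
      ENNReal.ofReal (Real.sqrt (1 + ‖l‖ ^ 2)) * μH[n] E := by
    have := (glin i l).hausdorffMeasure_image E
    rwa [normDet_glin, finrank_euclideanSpace_fin] at this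
  rw [← hA] at h1
  have h4 := (h2.trans h1).trans (mul_le_mul_right (measure_mono hsub) _)
  have : (μH[n] : Measure (Fu n)).IsAddHaarMeasure := by
    have := isAddHaarMeasure_hausdorffMeasure (E := Fu n)
    rwa [finrank_euclideanSpace_fin] at this
  rw [Measure.addHaar_ball_of_pos _ _ (by positivity), finrank_euclideanSpace_fin] at h4
  have e2 : ((((1 - 1 / 2 : NNReal))⁻¹ : NNReal) : ENNReal) = 2 := by
    have : ((1 - 1 / 2 : NNReal))⁻¹ = 2 := by
      rw [← NNReal.coe_inj, NNReal.coe_inv, NNReal.coe_sub (by rw [← NNReal.coe_le_coe]; norm_num)]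
      norm_num
    rw [this]; rfl
  rw [e2] at h4
  have h5 : (2:ENNReal) ^ n * (ENNReal.ofReal (r / 4) ^ n * μH[n] (Metric.ball (0 : Fu n) 1)) ≤
      2 ^ n * μH[n] (gmap i g '' V ∩ Metric.closedBall (gmap i g u0) r) := by
    refine le_trans (le_of_eq ?_) h4
    rw [← mul_assoc, ← mul_pow]
    congr 1
    rw [ENNReal.ofReal_pow (by positivity)]
    congr 1
    rw [show (2:ENNReal) = ENNReal.ofReal 2 by simp, ← ENNReal.ofReal_mul (by norm_num)]
    congr 1; ring
  exact (ENNReal.mul_le_mul_iff_right (by simp) (by simp)).1 h5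

/-- local comparison -/
lemma local_area2 (i : Fin (n + 1)) {g : Fu n → ℝ} {V : Set (Fu n)} (hV : IsOpen V)
    (hg : ContDiffOn ℝ 1 g V) {u0 : Fu n} (hu0 : u0 ∈ V) (c : NNReal) (hc : 1 < c) :
    ∃ N ∈ 𝓝 u0, N ⊆ V ∧ ∀ E ⊆ N, MeasurableSet E →
      μH[n] (gmap i g '' E) ≤ c * ∫⁻ u in E, ENNReal.ofReal (Wg g u) ∂μH[n] ∧
      ∫⁻ u in E, ENNReal.ofReal (Wg g u) ∂μH[n] ≤ c * μH[n] (gmap i g '' E) := by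
  have hs : HasStrictFDerivAt g (fderiv ℝ g u0) u0 :=
    (hg.contDiffAt (hV.mem_nhds hu0)).hasStrictFDerivAt one_ne_zero
  obtain ⟨ε, hε, hε1, hc1, hc2⟩ : ∃ ε : NNReal, 0 < ε ∧ ε < 1 ∧ (1 + ε) ^ n * (1 + ε) < c ∧
      (1 + ε) * ((1 - ε)⁻¹) ^ n < c := by
    have t1 : Tendsto (fun ε : NNReal => (1 + ε) ^ n * (1 + ε)) (𝓝[>] 0) (𝓝 ((1 + 0) ^ n * (1 + 0))) :=
      (Continuous.tendsto (by fun_prop) 0).mono_left nhdsWithin_le_nhds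
    have t2 : Tendsto (fun ε : NNReal => (1 + ε) * ((1 - ε)⁻¹) ^ n) (𝓝[>] 0)
        (𝓝 ((1 + 0) * ((1 - 0)⁻¹) ^ n)) := by
      refine Tendsto.mono_left ?_ (nhdsWithin_le_nhds)
      refine Tendsto.mul (Continuous.tendsto (by fun_prop) 0) (Tendsto.pow (Tendsto.inv₀ ?_ (by simp)) n)
      exact Continuous.tendsto (by fun_prop) 0
    have e1 := t1.eventually_lt_const (by simpa using hc)
    have e2 := t2.eventually_lt_const (by simpa using hc)
    have e3 : ∀ᶠ ε : NNReal in 𝓝[>] 0, ε < 1 :=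
      mem_nhdsWithin_of_mem_nhds (Iio_mem_nhds one_pos)
    have e4 : ∀ᶠ ε : NNReal in 𝓝[>] 0, 0 < ε := self_mem_nhdsWithin
    obtain ⟨ε, h1, h2, h3, h4⟩ := (e1.and (e2.and (e3.and e4))).exists
    exact ⟨ε, h4, h3, h1, h2⟩
  obtain ⟨N, hN, -, hN3⟩ := local_area i g u0 _ hs ε hε hε1
  set J := Wg g u0 with hJ
  have hJp : 0 < J := Wg_pos _ _
  have hcont : ContinuousAt (Wg g) u0 := (contOn_Wg hV hg).continuousAt (hV.mem_nhds hu0)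
  have hε' : (0:ℝ) < ε := hε
  have c1 : ∀ᶠ u in 𝓝 u0, Wg g u < (1 + ε) * J :=
    hcont.eventually_lt_const (by nlinarith)
  have c2 : ∀ᶠ u in 𝓝 u0, J / (1 + ε) < Wg g u :=
    hcont.eventually_const_lt (by rw [div_lt_iff₀ (by positivity)]; nlinarith)
  refine ⟨N ∩ (V ∩ ({u | Wg g u < (1 + ε) * J} ∩ {u | J / (1 + ε) < Wg g u})),
    inter_mem hN (inter_mem (hV.mem_nhds hu0) (inter_mem c1 c2)),
    inter_subset_right.trans inter_subset_left, fun E hE hEm => ?_⟩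
  obtain ⟨a1, a2⟩ := hN3 E (hE.trans inter_subset_left)
  have hc0 : ENNReal.ofReal (1 + ε) = ((1 + ε : NNReal) : ENNReal) := by
    rw [← ENNReal.ofReal_coe_nnreal]; simp
  have b1 : ∫⁻ u in E, ENNReal.ofReal (Wg g u) ∂μH[n] ≤
      ((1 + ε : NNReal) : ENNReal) * (ENNReal.ofReal J * μH[n] E) := by
    calc _ ≤ ∫⁻ u in E, ENNReal.ofReal ((1 + ε) * J) ∂μH[n] :=
          setLIntegral_mono' hEm fun u hu => ENNReal.ofReal_le_ofReal (hE hu).2.2.1.le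
      _ = _ := by
          rw [setLIntegral_const, ENNReal.ofReal_mul (by positivity), hc0, mul_assoc]
  have b2 : ENNReal.ofReal J * μH[n] E ≤ 
      ((1 + ε : NNReal) : ENNReal) * ∫⁻ u in E, ENNReal.ofReal (Wg g u) ∂μH[n] := by
    calc _ = ∫⁻ u in E, ENNReal.ofReal J ∂μH[n] := by rw [setLIntegral_const]
      _ ≤ ∫⁻ u in E, ((1 + ε : NNReal) : ENNReal) * ENNReal.ofReal (Wg g u) ∂μH[n] := by
          refine setLIntegral_mono' hEm fun u hu => ?_
          rw [← hc0, ← ENNReal.ofReal_mul (by positivity)]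
          apply ENNReal.ofReal_le_ofReal
          have := (hE hu).2.2.2
          simp only [mem_ofPred_eq] at this
          rw [div_lt_iff₀ (by positivity)] at this
          linarith
      _ = _ := by rw [lintegral_const_mul' _ _ ENNReal.coe_ne_top]
  constructor
  · refine a1.trans ((mul_le_mul_right b2 _).trans ?_)
    rw [← mul_assoc]
    refine mul_le_mul_left ?_ _
    exact_mod_cast hc1.le
  · refine b1.trans ((mul_le_mul_right a2 _).trans ?_)
    rw [← mul_assoc]
    refine mul_le_mul_left ?_ _
    exact_mod_cast hc2.le

lemma le_of_forall_one_lt {a b : ENNReal} (h : ∀ c : NNReal, 1 < c → a ≤ c * b) : a ≤ b := by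
  rcases eq_or_ne b 0 with rfl | hb
  · simpa using h 2 (by norm_num)
  rcases eq_or_ne b ⊤ with rfl | hb2
  · simp
  have t : Tendsto (fun c : NNReal => (c : ENNReal) * b) (𝓝[>] 1) (𝓝 (((1:NNReal) : ENNReal) * b)) := by
    refine ENNReal.Tendsto.mul_const ?_ (Or.inr hb2)
    exact (ENNReal.continuous_coe.tendsto 1).mono_left nhdsWithin_le_nhds
  have := ge_of_tendsto t (show ∀ᶠ c : NNReal in 𝓝[>] 1, a ≤ c * b from by
    filter_upwards [self_mem_nhdsWithin] with c hc using h c hc)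
  simpa using this

theorem area_graph (i : Fin (n + 1)) {g : Fu n → ℝ} {V : Set (Fu n)} (hV : IsOpen V)
    (hg : ContDiffOn ℝ 1 g V) :
    Measure.map (prj i) ((μH[n]).restrict (gmap i g '' V)) =
      ((μH[n]).restrict V).withDensity (fun u => ENNReal.ofReal (Wg g u)) := by
  set m1 := Measure.map (prj i) ((μH[n]).restrict (gmap i g '' V))
  set m2 := ((μH[n]).restrict V).withDensity (fun u => ENNReal.ofReal (Wg g u))
  have hpm : Measurable (prj (n := n) i) := (continuous_prj i).measurable
  have e1 : ∀ E, MeasurableSet E → m1 E = μH[n] (gmap i g '' (E ∩ V)) := by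
    intro E hE
    rw [Measure.map_apply hpm hE, Measure.restrict_apply (hpm hE)]
    congr 1
    ext x; constructor
    · rintro ⟨hx, u, hu, rfl⟩
      exact ⟨u, ⟨by simpa using hx, hu⟩, rfl⟩
    · rintro ⟨u, hu, rfl⟩
      exact ⟨by simpa using hu.1, u, hu.2, rfl⟩
  have e2 : ∀ E, MeasurableSet E → m2 E = ∫⁻ u in E ∩ V, ENNReal.ofReal (Wg g u) ∂μH[n] := by
    intro E hE
    rw [withDensity_apply _ hE, Measure.restrict_restrict hE]
  have main : ∀ c : NNReal, 1 < c → ∀ E, MeasurableSet E → m1 E ≤ c * m2 E ∧ m2 E ≤ c * m1 E := by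
    intro c hc E hE
    have hch : ∀ u ∈ V, ∃ N ∈ 𝓝 u, N ⊆ V ∧ ∀ E ⊆ N, MeasurableSet E →
      μH[n] (gmap i g '' E) ≤ c * ∫⁻ u in E, ENNReal.ofReal (Wg g u) ∂μH[n] ∧
      ∫⁻ u in E, ENNReal.ofReal (Wg g u) ∂μH[n] ≤ c * μH[n] (gmap i g '' E) :=
      fun u hu => local_area2 i hV hg hu c hc
    choose! N hN hNV hN2 using hch
    obtain ⟨t, htV, htc, ht⟩ := TopologicalSpace.countable_cover_nhdsWithin
      (s := V) (f := fun u => interior (N u))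
      (fun u hu => mem_nhdsWithin_of_mem_nhds (interior_mem_nhds.2 (hN u hu)))
    rcases t.eq_empty_or_nonempty with rfl | hne
    · have : V = ∅ := by simpa using ht
      rw [e1 E hE, e2 E hE, this]; simp
    obtain ⟨f, hf⟩ := htc.exists_eq_range hne
    have hfV : ∀ k, f k ∈ V := fun k => htV (hf ▸ mem_range_self k)
    let D := disjointed (fun k => interior (N (f k)))
    have hDm : ∀ k, MeasurableSet (D k) :=
      fun k => MeasurableSet.disjointed (fun k => isOpen_interior.measurableSet) k
    have hDsub : ∀ k, D k ⊆ N (f k) := fun k => (disjointed_subset _ k).trans interior_subset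
    have hDu : ⋃ k, E ∩ D k = E ∩ V := by
      rw [← inter_iUnion, iUnion_disjointed]
      congr 1
      apply subset_antisymm
      · exact iUnion_subset fun k => interior_subset.trans (hNV _ (hfV k))
      · refine ht.trans ?_
        rw [hf, biUnion_range]
    have hDV : ∀ k, E ∩ D k ∩ V = E ∩ D k :=
      fun k => inter_eq_left.2 (inter_subset_right.trans ((hDsub k).trans (hNV _ (hfV k))))
    have hdis : Pairwise (Function.onFun Disjoint fun k => E ∩ D k) := fun a b hab =>
      (disjoint_disjointed _ hab).mono inter_subset_right inter_subset_right
    have d1 : m1 E = ∑' k, m1 (E ∩ D k) := by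
      rw [← measure_iUnion hdis (fun k => hE.inter (hDm k)), hDu, e1 _ hE,
        e1 _ (hE.inter hV.measurableSet), inter_assoc, inter_self]
    have d2 : m2 E = ∑' k, m2 (E ∩ D k) := by
      rw [← measure_iUnion hdis (fun k => hE.inter (hDm k)), hDu, e2 _ hE,
        e2 _ (hE.inter hV.measurableSet), inter_assoc, inter_self]
    have hk : ∀ k, m1 (E ∩ D k) ≤ c * m2 (E ∩ D k) ∧ m2 (E ∩ D k) ≤ c * m1 (E ∩ D k) := by
      intro k
      rw [e1 _ (hE.inter (hDm k)), e2 _ (hE.inter (hDm k)), hDV]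
      exact hN2 _ (hfV k) _ (inter_subset_right.trans (hDsub k)) (hE.inter (hDm k))
    rw [d1, d2, ← ENNReal.tsum_mul_left, ← ENNReal.tsum_mul_left]
    exact ⟨ENNReal.tsum_le_tsum fun k => (hk k).1, ENNReal.tsum_le_tsum fun k => (hk k).2⟩
  ext E hE
  apply le_antisymm
  · exact le_of_forall_one_lt fun c hc => (main c hc E hE).1
  · exact le_of_forall_one_lt fun c hc => (main c hc E hE).2

end HS

namespace HS
open Set Filter Topology Module

lemma hasFDerivAt_gmap (i : Fin (n + 1)) {g : Fu n → ℝ} {l : Fu n →L[ℝ] ℝ} {u : Fu n}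
    (h : HasFDerivAt g l u) :
    HasFDerivAt (gmap i g) (LinearMap.toContinuousLinearMap (glin i l)) u := by
  rw [← hasFDerivWithinAt_univ, hasFDerivWithinAt_euclidean]
  intro j
  rw [hasFDerivWithinAt_univ]
  refine Fin.succAboveCases i ?_ (fun k => ?_) j
  · have e : (EuclideanSpace.proj i : Eu n →L[ℝ] ℝ) ∘L
        (LinearMap.toContinuousLinearMap (glin i l)) = l := by
      ext v; simp [glin]
    rw [e]; simpa using h
  · have e : (EuclideanSpace.proj (i.succAbove k) : Eu n →L[ℝ] ℝ) ∘L
        (LinearMap.toContinuousLinearMap (glin i l)) = EuclideanSpace.proj k := by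
      ext v; simp [glin]
    rw [e]
    simp only [gmap_succ]
    exact (EuclideanSpace.proj (𝕜 := ℝ) k).hasFDerivAt

lemma glin_single (i : Fin (n + 1)) (l : Fu n →L[ℝ] ℝ) (k : Fin n) :
    glin i l (EuclideanSpace.single k 1) = EuclideanSpace.single (i.succAbove k) 1 +
      l (EuclideanSpace.single k 1) • EuclideanSpace.single i (1:ℝ) := by
  ext j; refine Fin.succAboveCases i ?_ (fun m => ?_) j
  · simp [glin]
  · simp [glin]

lemma gradient_apply {f : Eu n → ℝ} {x : Eu n} (j : Fin (n + 1)) :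
    gradient f x j = fderiv ℝ f x (EuclideanSpace.single j 1) := by
  have h2 : inner ℝ (gradient f x) (EuclideanSpace.single j (1:ℝ)) =
      fderiv ℝ f x (EuclideanSpace.single j 1) := by
    simp [gradient]
  rw [← h2, EuclideanSpace.inner_single_right]; simp

structure IsChart (M : Hypersurface n) (i : Fin (n + 1)) (O : Set (Eu n)) (V : Set (Fu n))
    (g : Fu n → ℝ) (s : ℝ) : Prop where
  isOpen_O : IsOpen O
  isOpen_V : IsOpen V
  contDiff : ContDiffOn ℝ 2 g V
  image : M.carrier ∩ O = gmap i g '' V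
  sgn : s = 1 ∨ s = -1
  pos : ∀ u ∈ V, 0 < s * M.nu (gmap i g u) i
  tang : ∀ u ∈ V, ∀ k, M.nu (gmap i g u) (i.succAbove k) =
    - M.nu (gmap i g u) i * fderiv ℝ g u (EuclideanSpace.single k 1)

lemma exists_chart (M : Hypersurface n) {x0 : Eu n} (hx0 : x0 ∈ M.carrier) :
    ∃ i O V g s, x0 ∈ O ∧ IsChart M i O V g s := by
  obtain ⟨U, hU, hxU, f, hf, hMU, hgrad, hnu⟩ := M.locally_level_set x0 hx0
  obtain ⟨i, hi⟩ : ∃ i, gradient f x0 i ≠ 0 := by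
    by_contra! h
    exact hgrad x0 hxU (by ext j; simpa using h j)
  have hfd : ∀ x, HasFDerivAt f (fderiv ℝ f x) x :=
    fun x => (hf.differentiable (by simp) x).hasFDerivAt
  let Ψ : Eu n → Eu n := fun x => x + (f x - x i) • EuclideanSpace.single i (1:ℝ)
  have hΨ : ContDiff ℝ (⊤ : ℕ∞) Ψ := by
    have : ContDiff ℝ (⊤ : ℕ∞) (fun x : Eu n => x i) := by fun_prop
    fun_prop
  let D : Eu n →L[ℝ] Eu n := ContinuousLinearMap.id ℝ _ +
    (fderiv ℝ f x0 - EuclideanSpace.proj i).smulRight (EuclideanSpace.single i (1:ℝ))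
  have hD : HasFDerivAt Ψ D x0 := by
    have h1 : HasFDerivAt (fun x : Eu n => f x - x i) (fderiv ℝ f x0 - EuclideanSpace.proj i) x0 :=
      (hfd x0).sub (EuclideanSpace.proj (𝕜 := ℝ) i).hasFDerivAt
    exact (hasFDerivAt_id x0).add (h1.smul_const _)
  have hDinj : Function.Injective (D : Eu n →ₗ[ℝ] Eu n) := by
    rw [injective_iff_map_eq_zero]
    intro v hv
    have hv' : v + (fderiv ℝ f x0 v - v i) • EuclideanSpace.single i (1:ℝ) = 0 := by
      simpa [D] using hv
    have hk : ∀ k, v (i.succAbove k) = 0 := fun k => by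
      have := congrArg (fun w : Eu n => w (i.succAbove k)) hv'
      simpa using this
    have hi2 : fderiv ℝ f x0 v = 0 := by
      have := congrArg (fun w : Eu n => w i) hv'
      simpa using this
    have hve : v = v i • EuclideanSpace.single i (1:ℝ) := by
      ext j; refine Fin.succAboveCases i ?_ (fun m => ?_) j
      · simp
      · simp [hk m]
    rw [hve, map_smul, smul_eq_mul, ← gradient_apply] at hi2
    have : v i = 0 := by
      rcases mul_eq_zero.1 hi2 with h | h
      · exact h
      · exact absurd h hi
    rw [hve, this, zero_smul]
  let De : Eu n ≃L[ℝ] Eu n := (LinearEquiv.ofInjectiveEndo (D : Eu n →ₗ[ℝ] Eu n) hDinj).toContinuousLinearEquiv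
  have hDe : HasFDerivAt Ψ (De : Eu n →L[ℝ] Eu n) x0 := by
    have : (De : Eu n →L[ℝ] Eu n) = D := by ext v; rfl
    rw [this]; exact hD
  have hΨ2 : ContDiffAt ℝ 2 Ψ x0 := (contDiff_infty.1 hΨ 2).contDiffAt
  let Ph := hΨ2.toOpenPartialHomeomorph Ψ hDe (by norm_num)
  have hPh : ∀ x, Ph x = Ψ x := fun x => rfl
  have hsrc : x0 ∈ Ph.source := hΨ2.mem_toOpenPartialHomeomorph_source hDe (by norm_num)
  have hsymm : ContDiffAt ℝ 2 Ph.symm (Ψ x0) := hΨ2.to_localInverse hDe (by norm_num)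
  have hback : Ph.symm (Ψ x0) = x0 := Ph.left_inv hsrc
  obtain ⟨s, hs, hspos⟩ : ∃ s : ℝ, (s = 1 ∨ s = -1) ∧ 0 < s * M.nu x0 i := by
    have h1 : M.nu x0 i ≠ 0 := by
      rw [hnu x0 ⟨hx0, hxU⟩]
      simp only [PiLp.smul_apply, smul_eq_mul]
      exact mul_ne_zero (inv_ne_zero (norm_ne_zero_iff.2 (hgrad x0 hxU))) hi
    rcases lt_or_gt_of_ne h1 with h | h
    · exact ⟨-1, Or.inr rfl, by linarith⟩
    · exact ⟨1, Or.inl rfl, by linarith⟩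
  have hnucont : Continuous M.nu := M.smooth_nu.continuous
  have hev : ∀ᶠ y in 𝓝 (Ψ x0), y ∈ Ph.target ∧ Ph.symm y ∈ U ∧ ContDiffAt ℝ 2 Ph.symm y ∧
      0 < s * M.nu (Ph.symm y) i := by
    have e1 : ∀ᶠ y in 𝓝 (Ψ x0), y ∈ Ph.target := Ph.open_target.mem_nhds (Ph.map_source hsrc)
    have e2 : ∀ᶠ y in 𝓝 (Ψ x0), Ph.symm y ∈ U :=
      hsymm.continuousAt.eventually_mem (by rw [hback]; exact hU.mem_nhds hxU)
    have e3 := hsymm.eventually (by simp)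
    have e4 : ∀ᶠ y in 𝓝 (Ψ x0), 0 < s * M.nu (Ph.symm y) i := by
      have : ContinuousAt (fun y => s * M.nu (Ph.symm y) i) (Ψ x0) := by
        have hc : Continuous (fun x => s * M.nu x i) := by fun_prop
        exact hc.continuousAt.comp hsymm.continuousAt
      exact this.eventually_const_lt (by simpa only [hback] using hspos)
    filter_upwards [e1, e2, e3, e4] with y h1 h2 h3 h4 using ⟨h1, h2, h3, h4⟩
  obtain ⟨T, hT, hTo, hTx⟩ := eventually_nhds_iff.1 hev
  let z : Fu n → ℝ := fun _ => 0
  have hzc : ContDiff ℝ 2 (gmap i z) := by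
    rw [contDiff_euclidean]
    intro j
    refine Fin.succAboveCases i ?_ (fun m => ?_) j
    · simp [z]; exact contDiff_const
    · simp only [gmap_succ]; fun_prop
  let V : Set (Fu n) := gmap i z ⁻¹' T
  let g : Fu n → ℝ := fun u => Ph.symm (gmap i z u) i
  have hV : IsOpen V := hTo.preimage hzc.continuous
  have hkey : ∀ u ∈ V, gmap i g u = Ph.symm (gmap i z u) ∧ f (gmap i g u) = 0 := by
    intro u hu
    have h1 : Ψ (Ph.symm (gmap i z u)) = gmap i z u := by
      rw [← hPh]; exact Ph.right_inv (hT _ hu).1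
    have h2 : gmap i g u = Ph.symm (gmap i z u) := by
      ext j; refine Fin.succAboveCases i ?_ (fun m => ?_) j
      · simp [g]
      · have := congrArg (fun w : Eu n => w (i.succAbove m)) h1
        simpa [Ψ, eq_comm] using this
    refine ⟨h2, ?_⟩
    rw [h2]
    have := congrArg (fun w : Eu n => w i) h1
    simpa [Ψ, z] using this
  have hgC : ContDiffOn ℝ 2 g V := by
    intro u hu
    apply ContDiffAt.contDiffWithinAt
    have h1 : ContDiffAt ℝ 2 (fun u => Ph.symm (gmap i z u)) u :=
      ContDiffAt.comp u (hT _ hu).2.2.1 hzc.contDiffAt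
    exact (contDiffAt_euclidean.1 h1) i
  have himg : M.carrier ∩ (Ph.source ∩ Ph ⁻¹' T) = gmap i g '' V := by
    ext x; constructor
    · rintro ⟨hxM, hxs, hxT⟩
      have hxU : x ∈ U := by
        have := (hT _ hxT).2.1
        rwa [Ph.left_inv hxs] at this
      have hfx : f x = 0 := by
        have : x ∈ {y ∈ U | f y = 0} := hMU ▸ ⟨hxM, hxU⟩
        exact this.2
      have h1 : gmap i z (prj i x) = Ph x := by
        rw [hPh]
        ext j; refine Fin.succAboveCases i ?_ (fun m => ?_) j
        · simp [Ψ, z, hfx]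
        · simp [Ψ]
      have hv : prj i x ∈ V := by
        change gmap i z (prj i x) ∈ T
        rw [h1]; exact hxT
      refine ⟨prj i x, hv, ?_⟩
      rw [(hkey _ hv).1, h1, Ph.left_inv hxs]
    · rintro ⟨u, hu, rfl⟩
      have h1 := hkey u hu
      have hmem : gmap i g u ∈ U := by rw [h1.1]; exact (hT _ hu).2.1
      refine ⟨?_, ?_, ?_⟩
      · have : gmap i g u ∈ {y ∈ U | f y = 0} := ⟨hmem, h1.2⟩
        rw [← hMU] at this
        exact this.1
      · rw [h1.1]; exact Ph.map_target (hT _ hu).1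
      · rw [mem_preimage, h1.1, Ph.right_inv (hT _ hu).1]; exact hu
  refine ⟨i, Ph.source ∩ Ph ⁻¹' T, V, g, s, ⟨hsrc, hTx⟩, 
    ⟨Ph.isOpen_inter_preimage hTo, hV, hgC, himg, hs, ?_, ?_⟩⟩
  · intro u hu
    rw [(hkey u hu).1]; exact (hT _ hu).2.2.2
  · intro u hu k
    have hgd : HasFDerivAt g (fderiv ℝ g u) u :=
      ((hgC.contDiffAt (hV.mem_nhds hu)).differentiableAt (by norm_num)).hasFDerivAt
    have hcomp := (hfd (gmap i g u)).comp u (hasFDerivAt_gmap i hgd)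
    have hzero : HasFDerivAt (f ∘ gmap i g) (0 : Fu n →L[ℝ] ℝ) u := by
      refine (hasFDerivAt_const (0:ℝ) u).congr_of_eventuallyEq ?_
      filter_upwards [hV.mem_nhds hu] with v hv using (hkey v hv).2
    have heq := hcomp.unique hzero
    have h3 := congrArg (fun L : Fu n →L[ℝ] ℝ => L (EuclideanSpace.single k 1)) heq
    simp only [ContinuousLinearMap.comp_apply, LinearMap.coe_toContinuousLinearMap', glin_single,
      map_add, map_smul, smul_eq_mul, zero_apply, ← gradient_apply] at h3
    have hmem : gmap i g u ∈ M.carrier ∩ U := by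
      refine ⟨?_, by rw [(hkey u hu).1]; exact (hT _ hu).2.1⟩
      have : gmap i g u ∈ gmap i g '' V := ⟨u, hu, rfl⟩
      rw [← himg] at this
      exact this.1
    rw [hnu _ hmem]
    simp only [PiLp.smul_apply, smul_eq_mul]
    linear_combination ‖gradient f (gmap i g u)‖⁻¹ * h3

end HS

namespace HS
open Set Filter Topology Module

lemma measurableSet_carrier (M : Hypersurface n) : MeasurableSet M.carrier := by
  have : IsLocallyClosed M.carrier := by
    refine ((isLocallyClosed_tfae M.carrier).out 0 3).2 ?_
    intro x hx
    obtain ⟨U, hU, hxU, f, hf, hMU, -, -⟩ := M.locally_level_set x hx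
    refine ⟨U, hxU, hU, ?_⟩
    rintro y ⟨hyU, hyc⟩
    have h1 : y ∈ closure (M.carrier ∩ U) := by
      rw [inter_comm]; exact hU.inter_closure ⟨hyU, hyc⟩
    have h2 : closure (M.carrier ∩ U) ⊆ {y | f y = 0} := by
      refine closure_minimal ?_ (isClosed_eq hf.continuous continuous_const)
      rw [hMU]; exact fun z hz => hz.2
    have : y ∈ M.carrier ∩ U := by rw [hMU]; exact ⟨hyU, h2 h1⟩
    exact this.1
  obtain ⟨U, Z, hU, hZ, h⟩ := this
  rw [h]; exact hU.measurableSet.inter hZ.measurableSet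

variable {M : Hypersurface n} {i : Fin (n + 1)} {O : Set (Eu n)} {V : Set (Fu n)}
  {g : Fu n → ℝ} {s : ℝ}

lemma IsChart.contDiff1 (hc : IsChart M i O V g s) : ContDiffOn ℝ 1 g V :=
  hc.contDiff.of_le (by norm_num)

lemma IsChart.mem (hc : IsChart M i O V g s) {u : Fu n} (hu : u ∈ V) :
    gmap i g u ∈ M.carrier ∩ O := by rw [hc.image]; exact ⟨u, hu, rfl⟩

lemma IsChart.prj_mem (hc : IsChart M i O V g s) {x : Eu n} (hx : x ∈ M.carrier ∩ O) :
    prj i x ∈ V ∧ gmap i g (prj i x) = x := by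
  rw [hc.image] at hx
  obtain ⟨u, hu, rfl⟩ := hx
  simp [hu]

lemma IsChart.hasFDerivAt (hc : IsChart M i O V g s) {u : Fu n} (hu : u ∈ V) :
    HasFDerivAt g (fderiv ℝ g u) u :=
  ((hc.contDiff.contDiffAt (hc.isOpen_V.mem_nhds hu)).differentiableAt (by norm_num)).hasFDerivAt

lemma IsChart.contDiffOn_gmap (hc : IsChart M i O V g s) : ContDiffOn ℝ 2 (gmap i g) V := by
  rw [contDiffOn_euclidean]
  intro j
  refine Fin.succAboveCases i ?_ (fun m => ?_) j
  · simpa using hc.contDiff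
  · simp only [gmap_succ]; fun_prop

lemma haar_Fu : (μH[n] : Measure (Fu n)).IsAddHaarMeasure := by
  have := isAddHaarMeasure_hausdorffMeasure (E := Fu n)
  rwa [finrank_euclideanSpace_fin] at this

lemma IsChart.restrict_eq (hc : IsChart M i O V g s) :
    (surfMeasure M).restrict O = μH[n].restrict (gmap i g '' V) := by
  rw [surfMeasure, Measure.restrict_restrict hc.isOpen_O.measurableSet, inter_comm, hc.image]

lemma IsChart.measurable_graph (hc : IsChart M i O V g s) : MeasurableSet (gmap i g '' V) := by
  rw [← hc.image]; exact (measurableSet_carrier M).inter hc.isOpen_O.measurableSet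

lemma IsChart.area (hc : IsChart M i O V g s) :
    Measure.map (prj i) ((surfMeasure M).restrict O) =
      (μH[n].restrict V).withDensity (fun u => ENNReal.ofReal (Wg g u)) := by
  rw [hc.restrict_eq]; exact area_graph i hc.isOpen_V hc.contDiff1

lemma locally_finite (M : Hypersurface n) {x : Eu n} (hx : x ∈ M.carrier) :
    ∃ O, IsOpen O ∧ x ∈ O ∧ surfMeasure M O < ⊤ := by
  have := haar_Fu (n := n)
  obtain ⟨i, O, V, g, s, hxO, hc⟩ := exists_chart M hx
  have hv := hc.prj_mem ⟨hx, hxO⟩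
  obtain ⟨r, hr, hrV⟩ := Metric.nhds_basis_closedBall.mem_iff.1 (hc.isOpen_V.mem_nhds hv.1)
  have hcont : ContinuousOn (Wg g) (Metric.closedBall (prj i x) r) :=
    (contOn_Wg hc.isOpen_V hc.contDiff1).mono hrV
  obtain ⟨C, hC⟩ := (isCompact_closedBall (prj i x) r).exists_bound_of_continuousOn hcont
  refine ⟨O ∩ prj i ⁻¹' (Metric.ball (prj i x) r),
    hc.isOpen_O.inter (Metric.isOpen_ball.preimage (continuous_prj i)), ⟨hxO, by simpa using hr⟩, ?_⟩
  have h1 : surfMeasure M (O ∩ prj i ⁻¹' (Metric.ball (prj i x) r)) =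
      Measure.map (prj i) ((surfMeasure M).restrict O) (Metric.ball (prj i x) r) := by
    rw [Measure.map_apply (continuous_prj i).measurable Metric.isOpen_ball.measurableSet,
      Measure.restrict_apply ((continuous_prj i).measurable Metric.isOpen_ball.measurableSet),
      inter_comm]
  rw [h1, hc.area, withDensity_apply _ Metric.isOpen_ball.measurableSet,
    Measure.restrict_restrict Metric.isOpen_ball.measurableSet]
  calc ∫⁻ u in Metric.ball (prj i x) r ∩ V, ENNReal.ofReal (Wg g u) ∂μH[n]
      ≤ ∫⁻ u in Metric.ball (prj i x) r ∩ V, ENNReal.ofReal C ∂μH[n] := by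
        refine setLIntegral_mono' (Metric.isOpen_ball.measurableSet.inter
          hc.isOpen_V.measurableSet) ?_
        intro u hu
        exact ENNReal.ofReal_le_ofReal ((le_abs_self _).trans (hC u (Metric.ball_subset_closedBall hu.1)))
    _ = ENNReal.ofReal C * μH[n] (Metric.ball (prj i x) r ∩ V) := by simp
    _ < ⊤ := ENNReal.mul_lt_top ENNReal.ofReal_lt_top
        ((measure_mono inter_subset_left).trans_lt measure_ball_lt_top)

lemma compact_finite (M : Hypersurface n) {K : Set (Eu n)} (hK : IsCompact K)
    (hKM : K ⊆ M.carrier) : surfMeasure M K < ⊤ := by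
  obtain ⟨U, hU, -, h⟩ := hK.exists_open_superset_measure_lt_top' (μ := surfMeasure M) (by
    intro x hx
    obtain ⟨O, hO, hxO, h⟩ := locally_finite M (hKM hx)
    exact ⟨O, hO.mem_nhds hxO, h⟩)
  exact (measure_mono hU).trans_lt h

lemma surf_density (M : Hypersurface n) {x : Eu n} (hx : x ∈ M.carrier) :
    ∃ r0 > 0, ∀ r > 0, r < r0 →
      ENNReal.ofReal (r / 4) ^ n * μH[n] (Metric.ball (0 : Fu n) 1) ≤
        surfMeasure M (Metric.closedBall x r) := by
  obtain ⟨i, O, V, g, s, hxO, hc⟩ := exists_chart M hx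
  have hv := hc.prj_mem ⟨hx, hxO⟩
  obtain ⟨r0, h0, h⟩ := graph_density i hc.isOpen_V hc.contDiff1 hv.1
  refine ⟨r0, h0, fun r hr hr' => (h r hr hr').trans ?_⟩
  rw [hv.2, surfMeasure, Measure.restrict_apply Metric.isClosed_closedBall.measurableSet,
    ← hc.image]
  exact measure_mono fun y hy => ⟨hy.2, hy.1.1⟩

lemma ae_mem (M : Hypersurface n) : ∀ᵐ x ∂surfMeasure M, x ∈ M.carrier :=
  ae_restrict_mem (measurableSet_carrier M)

/-- continuous functions vanishing on `M` off a compact subset are integrable -/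
lemma integrable_of_supp (M : Hypersurface n) {K : Set (Eu n)} (hK : IsCompact K)
    (hKM : K ⊆ M.carrier) {F : Eu n → ℝ} (hF : Continuous F)
    (h0 : ∀ x ∈ M.carrier, x ∉ K → F x = 0) : Integrable F (surfMeasure M) := by
  have h1 : IntegrableOn F K (surfMeasure M) := by
    obtain ⟨C, hC⟩ := hK.exists_bound_of_continuousOn hF.continuousOn
    exact Measure.integrableOn_of_bounded (compact_finite M hK hKM).ne hF.aestronglyMeasurable
      ((ae_restrict_mem hK.measurableSet).mono fun x hx => hC x hx)
  refine (integrable_indicator_iff hK.measurableSet).2 h1 |>.congr ?_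
  filter_upwards [ae_mem M] with x hx
  by_cases hxK : x ∈ K
  · simp [hxK]
  · simp [hxK, h0 x hx hxK]

lemma IsChart.setIntegral (hc : IsChart M i O V g s) {F : Eu n → ℝ} (hF : Continuous F) :
    ∫ x in O, F x ∂surfMeasure M = ∫ u in V, Wg g u * F (gmap i g u) ∂μH[n] := by
  have hW : Measurable fun u => ENNReal.ofReal (V.indicator (Wg g) u) := by
    refine ENNReal.measurable_ofReal.comp ?_
    have := (contOn_Wg hc.isOpen_V hc.contDiff1)
    classical
    rw [← piecewise_eq_indicator]
    exact (this.measurable_piecewise (g := fun _ => 0) continuousOn_const hc.isOpen_V.measurableSet)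
  have hd : (μH[n].restrict V).withDensity (fun u => ENNReal.ofReal (Wg g u)) =
      (μH[n].restrict V).withDensity (fun u => ENNReal.ofReal (V.indicator (Wg g) u)) := by
    refine withDensity_congr_ae ?_
    filter_upwards [ae_restrict_mem hc.isOpen_V.measurableSet] with u hu
    simp [hu]
  have hFg : ContinuousOn (fun u => F (gmap i g u)) V :=
    hF.comp_continuousOn hc.contDiffOn_gmap.continuousOn
  have e1 : ∫ x in O, F x ∂surfMeasure M =
      ∫ x in O, (fun u => F (gmap i g u)) (prj i x) ∂surfMeasure M := by
    rw [hc.restrict_eq]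
    refine integral_congr_ae ?_
    filter_upwards [ae_restrict_mem hc.measurable_graph] with x hx
    rw [(hc.prj_mem (hc.image ▸ hx)).2]
  have e2 := integral_map (μ := (surfMeasure M).restrict O) (continuous_prj i).measurable.aemeasurable
    (f := fun u => F (gmap i g u)) (by
    rw [hc.area]
    exact (hFg.aestronglyMeasurable hc.isOpen_V.measurableSet).mono_ac
      (withDensity_absolutelyContinuous _ _))
  rw [e1, ← e2, hc.area, hd,
    integral_withDensity_eq_integral_toReal_smul hW (by simp)]
  refine setIntegral_congr_fun hc.isOpen_V.measurableSet ?_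
  intro u hu
  simp [hu, ENNReal.toReal_ofReal (Wg_pos g u).le]


end HS

namespace HS
open Set Filter Topology Module

lemma clm_sum {m : ℕ} (L : EuclideanSpace ℝ (Fin m) →L[ℝ] ℝ) (v : EuclideanSpace ℝ (Fin m)) :
    L v = ∑ k, v k * L (EuclideanSpace.single k 1) := by
  have h : v = ∑ k, v k • EuclideanSpace.single k (1:ℝ) := by
    ext j; simp [Pi.single_apply]
  conv_lhs => rw [h]
  simp

lemma tderiv_eq (ν : Eu n → Eu n) (j : Fin (n + 1)) (φ : Eu n → ℝ) (x : Eu n) :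
    tderiv ν j φ x = fderiv ℝ φ x (EuclideanSpace.single j 1 - ν x j • ν x) := by
  rw [tderiv, map_sub, map_smul, clm_sum _ (ν x), smul_eq_mul]
  simp only [mul_comm]

lemma tgrad_apply (ν : Eu n → Eu n) (j : Fin (n + 1)) (φ : Eu n → ℝ) (x : Eu n) :
    tgrad ν φ x j = tderiv ν j φ x := by
  simp only [tgrad, tderiv, PiLp.sub_apply, PiLp.smul_apply, smul_eq_mul, gradient_apply,
    PiLp.inner_apply]
  simp [mul_comm]

variable {M : Hypersurface n} {i : Fin (n + 1)} {O : Set (Eu n)} {V : Set (Fu n)}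
  {g : Fu n → ℝ} {s : ℝ}

lemma IsChart.ne (hc : IsChart M i O V g s) {u : Fu n} (hu : u ∈ V) : M.nu (gmap i g u) i ≠ 0 := by
  intro h; have := hc.pos u hu; rw [h] at this; simp at this

lemma IsChart.sum_sq (hc : IsChart M i O V g s) {u : Fu n} (hu : u ∈ V) :
    ∑ j, M.nu (gmap i g u) j ^ 2 = 1 := by
  have := M.unit_nu _ (hc.mem hu).1
  have h2 := EuclideanSpace.real_norm_sq_eq (M.nu (gmap i g u))
  rw [this] at h2; rw [← h2]; norm_num

lemma IsChart.glin_prj (hc : IsChart M i O V g s) {u : Fu n} (hu : u ∈ V) (v : Eu n)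
    (hv : ∑ j, M.nu (gmap i g u) j * v j = 0) : glin i (fderiv ℝ g u) (prj i v) = v := by
  ext j
  refine Fin.succAboveCases i ?_ (fun m => ?_) j
  · simp only [glin, LinearMap.coe_mk, AddHom.coe_mk, gmap_same]
    rw [clm_sum]
    rw [Fin.sum_univ_succAbove _ i] at hv
    simp only [hc.tang u hu] at hv
    have : M.nu (gmap i g u) i * (v i - ∑ k, (prj i v) k * fderiv ℝ g u (EuclideanSpace.single k 1)) = 0 := by
      rw [mul_sub, Finset.mul_sum, sub_eq_add_neg, ← Finset.sum_neg_distrib, ← hv]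
      congr 1
      refine Finset.sum_congr rfl fun k _ => ?_
      simp; ring
    rcases mul_eq_zero.1 this with h | h
    · exact absurd h (hc.ne hu)
    · linarith
  · simp [glin]

lemma IsChart.fderiv_comp (hc : IsChart M i O V g s) {u : Fu n} (hu : u ∈ V) {φ : Eu n → ℝ}
    (hφ : DifferentiableAt ℝ φ (gmap i g u)) (w : Fu n) :
    fderiv ℝ (fun u => φ (gmap i g u)) u w = fderiv ℝ φ (gmap i g u) (glin i (fderiv ℝ g u) w) := by
  have := (hφ.hasFDerivAt.comp u (hasFDerivAt_gmap i (hc.hasFDerivAt hu))).fderiv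
  have h2 : (fun u => φ (gmap i g u)) = φ ∘ gmap i g := rfl
  rw [h2, this]; rfl

lemma IsChart.tderiv_chart (hc : IsChart M i O V g s) {u : Fu n} (hu : u ∈ V) {φ : Eu n → ℝ}
    (hφ : DifferentiableAt ℝ φ (gmap i g u)) (j : Fin (n + 1)) :
    tderiv M.nu j φ (gmap i g u) = fderiv ℝ (fun u => φ (gmap i g u)) u
      (prj i (EuclideanSpace.single j 1 - M.nu (gmap i g u) j • M.nu (gmap i g u))) := by
  rw [hc.fderiv_comp hu hφ, hc.glin_prj hu, tderiv_eq]
  have := hc.sum_sq hu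
  simp only [PiLp.sub_apply, PiLp.smul_apply, smul_eq_mul, mul_sub, Finset.sum_sub_distrib]
  have e : ∀ x, M.nu (gmap i g u) x * (M.nu (gmap i g u) j * M.nu (gmap i g u) x) =
    M.nu (gmap i g u) j * M.nu (gmap i g u) x ^ 2 := fun x => by ring
  simp only [e, ← Finset.mul_sum, this]
  simp

lemma tderiv_congr (M : Hypersurface n) {x : Eu n} (hx : x ∈ M.carrier) {φ ψ : Eu n → ℝ}
    (hφ : DifferentiableAt ℝ φ x) (hψ : DifferentiableAt ℝ ψ x)
    (h : ∀ᶠ y in 𝓝 x, y ∈ M.carrier → φ y = ψ y) (j : Fin (n + 1)) :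
    tderiv M.nu j φ x = tderiv M.nu j ψ x := by
  obtain ⟨i, O, V, g, s, hxO, hc⟩ := exists_chart M hx
  obtain ⟨hv, hxe⟩ := hc.prj_mem ⟨hx, hxO⟩
  rw [← hxe] at hφ hψ h ⊢
  rw [hc.tderiv_chart hv hφ, hc.tderiv_chart hv hψ]
  congr 1
  apply Filter.EventuallyEq.fderiv_eq
  have hcont : ContinuousAt (gmap i g) (prj i x) :=
    hc.contDiffOn_gmap.continuousOn.continuousAt (hc.isOpen_V.mem_nhds hv)
  filter_upwards [hcont.eventually h, hc.isOpen_V.mem_nhds hv] with u h1 h2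
  exact h1 (hc.mem h2).1

lemma tgrad_congr (M : Hypersurface n) {x : Eu n} (hx : x ∈ M.carrier) {φ ψ : Eu n → ℝ}
    (hφ : DifferentiableAt ℝ φ x) (hψ : DifferentiableAt ℝ ψ x)
    (h : ∀ᶠ y in 𝓝 x, y ∈ M.carrier → φ y = ψ y) : tgrad M.nu φ x = tgrad M.nu ψ x := by
  ext j; rw [tgrad_apply, tgrad_apply]; exact tderiv_congr M hx hφ hψ h j

lemma tderiv_zero_of_supp (M : Hypersurface n) {K : Set (Eu n)} (hK : IsCompact K) {φ : Eu n → ℝ}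
    (hφ : ContDiff ℝ 1 φ) (h0 : ∀ x ∈ M.carrier, x ∉ K → φ x = 0) {x : Eu n} (hx : x ∈ M.carrier)
    (hxK : x ∉ K) (j : Fin (n + 1)) : tderiv M.nu j φ x = 0 := by
  have h := tderiv_congr M hx (ψ := fun _ => 0) (hφ.differentiable (by simp) x) (by fun_prop) (by
    filter_upwards [hK.isClosed.isOpen_compl.mem_nhds hxK] with y hy hyM using h0 y hyM hy) j
  rw [h]; simp [tderiv]

lemma tgrad_zero_of_supp (M : Hypersurface n) {K : Set (Eu n)} (hK : IsCompact K) {φ : Eu n → ℝ}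
    (hφ : ContDiff ℝ 1 φ) (h0 : ∀ x ∈ M.carrier, x ∉ K → φ x = 0) {x : Eu n} (hx : x ∈ M.carrier)
    (hxK : x ∉ K) : tgrad M.nu φ x = 0 := by
  ext j; rw [tgrad_apply, tderiv_zero_of_supp M hK hφ h0 hx hxK]; simp

lemma continuous_tderiv (M : Hypersurface n) {φ : Eu n → ℝ} (hφ : ContDiff ℝ 1 φ)
    (j : Fin (n + 1)) : Continuous (tderiv M.nu j φ) := by
  have h1 : Continuous (fderiv ℝ φ) := hφ.continuous_fderiv (by simp)
  have h2 : Continuous M.nu := M.smooth_nu.continuous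
  unfold tderiv
  fun_prop

lemma continuous_tgrad (M : Hypersurface n) {φ : Eu n → ℝ} (hφ : ContDiff ℝ 1 φ) :
    Continuous (tgrad M.nu φ) := by
  have : tgrad M.nu φ = fun x => WithLp.toLp 2 (fun j => tderiv M.nu j φ x) := by
    ext x j; rw [tgrad_apply]
  rw [this]
  have := fun j => continuous_tderiv M hφ j
  fun_prop

lemma contDiff_nu (M : Hypersurface n) (m : ℕ) : ContDiff ℝ m M.nu := contDiff_infty.1 M.smooth_nu m

lemma contDiff_nu_apply (M : Hypersurface n) (m : ℕ) (j : Fin (n + 1)) :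
    ContDiff ℝ m (fun x => M.nu x j) := by
  have := contDiff_nu M m
  fun_prop

lemma continuous_meanCurv (M : Hypersurface n) : Continuous (meanCurv M) := by
  unfold meanCurv tdiv
  have := fun j => continuous_tderiv M (contDiff_nu_apply M 1 j) j
  fun_prop

lemma IsChart.W_mul (hc : IsChart M i O V g s) {u : Fu n} (hu : u ∈ V) :
    Wg g u * M.nu (gmap i g u) i = s := by
  have h1 := hc.sum_sq hu
  rw [Fin.sum_univ_succAbove _ i] at h1
  simp only [hc.tang u hu, mul_pow, ← Finset.mul_sum, ← norm_dual_sq] at h1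
  have h2 : Wg g u ^ 2 = 1 + ‖fderiv ℝ g u‖ ^ 2 := Real.sq_sqrt (by positivity)
  have h3 : (Wg g u * M.nu (gmap i g u) i) ^ 2 = 1 := by rw [mul_pow, h2]; nlinarith
  have h4 := hc.pos u hu
  have h5 := Wg_pos g u
  have h6 : 0 < s * (Wg g u * M.nu (gmap i g u) i) := by
    have := mul_pos h5 h4; nlinarith
  rcases mul_self_eq_one_iff.1 (by rwa [sq] at h3) with h | h <;> rcases hc.sgn with h' | h' <;>
    rw [h, h'] at h6 <;> rw [h, h'] <;> norm_num at h6 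

lemma IsChart.nu_tang (hc : IsChart M i O V g s) {u : Fu n} (hu : u ∈ V) (k : Fin n) :
    Wg g u * M.nu (gmap i g u) (i.succAbove k) = - s * fderiv ℝ g u (EuclideanSpace.single k 1) := by
  rw [hc.tang u hu, ← hc.W_mul hu]; ring

lemma IsChart.contDiffOn_N (hc : IsChart M i O V g s) (j : Fin (n + 1)) :
    ContDiffOn ℝ 1 (fun u => M.nu (gmap i g u) j) V :=
  (contDiff_nu_apply M 1 j).comp_contDiffOn (hc.contDiffOn_gmap.of_le (by norm_num))

lemma IsChart.contDiffOn_fderiv (hc : IsChart M i O V g s) : ContDiffOn ℝ 1 (fderiv ℝ g) V :=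
  hc.contDiff.fderiv_of_isOpen hc.isOpen_V (by norm_num)

lemma Wg_eq (g : Fu n → ℝ) (u : Fu n) :
    Wg g u = Real.sqrt (1 + ∑ k, (fderiv ℝ g u (EuclideanSpace.single k 1)) ^ 2) := by
  rw [Wg, norm_dual_sq]

lemma IsChart.contDiffOn_W (hc : IsChart M i O V g s) : ContDiffOn ℝ 1 (Wg g) V := by
  have h := hc.contDiffOn_fderiv
  have h2 : ContDiffOn ℝ 1 (fun u => 1 + ∑ k, (fderiv ℝ g u (EuclideanSpace.single k 1)) ^ 2) V := by
    fun_prop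
  exact (h2.sqrt (fun u _ => by positivity)).congr fun u _ => Wg_eq g u

lemma IsChart.diffAt (hc : IsChart M i O V g s) {f : Fu n → ℝ} (hf : ContDiffOn ℝ 1 f V) {u : Fu n}
    (hu : u ∈ V) : DifferentiableAt ℝ f u :=
  (hf.contDiffAt (hc.isOpen_V.mem_nhds hu)).differentiableAt (by simp)

lemma IsChart.meanCurv_eq (hc : IsChart M i O V g s) {u : Fu n} (hu : u ∈ V) :
    meanCurv M (gmap i g u) = ∑ k, fderiv ℝ (fun u => M.nu (gmap i g u) (i.succAbove k)) u
      (EuclideanSpace.single k 1) := by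
  have hd : ∀ j, DifferentiableAt ℝ (fun u => M.nu (gmap i g u) j) u :=
    fun j => hc.diffAt (hc.contDiffOn_N j) hu
  have hz : ∀ k, ∑ j, M.nu (gmap i g u) j * fderiv ℝ (fun u => M.nu (gmap i g u) j) u
      (EuclideanSpace.single k 1) = 0 := by
    intro k
    have h1 : HasFDerivAt (fun u => ∑ j, M.nu (gmap i g u) j ^ 2)
        (∑ j, (2 * M.nu (gmap i g u) j) • fderiv ℝ (fun u => M.nu (gmap i g u) j) u) u := by
      refine HasFDerivAt.fun_sum fun j _ => ?_
      simpa using (hd j).hasFDerivAt.pow 2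
    have h2 : HasFDerivAt (fun u => ∑ j, M.nu (gmap i g u) j ^ 2) (0 : Fu n →L[ℝ] ℝ) u := by
      refine (hasFDerivAt_const (1:ℝ) u).congr_of_eventuallyEq ?_
      filter_upwards [hc.isOpen_V.mem_nhds hu] with v hv using hc.sum_sq hv
    have h3 := congrArg (fun L : Fu n →L[ℝ] ℝ => L (EuclideanSpace.single k 1)) (h1.unique h2)
    simp only [_root_.sum_apply, _root_.smul_apply, smul_eq_mul, zero_apply, mul_assoc,
      ← Finset.mul_sum] at h3
    linarith
  rw [meanCurv, tdiv]
  have e : ∀ j, tderiv M.nu j (fun y => M.nu y j) (gmap i g u) =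
      ∑ k, ((if j = i.succAbove k then fderiv ℝ (fun u => M.nu (gmap i g u) j) u
        (EuclideanSpace.single k 1) else 0) - M.nu (gmap i g u) (i.succAbove k) *
        (M.nu (gmap i g u) j * fderiv ℝ (fun u => M.nu (gmap i g u) j) u
          (EuclideanSpace.single k 1))) := by
    intro j
    rw [hc.tderiv_chart hu ((contDiff_nu_apply M 1 j).differentiable (by simp) _), clm_sum]
    refine Finset.sum_congr rfl fun k _ => ?_
    simp only [prj_apply, PiLp.sub_apply, PiLp.smul_apply, smul_eq_mul, PiLp.single_apply]
    by_cases h : j = i.succAbove k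
    · simp [← h]; ring
    · simp [h, Ne.symm h]; ring
  simp only [e]
  rw [Finset.sum_comm]
  refine Finset.sum_congr rfl fun k _ => ?_
  rw [Finset.sum_sub_distrib, ← Finset.mul_sum, hz]
  simp

/-- the components of the vector field used in the first variation formula -/
def Xf (M : Hypersurface n) (i : Fin (n + 1)) (g : Fu n → ℝ) (j : Fin (n + 1)) (k : Fin n)
    (u : Fu n) : ℝ :=
  Wg g u * prj i (EuclideanSpace.single j 1 - M.nu (gmap i g u) j • M.nu (gmap i g u)) k

lemma IsChart.contDiffOn_X (hc : IsChart M i O V g s) (j : Fin (n + 1)) (k : Fin n) :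
    ContDiffOn ℝ 1 (Xf M i g j k) V := by
  have h1 := hc.contDiffOn_W
  have h2 := hc.contDiffOn_N j
  have h3 := hc.contDiffOn_N (i.succAbove k)
  unfold Xf
  simp only [prj_apply, PiLp.sub_apply, PiLp.smul_apply, smul_eq_mul]
  fun_prop

lemma IsChart.div_X (hc : IsChart M i O V g s) {u : Fu n} (hu : u ∈ V) (j : Fin (n + 1)) :
    ∑ k, fderiv ℝ (Xf M i g j k) u (EuclideanSpace.single k 1) =
      - (Wg g u * meanCurv M (gmap i g u) * M.nu (gmap i g u) j) := by
  have hd : ∀ j, DifferentiableAt ℝ (fun u => M.nu (gmap i g u) j) u :=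
    fun j => hc.diffAt (hc.contDiffOn_N j) hu
  have hVn := hc.isOpen_V.mem_nhds hu
  rw [hc.meanCurv_eq hu]
  refine Fin.succAboveCases i ?_ (fun m => ?_) j
  · have : ∀ k, fderiv ℝ (Xf M i g i k) u =
        (-s) • fderiv ℝ (fun u => M.nu (gmap i g u) (i.succAbove k)) u := by
      intro k
      rw [← fderiv_const_smul (hd _)]
      apply Filter.EventuallyEq.fderiv_eq
      filter_upwards [hVn] with v hv
      simp only [Xf, prj_apply, PiLp.sub_apply, PiLp.smul_apply, smul_eq_mul, PiLp.single_apply,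
        Pi.smul_apply]
      rw [if_neg (Fin.succAbove_ne i k), ← hc.W_mul hv]; ring
    simp only [this, _root_.smul_apply, smul_eq_mul, ← Finset.mul_sum]
    rw [← hc.W_mul hu]; ring
  · have hWd := hc.diffAt hc.contDiffOn_W hu
    have hfd : DifferentiableAt ℝ (fderiv ℝ g) u :=
      (hc.contDiffOn_fderiv.contDiffAt hVn).differentiableAt (by simp)
    have hgk : ∀ k, HasFDerivAt (fun u => fderiv ℝ g u (EuclideanSpace.single k 1))
        ((fderiv ℝ (fderiv ℝ g) u).flip (EuclideanSpace.single k 1)) u := by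
      intro k
      simpa using hfd.hasFDerivAt.clm_apply (hasFDerivAt_const (EuclideanSpace.single k (1:ℝ)) u)
    have hX : ∀ k, fderiv ℝ (Xf M i g (i.succAbove m) k) u (EuclideanSpace.single k 1) =
        (if m = k then fderiv ℝ (Wg g) u (EuclideanSpace.single k 1) else 0) +
        s * (fderiv ℝ g u (EuclideanSpace.single m 1) *
            fderiv ℝ (fun u => M.nu (gmap i g u) (i.succAbove k)) u (EuclideanSpace.single k 1)
          + M.nu (gmap i g u) (i.succAbove k) *
            fderiv ℝ (fderiv ℝ g) u (EuclideanSpace.single k 1) (EuclideanSpace.single m 1)) := by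
      intro k
      have h1 : HasFDerivAt (fun u => (if m = k then (1:ℝ) else 0) * Wg g u +
          s * (fderiv ℝ g u (EuclideanSpace.single m 1) * M.nu (gmap i g u) (i.succAbove k)))
          _ u := (hWd.hasFDerivAt.const_mul _).add
            (((hgk m).mul (hd (i.succAbove k)).hasFDerivAt).const_mul s)
      have h2 : Xf M i g (i.succAbove m) k =ᶠ[𝓝 u] (fun u => (if m = k then (1:ℝ) else 0) * Wg g u +
          s * (fderiv ℝ g u (EuclideanSpace.single m 1) * M.nu (gmap i g u) (i.succAbove k))) := by
        filter_upwards [hVn] with v hv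
        have e := hc.nu_tang hv m
        simp only [Xf, prj_apply, PiLp.sub_apply, PiLp.smul_apply, smul_eq_mul, PiLp.single_apply,
          Fin.succAbove_right_inj, eq_comm (a := k)]
        linear_combination (- M.nu (gmap i g v) (i.succAbove k)) * e
      rw [h2.fderiv_eq, h1.fderiv]
      by_cases h : m = k <;> simp [h] <;> ring
    simp only [hX, Finset.sum_add_distrib, ← Finset.mul_sum]
    have hsymm : ∀ v w, fderiv ℝ (fderiv ℝ g) u v w = fderiv ℝ (fderiv ℝ g) u w v := fun v w =>
      (hc.contDiff.contDiffAt hVn).isSymmSndFDerivAt (by simp) v w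
    have hW1 : Wg g u * fderiv ℝ (Wg g) u (EuclideanSpace.single m 1) =
        ∑ k, fderiv ℝ g u (EuclideanSpace.single k 1) *
          fderiv ℝ (fderiv ℝ g) u (EuclideanSpace.single m 1) (EuclideanSpace.single k 1) := by
      have h1 : HasFDerivAt (fun u => 1 + ∑ k, (fderiv ℝ g u (EuclideanSpace.single k 1)) ^ 2)
          (∑ k, (2 * fderiv ℝ g u (EuclideanSpace.single k 1)) •
            (fderiv ℝ (fderiv ℝ g) u).flip (EuclideanSpace.single k 1)) u := by
        refine HasFDerivAt.const_add _ (HasFDerivAt.fun_sum fun j _ => ?_)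
        simpa using (hgk j).pow 2
      have h2 : HasFDerivAt (fun u => Wg g u ^ 2) ((2 * Wg g u) • fderiv ℝ (Wg g) u) u := by
        simpa using hWd.hasFDerivAt.pow 2
      have h3 : (fun u => Wg g u ^ 2) = 
          (fun u => 1 + ∑ k, (fderiv ℝ g u (EuclideanSpace.single k 1)) ^ 2) := by
        ext v; rw [Wg_eq, Real.sq_sqrt (by positivity)]
      rw [h3] at h2
      have h4 := congrArg (fun L : Fu n →L[ℝ] ℝ => L (EuclideanSpace.single m 1)) (h1.unique h2)
      simp only [_root_.sum_apply, _root_.smul_apply, smul_eq_mul, mul_assoc,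
        ← Finset.mul_sum, ContinuousLinearMap.flip_apply] at h4
      linarith
    have hkey : fderiv ℝ (Wg g) u (EuclideanSpace.single m 1) = - s * ∑ k,
        M.nu (gmap i g u) (i.succAbove k) *
          fderiv ℝ (fderiv ℝ g) u (EuclideanSpace.single k 1) (EuclideanSpace.single m 1) := by
      have hs : s * s = 1 := by rcases hc.sgn with h | h <;> rw [h] <;> norm_num
      refine mul_left_cancel₀ (Wg_pos g u).ne' ?_
      rw [hW1, Finset.mul_sum, Finset.mul_sum]
      refine Finset.sum_congr rfl fun k _ => ?_
      have e := hc.nu_tang hu k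
      rw [hsymm (EuclideanSpace.single m 1)]
      linear_combination (s * fderiv ℝ (fderiv ℝ g) u (EuclideanSpace.single k 1) (EuclideanSpace.single m 1)) * e
        - (fderiv ℝ g u (EuclideanSpace.single k 1) * fderiv ℝ (fderiv ℝ g) u (EuclideanSpace.single k 1) (EuclideanSpace.single m 1)) * hs
    have e := hc.nu_tang hu m
    rw [Finset.sum_ite_eq Finset.univ m, if_pos (Finset.mem_univ _), hkey]
    linear_combination (∑ k, fderiv ℝ (fun u => M.nu (gmap i g u) (i.succAbove k)) u
      (EuclideanSpace.single k 1)) * e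

end HS

namespace HS
open Set Filter Topology Module

lemma integral_fderiv_zero {Y : Fu n → ℝ} (hY : ContDiff ℝ 1 Y) (hs : HasCompactSupport Y) (v : Fu n) :
    ∫ u, fderiv ℝ Y u v ∂μH[n] = 0 := by
  have := haar_Fu (n := n)
  have h1 : Continuous (fun u => fderiv ℝ Y u v) := (hY.continuous_fderiv (by simp)).clm_apply continuous_const
  have h2 : HasCompactSupport (fun u => fderiv ℝ Y u v) := hs.fderiv_apply ℝ v
  have := integral_mul_fderiv_eq_neg_fderiv_mul_of_integrable (μ := (μH[n] : Measure (Fu n)))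
    (f := fun _ : Fu n => (1:ℝ)) (g := Y) (v := v) (by simp)
    (by simpa using h1.integrable_of_hasCompactSupport h2)
    (by simpa using hY.continuous.integrable_of_hasCompactSupport hs)
    (by simp) (fun x _ => hY.differentiable (by simp) x)
  simpa using this

variable {M : Hypersurface n} {i : Fin (n + 1)} {O : Set (Eu n)} {V : Set (Fu n)}
  {g : Fu n → ℝ} {s : ℝ}

lemma contDiff_indicator {V K : Set (Fu n)} (hV : IsOpen V) (hK : IsCompact K) (hKV : K ⊆ V)
    {f : Fu n → ℝ} (hf : ContDiffOn ℝ 1 f V) (h0 : ∀ u ∈ V, u ∉ K → f u = 0) :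
    ContDiff ℝ 1 (V.indicator f) ∧ HasCompactSupport (V.indicator f) := by
  have hz : ∀ u, u ∉ K → V.indicator f u = 0 := fun u hu => by
    by_cases h : u ∈ V
    · simp [h, h0 u h hu]
    · simp [h]
  refine ⟨?_, HasCompactSupport.intro hK hz⟩
  rw [contDiff_iff_contDiffAt]
  intro u
  by_cases h : u ∈ V
  · refine (hf.contDiffAt (hV.mem_nhds h)).congr_of_eventuallyEq ?_
    filter_upwards [hV.mem_nhds h] with v hv
    simp [hv]
  · refine (contDiffAt_const (c := (0:ℝ))).congr_of_eventuallyEq ?_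
    filter_upwards [hK.isClosed.isOpen_compl.mem_nhds (fun h' => h (hKV h'))] with v hv using hz v hv

lemma first_var_local (hc : IsChart M i O V g s) {φ : Eu n → ℝ} (hφ : ContDiff ℝ 1 φ)
    {K : Set (Eu n)} (hK : IsCompact K) (hKM : K ⊆ M.carrier ∩ O)
    (h0 : ∀ x ∈ M.carrier, x ∉ K → φ x = 0) (j : Fin (n + 1)) :
    ∫ x, tderiv M.nu j φ x - φ x * meanCurv M x * M.nu x j ∂surfMeasure M = 0 := by
  set F : Eu n → ℝ := fun x => tderiv M.nu j φ x - φ x * meanCurv M x * M.nu x j with hF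
  have hFc : Continuous F := by
    have h1 := continuous_tderiv M hφ j
    have h2 := continuous_meanCurv M
    have h3 : Continuous M.nu := M.smooth_nu.continuous
    have h4 := hφ.continuous
    fun_prop
  have hF0 : ∀ x ∈ M.carrier, x ∉ K → F x = 0 := fun x hx hxK => by
    simp [hF, tderiv_zero_of_supp M hK hφ h0 hx hxK, h0 x hx hxK]
  have e1 : ∫ x in O, F x ∂surfMeasure M = ∫ x, F x ∂surfMeasure M := by
    refine setIntegral_eq_integral_of_ae_compl_eq_zero ?_
    filter_upwards [ae_mem M] with x hx hxO
    exact hF0 x hx fun h => hxO (hKM h).2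
  rw [← e1, hc.setIntegral hFc]
  set Y : Fin n → Fu n → ℝ := fun k => V.indicator (fun u => φ (gmap i g u) * Xf M i g j k u) with hY
  have hφg : ContDiffOn ℝ 1 (fun u => φ (gmap i g u)) V :=
    hφ.comp_contDiffOn (hc.contDiffOn_gmap.of_le (by norm_num))
  have hYp : ∀ k, ContDiff ℝ 1 (Y k) ∧ HasCompactSupport (Y k) := fun k => by
    refine contDiff_indicator hc.isOpen_V (hK.image (continuous_prj i)) ?_
      (hφg.mul (hc.contDiffOn_X j k)) ?_
    · rintro _ ⟨x, hx, rfl⟩; exact (hc.prj_mem (hKM hx)).1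
    · intro u hu huK
      have : gmap i g u ∉ K := fun h => huK ⟨_, h, prj_gmap i g u⟩
      simp [h0 _ (hc.mem hu).1 this]
  have e2 : ∀ u ∈ V, Wg g u * F (gmap i g u) = ∑ k, fderiv ℝ (Y k) u (EuclideanSpace.single k 1) := by
    intro u hu
    have hk : ∀ k, fderiv ℝ (Y k) u (EuclideanSpace.single k 1) =
        φ (gmap i g u) * fderiv ℝ (Xf M i g j k) u (EuclideanSpace.single k 1) +
        Xf M i g j k u * fderiv ℝ (fun u => φ (gmap i g u)) u (EuclideanSpace.single k 1) := by
      intro k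
      have : Y k =ᶠ[𝓝 u] fun u => φ (gmap i g u) * Xf M i g j k u := by
        filter_upwards [hc.isOpen_V.mem_nhds hu] with v hv
        simp [hY, hv]
      rw [this.fderiv_eq, fderiv_fun_mul (hc.diffAt hφg hu) (hc.diffAt (hc.contDiffOn_X j k) hu)]
      simp
    simp only [hk, Finset.sum_add_distrib, ← Finset.mul_sum, hc.div_X hu, hF]
    rw [hc.tderiv_chart hu (hφ.differentiable (by simp) _), clm_sum, mul_sub, Finset.mul_sum]
    simp only [Xf, mul_assoc]
    ring
  rw [setIntegral_congr_fun hc.isOpen_V.measurableSet e2]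
  have e3 : ∫ u in V, ∑ k, fderiv ℝ (Y k) u (EuclideanSpace.single k 1) ∂μH[n] =
      ∫ u, ∑ k, fderiv ℝ (Y k) u (EuclideanSpace.single k 1) ∂μH[n] := by
    refine setIntegral_eq_integral_of_forall_compl_eq_zero ?_
    intro u hu
    refine Finset.sum_eq_zero fun k _ => ?_
    have hKs : tsupport (Y k) ⊆ V := by
      have hz : Function.support (Y k) ⊆ prj i '' K := by
        intro u hu
        by_contra h
        apply hu
        by_cases hv : u ∈ V
        · have : gmap i g u ∉ K := fun h' => h ⟨_, h', prj_gmap i g u⟩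
          simp [hY, hv, h0 _ (hc.mem hv).1 this]
        · simp [hY, hv]
      refine (closure_minimal hz (hK.image (continuous_prj i)).isClosed).trans ?_
      rintro _ ⟨x, hx, rfl⟩; exact (hc.prj_mem (hKM hx)).1
    rw [fderiv_of_notMem_tsupport ℝ (fun h => hu (hKs h))]; simp
  have := haar_Fu (n := n)
  rw [e3, integral_finsetSum]
  · exact Finset.sum_eq_zero fun k _ => integral_fderiv_zero (hYp k).1 (hYp k).2 _
  · intro k _
    exact (((hYp k).1.continuous_fderiv (by simp)).clm_apply continuous_const).integrable_of_hasCompactSupport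
      ((hYp k).2.fderiv_apply ℝ _)

/-- first variation formula -/
theorem first_var (M : Hypersurface n) {φ : Eu n → ℝ} (hφ : C1cOn M.carrier φ) (j : Fin (n + 1)) :
    ∫ x, tderiv M.nu j φ x - φ x * meanCurv M x * M.nu x j ∂surfMeasure M = 0 := by
  obtain ⟨hφ, K, hK, hKM, h0⟩ := hφ
  choose! ci cO cV cg cs hcx hcc using fun x (hx : x ∈ M.carrier) => exists_chart M hx
  obtain ⟨t, htK, htc⟩ := hK.elim_nhds_subcover cO (fun x hx =>
    (hcc x (hKM hx)).isOpen_O.mem_nhds (hcx x (hKM hx)))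
  obtain ⟨f, hf⟩ := SmoothPartitionOfUnity.exists_isSubordinate (modelWithCornersSelf ℝ (Eu n))
    hK.isClosed (fun x : t => cO x) (fun x => (hcc x (hKM (htK _ x.2))).isOpen_O)
    (by intro x hx; obtain ⟨y, hy, hxy⟩ := mem_iUnion₂.1 (htc hx); exact mem_iUnion.2 ⟨⟨y, hy⟩, hxy⟩)
  have hfC : ∀ l, ContDiff ℝ 1 (f l) := fun l =>
    contDiff_infty.1 (f l).contMDiff.contDiff 1
  have hsum : ∀ x ∈ M.carrier, φ x = ∑ l, f l x * φ x := by
    intro x hx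
    by_cases hxK : x ∈ K
    · have := f.sum_eq_one hxK
      rw [finsum_eq_sum_of_fintype] at this
      rw [← Finset.sum_mul, this, one_mul]
    · simp [h0 x hx hxK]
  have hφl : ∀ l, ContDiff ℝ 1 (fun x => f l x * φ x) := fun l => (hfC l).mul hφ
  have hloc : ∀ l, ∫ x, tderiv M.nu j (fun x => f l x * φ x) x -
      (f l x * φ x) * meanCurv M x * M.nu x j ∂surfMeasure M = 0 := by
    intro l
    refine first_var_local (hcc l (hKM (htK _ l.2))) (hφl l)
      (hK.inter_right (isClosed_tsupport (f l))) ?_ ?_ j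
    · exact fun x hx => ⟨hKM hx.1, hf l hx.2⟩
    · intro x hx hxK
      by_cases h : x ∈ K
      · have : x ∉ tsupport (f l) := fun h' => hxK ⟨h, h'⟩
        simp [image_eq_zero_of_notMem_tsupport this]
      · simp [h0 x hx h]
  have hint : ∀ l ∈ Finset.univ, Integrable (fun x => tderiv M.nu j (fun x => f l x * φ x) x -
      (f l x * φ x) * meanCurv M x * M.nu x j) (surfMeasure M) := by
    intro l _
    have h00 : ∀ x ∈ M.carrier, x ∉ K → f l x * φ x = 0 := fun x hx hxK => by simp [h0 x hx hxK]
    refine integrable_of_supp M hK hKM ?_ ?_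
    · have h1 := continuous_tderiv M (hφl l) j
      have h2 := continuous_meanCurv M
      have h3 : Continuous M.nu := M.smooth_nu.continuous
      have h4 := (hφl l).continuous
      fun_prop
    · intro x hx hxK
      simp [tderiv_zero_of_supp M hK (hφl l) h00 hx hxK, h0 x hx hxK]
  have hfin := integral_finsetSum Finset.univ hint
  rw [Finset.sum_eq_zero (fun l _ => hloc l)] at hfin
  rw [← hfin]
  refine integral_congr_ae ?_
  filter_upwards [ae_mem M] with x hx
  have e1 : tderiv M.nu j φ x = tderiv M.nu j (fun x => ∑ l, f l x * φ x) x := by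
    refine tderiv_congr M hx (hφ.differentiable (by simp) x) ?_ ?_ j
    · exact (ContDiff.sum fun l _ => hφl l).differentiable (by simp) x
    · exact Eventually.of_forall hsum
  have e2 : tderiv M.nu j (fun x => ∑ l, f l x * φ x) x = ∑ l, tderiv M.nu j (fun x => f l x * φ x) x := by
    simp only [tderiv_eq]
    rw [fderiv_fun_sum (fun l _ => (hφl l).differentiable (by simp) x)]
    simp
  rw [Finset.sum_sub_distrib, e1, e2, ← Finset.sum_mul, ← Finset.sum_mul, ← hsum x hx]

end HS

namespace HS
open Set Filter Topology Module

variable {M : Hypersurface n}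

lemma tderiv_mul (ν : Eu n → Eu n) (j : Fin (n + 1)) {f g : Eu n → ℝ} {x : Eu n}
    (hf : DifferentiableAt ℝ f x) (hg : DifferentiableAt ℝ g x) :
    tderiv ν j (fun x => f x * g x) x = f x * tderiv ν j g x + g x * tderiv ν j f x := by
  simp only [tderiv_eq]
  rw [fderiv_fun_mul hf hg]; simp

lemma sum_tderiv_mul (ν : Eu n → Eu n) (f : Eu n → ℝ) (x v : Eu n) :
    ∑ j, tderiv ν j f x * v j = fderiv ℝ f x (v - ⟪ν x, v⟫ • ν x) := by
  simp only [tderiv_eq, map_sub, map_smul, smul_eq_mul, sub_mul, Finset.sum_sub_distrib]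
  rw [clm_sum (fderiv ℝ f x) v]
  simp only [PiLp.inner_apply, Finset.sum_mul]
  congr 1
  · exact Finset.sum_congr rfl fun k _ => mul_comm _ _
  · refine Finset.sum_congr rfl fun k _ => ?_
    simp; ring

lemma tderiv_coord (ν : Eu n → Eu n) (j : Fin (n + 1)) (ξ x : Eu n) :
    tderiv ν j (fun x => (x - ξ) j) x = 1 - ν x j ^ 2 := by
  have h : HasFDerivAt (fun x : Eu n => (x - ξ) j) (EuclideanSpace.proj j : Eu n →L[ℝ] ℝ) x := by
    have := ((EuclideanSpace.proj (𝕜 := ℝ) j : Eu n →L[ℝ] ℝ).hasFDerivAt (x := x)).sub_const (ξ j)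
    simpa using this
  rw [tderiv_eq, h.fderiv]
  simp; ring

lemma c1c_integrable {φ : Eu n → ℝ} (hφ : C1cOn M.carrier φ) {F : Eu n → ℝ} (hF : Continuous F)
    (h : ∀ x ∈ M.carrier, φ x = 0 → tgrad M.nu φ x = 0 → F x = 0) :
    Integrable F (surfMeasure M) := by
  obtain ⟨h1, K, hK, hKM, h0⟩ := hφ
  exact integrable_of_supp M hK hKM hF fun x hx hxK =>
    h x hx (h0 x hx hxK) (tgrad_zero_of_supp M hK h1 h0 hx hxK)

lemma star0 {h : Eu n → ℝ} (hh : C1cOn M.carrier h) (hpos : ∀ x ∈ M.carrier, 0 ≤ h x) (ξ : Eu n)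
    {W D : Eu n → ℝ} (hW : ContDiff ℝ 1 W)
    (hD : ∀ x v, fderiv ℝ W x v = 2 * D x * ⟪x - ξ, v⟫) (hW0 : ∀ x, 0 ≤ W x) (hD0 : ∀ x, D x ≤ 0)
    (hDc : Continuous D) :
    ∫ x, h x * (n * W x + 2 * D x * ‖x - ξ‖ ^ 2) ∂surfMeasure M ≤
      ∫ x, W x * ‖x - ξ‖ * (‖tgrad M.nu h x‖ + |meanCurv M x * h x|) ∂surfMeasure M := by
  have hc1 := hh.1
  have hyj : ∀ j, ContDiff ℝ 1 (fun x : Eu n => (x - ξ) j) := fun j => by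
    have : ContDiff ℝ 1 (fun x : Eu n => x - ξ) := by fun_prop
    exact contDiff_euclidean.1 this j
  have hφc : ∀ j, ContDiff ℝ 1 (fun x => h x * (W x * (x - ξ) j)) := fun j =>
    hc1.mul (hW.mul (hyj j))
  have hφ : ∀ j, C1cOn M.carrier (fun x => h x * (W x * (x - ξ) j)) := by
    intro j
    obtain ⟨h1, K, hK, hKM, h0⟩ := hh
    exact ⟨hφc j, K, hK, hKM, fun x hx hxK => by simp [h0 x hx hxK]⟩
  have cH := continuous_meanCurv M
  have cν : Continuous M.nu := M.smooth_nu.continuous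
  have ch := hc1.continuous
  have cW := hW.continuous
  have ct := continuous_tgrad M hc1
  have hint : ∀ j ∈ Finset.univ, Integrable (fun x => tderiv M.nu j (fun x => h x * (W x * (x - ξ) j)) x -
      (h x * (W x * (x - ξ) j)) * meanCurv M x * M.nu x j) (surfMeasure M) := by
    intro j _
    refine c1c_integrable (hφ j) ?_ ?_
    · have h1 := continuous_tderiv M (hφc j) j
      have := (hφc j).continuous
      fun_prop
    · intro x hx hx0 hx1
      rw [← tgrad_apply, hx1, hx0]; simp
  have hz := integral_finsetSum Finset.univ hint
  rw [Finset.sum_eq_zero (fun j _ => first_var M (hφ j) j)] at hz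
  have i1 : Integrable (fun x => h x * (n * W x + 2 * D x * ‖x - ξ‖ ^ 2)) (surfMeasure M) :=
    c1c_integrable hh (by fun_prop) (fun x _ h0 _ => by simp [h0])
  have i2 : Integrable (fun x => W x * ‖x - ξ‖ * (‖tgrad M.nu h x‖ + |meanCurv M x * h x|)) (surfMeasure M) :=
    c1c_integrable hh (by fun_prop) (fun x _ h0 h1 => by simp [h0, h1])
  rw [← sub_nonpos, ← integral_sub i1 i2, ← hz]
  refine integral_mono_ae (i1.sub i2) (integrable_finsetSum _ hint) ?_
  filter_upwards [ae_mem M] with x hx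
  have hν : ‖M.nu x‖ = 1 := M.unit_nu x hx
  have dh : DifferentiableAt ℝ h x := hc1.differentiable (by simp) x
  have dW : DifferentiableAt ℝ W x := hW.differentiable (by simp) x
  have dy : ∀ j, DifferentiableAt ℝ (fun x : Eu n => (x - ξ) j) x := fun j =>
    (hyj j).differentiable (by simp) x
  have e : ∀ j, tderiv M.nu j (fun x => h x * (W x * (x - ξ) j)) x -
      (h x * (W x * (x - ξ) j)) * meanCurv M x * M.nu x j =
      W x * (tderiv M.nu j h x * (x - ξ) j) + h x * (tderiv M.nu j W x * (x - ξ) j)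
       + h x * W x * (1 - M.nu x j ^ 2) - h x * W x * meanCurv M x * (M.nu x j * (x - ξ) j) := by
    intro j
    rw [tderiv_mul _ _ dh (g := fun x => W x * (x - ξ) j) (dW.mul (dy j)), tderiv_mul _ _ dW (dy j), tderiv_coord]
    ring
  simp only [e, Finset.sum_sub_distrib, Finset.sum_add_distrib, ← Finset.mul_sum]
  have s1 : ∑ j, tderiv M.nu j h x * (x - ξ) j = ⟪tgrad M.nu h x, x - ξ⟫ := by
    rw [PiLp.inner_apply]
    refine Finset.sum_congr rfl fun j _ => ?_
    rw [tgrad_apply]; simp [mul_comm]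
  have s2 : ∑ j, M.nu x j * (x - ξ) j = ⟪M.nu x, x - ξ⟫ := by
    rw [PiLp.inner_apply]
    refine Finset.sum_congr rfl fun j _ => ?_
    simp [mul_comm]
  have s3 : ∑ j, M.nu x j ^ 2 = 1 := by
    rw [← EuclideanSpace.real_norm_sq_eq, hν]; norm_num
  have s4 : ⟪x - ξ, x - ξ - ⟪M.nu x, x - ξ⟫ • M.nu x⟫ = ‖x - ξ‖ ^ 2 - ⟪M.nu x, x - ξ⟫ ^ 2 := by
    rw [inner_sub_right (x - ξ) (x - ξ) (⟪M.nu x, x - ξ⟫ • M.nu x), inner_smul_right,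
      real_inner_self_eq_norm_sq, real_inner_comm (M.nu x) (x - ξ)]
    ring
  rw [s1, s2, s3, sum_tderiv_mul, hD, s4]
  simp only [Finset.card_univ, Fintype.card_fin, Finset.sum_const, nsmul_eq_mul]
  have a1 := (abs_le.1 (abs_real_inner_le_norm (tgrad M.nu h x) (x - ξ))).1
  have a2 : ⟪M.nu x, x - ξ⟫ ≤ ‖x - ξ‖ := by simpa [hν] using real_inner_le_norm (M.nu x) (x - ξ)
  have a2' : |⟪M.nu x, x - ξ⟫| ≤ ‖x - ξ‖ := by simpa [hν] using abs_real_inner_le_norm (M.nu x) (x - ξ)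
  have hhx := hpos x hx
  have b1 := mul_le_mul_of_nonneg_left a1 (hW0 x)
  have b2 : h x * W x * meanCurv M x * ⟪M.nu x, x - ξ⟫ ≤ W x * ‖x - ξ‖ * |meanCurv M x * h x| := by
    calc _ ≤ |h x * W x * meanCurv M x * ⟪M.nu x, x - ξ⟫| := le_abs_self _
      _ = W x * |meanCurv M x * h x| * |⟪M.nu x, x - ξ⟫| := by
        rw [abs_mul, show h x * W x * meanCurv M x = W x * (meanCurv M x * h x) by ring, abs_mul,
          abs_of_nonneg (hW0 x)]
      _ ≤ W x * |meanCurv M x * h x| * ‖x - ξ‖ := 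
        mul_le_mul_of_nonneg_left a2' (mul_nonneg (hW0 x) (abs_nonneg _))
      _ = _ := by ring
  have b3 : 0 ≤ - (h x * D x) * ⟪M.nu x, x - ξ⟫ ^ 2 := 
    mul_nonneg (by nlinarith [hD0 x]) (sq_nonneg _)
  push_cast
  nlinarith [b1, b2, b3]

lemma c1c_sqrt {φ : Eu n → ℝ} (hφ : C1cOn M.carrier φ) {δ : ℝ} (hδ : 0 < δ) :
    C1cOn M.carrier (fun x => √(φ x ^ 2 + δ ^ 2) - δ) := by
  obtain ⟨h1, K, hK, hKM, h0⟩ := hφ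
  refine ⟨?_, K, hK, hKM, fun x hx hxK => by simp [h0 x hx hxK, Real.sqrt_sq hδ.le]⟩
  have : ContDiff ℝ 1 (fun x => φ x ^ 2 + δ ^ 2) := by fun_prop
  exact (this.sqrt (fun x => by positivity)).sub contDiff_const

/-- chain rule for the tangential gradient -/
lemma tgrad_comp (ν : Eu n → Eu n) {φ : Eu n → ℝ} {x : Eu n} (hφ : DifferentiableAt ℝ φ x)
    {β : ℝ → ℝ} {b : ℝ} (hβ : HasDerivAt β b (φ x)) :
    tgrad ν (fun x => β (φ x)) x = b • tgrad ν φ x := by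
  ext j
  rw [PiLp.smul_apply, tgrad_apply, tgrad_apply, tderiv_eq, tderiv_eq]
  have h : HasFDerivAt (fun x => β (φ x)) (b • fderiv ℝ φ x) x :=
    hβ.comp_hasFDerivAt x hφ.hasFDerivAt
  rw [h.fderiv]; rfl

lemma star1 {φ : Eu n → ℝ} (hφ : C1cOn M.carrier φ) (ξ : Eu n)
    {W D : Eu n → ℝ} (hW : ContDiff ℝ 1 W)
    (hD : ∀ x v, fderiv ℝ W x v = 2 * D x * ⟪x - ξ, v⟫) (hW0 : ∀ x, 0 ≤ W x) (hD0 : ∀ x, D x ≤ 0)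
    (hDc : Continuous D) :
    ∫ x, |φ x| * (n * W x + 2 * D x * ‖x - ξ‖ ^ 2) ∂surfMeasure M ≤
      ∫ x, W x * ‖x - ξ‖ * (‖tgrad M.nu φ x‖ + |meanCurv M x * φ x|) ∂surfMeasure M := by
  have cH := continuous_meanCurv M
  have ch := hφ.1.continuous
  have cW := hW.continuous
  have ct := continuous_tgrad M hφ.1
  set Q : Eu n → ℝ := fun x => n * W x + 2 * D x * ‖x - ξ‖ ^ 2 with hQ
  have cQ : Continuous Q := by fun_prop
  have hab : ∀ δ > 0, ∀ t : ℝ, 0 ≤ √(t ^ 2 + δ ^ 2) - δ ∧ √(t ^ 2 + δ ^ 2) - δ ≤ |t| := by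
    intro δ hδ t
    constructor
    · have : δ ≤ √(t ^ 2 + δ ^ 2) := Real.le_sqrt_of_sq_le (by nlinarith [sq_nonneg t])
      linarith
    · have : √(t ^ 2 + δ ^ 2) ≤ |t| + δ := by
        rw [Real.sqrt_le_left (by positivity)]
        nlinarith [sq_abs t, abs_nonneg t]
      linarith
  have hb : ∀ δ > 0, ∫ x, (√(φ x ^ 2 + δ ^ 2) - δ) * Q x ∂surfMeasure M ≤
      ∫ x, W x * ‖x - ξ‖ * (‖tgrad M.nu φ x‖ + |meanCurv M x * φ x|) ∂surfMeasure M := by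
    intro δ hδ
    have hs := c1c_sqrt hφ hδ
    refine (star0 hs (fun x _ => (hab δ hδ _).1) ξ hW hD hW0 hD0 hDc).trans ?_
    have cs := continuous_tgrad M hs.1
    have css := hs.1.continuous
    refine integral_mono ?_ ?_ ?_
    · exact c1c_integrable hs (by fun_prop) (fun x _ h0 h1 => by simp only [h0, h1]; simp)
    · exact c1c_integrable hφ (by fun_prop) (fun x _ h0 h1 => by simp [h0, h1])
    intro x
    refine mul_le_mul_of_nonneg_left ?_ (mul_nonneg (hW0 x) (norm_nonneg _))
    have hd : HasDerivAt (fun t => √(t ^ 2 + δ ^ 2) - δ) ((2 * φ x) / (2 * √(φ x ^ 2 + δ ^ 2))) (φ x) := by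
      have h1 : HasDerivAt (fun t : ℝ => t ^ 2 + δ ^ 2) (2 * φ x) (φ x) := by
        simpa using (hasDerivAt_pow 2 (φ x)).add_const (δ ^ 2)
      exact (h1.sqrt (by positivity)).sub_const δ
    rw [tgrad_comp M.nu (hφ.1.differentiable (by simp) x) hd, norm_smul, abs_mul, abs_mul]
    have hsq : |φ x| ≤ √(φ x ^ 2 + δ ^ 2) := Real.abs_le_sqrt (by nlinarith)
    refine add_le_add ?_ ?_
    · refine mul_le_of_le_one_left (norm_nonneg _) ?_
      have hp : 0 < √(φ x ^ 2 + δ ^ 2) := by positivity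
      rw [mul_div_mul_left _ _ two_ne_zero, norm_div, Real.norm_eq_abs, Real.norm_eq_abs, abs_of_pos hp]
      exact div_le_one_of_le₀ hsq hp.le
    · refine mul_le_mul_of_nonneg_left ?_ (abs_nonneg _)
      rw [abs_of_nonneg (hab δ hδ _).1]; exact (hab δ hδ _).2
  have hlim : Tendsto (fun δ : ℝ => ∫ x, (√(φ x ^ 2 + δ ^ 2) - δ) * Q x ∂surfMeasure M) (𝓝[>] 0)
      (𝓝 (∫ x, |φ x| * Q x ∂surfMeasure M)) := by
    refine tendsto_integral_filter_of_dominated_convergence (fun x => |φ x| * |Q x|) ?_ ?_ ?_ ?_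
    · refine Eventually.of_forall fun δ => Continuous.aestronglyMeasurable (by fun_prop)
    · filter_upwards [self_mem_nhdsWithin] with δ hδ
      refine Eventually.of_forall fun x => ?_
      rw [norm_mul, Real.norm_eq_abs, Real.norm_eq_abs, abs_of_nonneg (hab δ hδ _).1]
      exact mul_le_mul_of_nonneg_right (hab δ hδ _).2 (abs_nonneg _)
    · exact c1c_integrable hφ (by fun_prop) (fun x _ h0 h1 => by simp [h0])
    · refine Eventually.of_forall fun x => ?_
      have : Continuous (fun δ : ℝ => (√(φ x ^ 2 + δ ^ 2) - δ) * Q x) := by fun_prop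
      have h2 := this.tendsto 0
      simp only [sub_zero, ne_eq, OfNat.ofNat_ne_zero, not_false_eq_true, zero_pow, add_zero,
        Real.sqrt_sq_eq_abs] at h2
      exact h2.mono_left nhdsWithin_le_nhds
  exact le_of_tendsto hlim (by filter_upwards [self_mem_nhdsWithin] with δ hδ using hb δ hδ)

theorem star {φ : Eu n → ℝ} (hφ : C1cOn M.carrier φ) (ξ : Eu n) {w w' : ℝ → ℝ}
    (hw : ∀ t, 0 ≤ t → HasDerivAt w (w' t) t) (hwc : ContinuousOn w' (Ici 0))
    (hw0 : ∀ t, 0 ≤ t → 0 ≤ w t) (hw1 : ∀ t, 0 ≤ t → w' t ≤ 0) :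
    ∫ x, |φ x| * (n * w (‖x - ξ‖ ^ 2) + 2 * w' (‖x - ξ‖ ^ 2) * ‖x - ξ‖ ^ 2) ∂surfMeasure M ≤
      ∫ x, w (‖x - ξ‖ ^ 2) * ‖x - ξ‖ * (‖tgrad M.nu φ x‖ + |meanCurv M x * φ x|) ∂surfMeasure M := by
  have hd : ∀ x : Eu n, HasFDerivAt (fun x => w (‖x - ξ‖ ^ 2))
      (w' (‖x - ξ‖ ^ 2) • ((2:ℝ) • innerSL ℝ (x - ξ))) x := by
    intro x
    have h1 : HasFDerivAt (fun x : Eu n => ‖x - ξ‖ ^ 2) ((2:ℝ) • innerSL ℝ (x - ξ)) x := by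
      have := ((hasFDerivAt_id x).sub_const ξ).norm_sq
      convert! this using 1
      ext v; simp
    exact (hw _ (by positivity)).comp_hasFDerivAt x h1
  have hDc : Continuous (fun x : Eu n => w' (‖x - ξ‖ ^ 2)) :=
    hwc.comp_continuous (by fun_prop) (fun x => by simp)
  refine star1 hφ ξ (W := fun x => w (‖x - ξ‖ ^ 2)) (D := fun x => w' (‖x - ξ‖ ^ 2)) ?_ ?_ ?_ ?_ hDc
  · rw [contDiff_one_iff_hasFDerivAt]
    refine ⟨_, ?_, hd⟩
    have h3 : Continuous (fun x : Eu n => innerSL ℝ (x - ξ)) :=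
      (innerSL ℝ).continuous.comp (continuous_id.sub continuous_const)
    exact hDc.smul (h3.const_smul (2:ℝ))
  · intro x v
    rw [(hd x).fderiv]; simp [inner_sub_left]; ring
  · exact fun x => hw0 _ (by positivity)
  · exact fun x => hw1 _ (by positivity)

end HS

namespace HS
open Set Filter Topology Module

variable {M : Hypersurface n}

/-- the kernels -/
def kq (q a r : ℝ) : ℝ := (r ^ 2 + a ^ 2) ^ (-q / 2)

lemma kq_pos {q a r : ℝ} (ha : 0 < a) : 0 < kq q a r := Real.rpow_pos_of_pos (by positivity) _

lemma continuous_kq {q a : ℝ} (ha : 0 < a) : Continuous (fun x : Eu n => kq q a ‖x‖) := by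
  unfold kq
  refine Continuous.rpow_const (by fun_prop) (fun x => Or.inl (by positivity))

lemma continuous_kq' {q a : ℝ} (ha : 0 < a) (ξ : Eu n) : Continuous (fun x : Eu n => kq q a ‖x - ξ‖) :=
  (continuous_kq ha).comp (continuous_id.sub continuous_const)

/-- the density `G` -/
def Gf (M : Hypersurface n) (φ : Eu n → ℝ) (x : Eu n) : ℝ :=
  ‖tgrad M.nu φ x‖ + |meanCurv M x * φ x|

lemma Gf_nonneg (M : Hypersurface n) (φ : Eu n → ℝ) (x : Eu n) : 0 ≤ Gf M φ x := by
  unfold Gf; positivity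

lemma continuous_Gf (M : Hypersurface n) {φ : Eu n → ℝ} (hφ : ContDiff ℝ 1 φ) : Continuous (Gf M φ) := by
  have cH := continuous_meanCurv M
  have ch := hφ.continuous
  have ct := continuous_tgrad M hφ
  unfold Gf; fun_prop

/-- Poisson type averages -/
def Pav (M : Hypersurface n) (φ : Eu n → ℝ) (ξ : Eu n) (a : ℝ) : ENNReal :=
  ∫⁻ x, ENNReal.ofReal (|φ x|) * ENNReal.ofReal (a ^ 2 * kq (n + 2) a ‖x - ξ‖) ∂surfMeasure M

/-- (star) with weight `(t+a^2)^{-q/2}`, `0 < q ≤ n` -/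
lemma star_q {φ : Eu n → ℝ} (hφ : C1cOn M.carrier φ) (ξ : Eu n) {q a : ℝ} (ha : 0 < a) (hq : 0 ≤ q) :
    ∫ x, |φ x| * (n * kq q a ‖x - ξ‖ - q * ‖x - ξ‖ ^ 2 * kq (q + 2) a ‖x - ξ‖) ∂surfMeasure M ≤
      ∫ x, kq q a ‖x - ξ‖ * ‖x - ξ‖ * Gf M φ x ∂surfMeasure M := by
  have := star hφ ξ (w := fun t => (t + a ^ 2) ^ (-q / 2))
    (w' := fun t => (-q / 2) * (t + a ^ 2) ^ (-(q + 2) / 2)) ?_ ?_ ?_ ?_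
  · refine le_trans (le_of_eq ?_) (this.trans (le_of_eq ?_))
    · congr 1; ext x; simp only [kq]; ring
    · rfl
  · intro t ht
    have h1 : HasDerivAt (fun t : ℝ => t + a ^ 2) 1 t := (hasDerivAt_id t).add_const _
    have := h1.rpow_const (p := -q / 2) (Or.inl (by positivity))
    convert! this using 1
    rw [show -q / 2 - 1 = -(q + 2) / 2 by ring]; ring
  · refine ContinuousOn.mul continuousOn_const (ContinuousOn.rpow_const (by fun_prop) ?_)
    intro t ht; left; have : (0:ℝ) ≤ t := ht; positivity
  · intro t ht; positivity
  · intro t ht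
    have : 0 ≤ (t + a ^ 2) ^ (-(q + 2) / 2) := by positivity
    nlinarith

lemma kq_succ {q a r : ℝ} (ha : 0 < a) : kq q a r = (r ^ 2 + a ^ 2) * kq (q + 2) a r := by
  unfold kq
  rw [show -q / 2 = 1 + -(q + 2) / 2 by ring, Real.rpow_add (by positivity), Real.rpow_one]

lemma kq_mul_le {q a r : ℝ} (ha : 0 < a) (hr : 0 ≤ r) : kq q a r * r ≤ kq (q - 1) a r := by
  unfold kq
  rw [show -(q - 1) / 2 = -q / 2 + 1 / 2 by ring, Real.rpow_add (by positivity), ← Real.sqrt_eq_rpow]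
  refine mul_le_mul_of_nonneg_left ?_ (by positivity)
  exact Real.le_sqrt_of_sq_le (by nlinarith)

lemma star_kernel {φ : Eu n → ℝ} (hφ : C1cOn M.carrier φ) (ξ : Eu n) {a : ℝ} (ha : 0 < a) :
    ENNReal.ofReal n * Pav M φ ξ a ≤
      ∫⁻ x, ENNReal.ofReal (Gf M φ x) * ENNReal.ofReal (kq (n - 1) a ‖x - ξ‖) ∂surfMeasure M := by
  have h := star_q hφ ξ ha (q := n) (by positivity)
  have ck := fun q => continuous_kq' (q := q) ha ξ
  have ch := hφ.1.continuous
  have cG := continuous_Gf M hφ.1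
  have i1 : Integrable (fun x => |φ x| * (n * kq n a ‖x - ξ‖ - n * ‖x - ξ‖ ^ 2 * kq (n + 2) a ‖x - ξ‖))
      (surfMeasure M) := c1c_integrable hφ (by have := ck n; have := ck (n+2); fun_prop) (fun x _ h0 _ => by simp [h0])
  have i2 : Integrable (fun x => kq n a ‖x - ξ‖ * ‖x - ξ‖ * Gf M φ x) (surfMeasure M) :=
    c1c_integrable hφ (by have := ck n; fun_prop) (fun x _ h0 h1 => by simp [Gf, h0, h1])
  have e : ∀ x, |φ x| * (n * kq n a ‖x - ξ‖ - n * ‖x - ξ‖ ^ 2 * kq (n + 2) a ‖x - ξ‖) =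
      n * (|φ x| * (a ^ 2 * kq (n + 2) a ‖x - ξ‖)) := fun x => by
    rw [kq_succ ha]; ring
  have h2 := ENNReal.ofReal_le_ofReal h
  rw [ofReal_integral_eq_lintegral_ofReal i1, ofReal_integral_eq_lintegral_ofReal i2] at h2
  · calc ENNReal.ofReal n * Pav M φ ξ a = ∫⁻ x, ENNReal.ofReal (|φ x| * (n * kq n a ‖x - ξ‖ - n * ‖x - ξ‖ ^ 2 * kq (n + 2) a ‖x - ξ‖)) ∂surfMeasure M := by
          rw [Pav, ← lintegral_const_mul' _ _ ENNReal.ofReal_ne_top]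
          refine lintegral_congr fun x => ?_
          rw [e, ENNReal.ofReal_mul (p := (n:ℝ)) (Nat.cast_nonneg n), ENNReal.ofReal_mul (p := |φ x|) (abs_nonneg _)]
      _ ≤ _ := h2
      _ ≤ _ := by
          refine lintegral_mono fun x => ?_
          rw [← ENNReal.ofReal_mul (Gf_nonneg M φ x), mul_comm]
          exact ENNReal.ofReal_le_ofReal (mul_le_mul_of_nonneg_left (kq_mul_le ha (norm_nonneg _)) (Gf_nonneg M φ x))
  · exact Eventually.of_forall fun x => mul_nonneg (mul_nonneg (kq_pos ha).le (norm_nonneg _)) (Gf_nonneg M φ x)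
  · refine Eventually.of_forall fun x => ?_
    simp only [e]
    have := kq_pos (q := (n:ℝ) + 2) (r := ‖x - ξ‖) ha
    simp only [Pi.zero_apply]; positivity

/-- superlevel sets of the kernel are balls -/
lemma kq_lt_iff {q a τ r : ℝ} (hq : 0 < q) (ha : 0 < a) (hτ : 0 < τ) (hr : 0 ≤ r) :
    τ < kq q a r ↔ r < √(τ ^ (-2 / q) - a ^ 2) := by
  rw [Real.lt_sqrt hr, kq, lt_sub_iff_add_lt]
  have hb : 0 < r ^ 2 + a ^ 2 := by positivity
  have e : ((r ^ 2 + a ^ 2) ^ (-q / 2)) ^ (-2 / q) = r ^ 2 + a ^ 2 := by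
    rw [← Real.rpow_mul hb.le, show -q / 2 * (-2 / q) = 1 by field_simp, Real.rpow_one]
  conv_rhs => lhs; rw [← e]
  rw [Real.rpow_lt_rpow_iff_of_neg (by positivity) hτ (by rw [neg_div]; simpa using hq)]

lemma layer_cake (μ₁ μ₂ : Measure (Eu n)) (ξ : Eu n) {A : ENNReal} (hA : A ≠ ⊤) {q a : ℝ} (hq : 0 < q)
    (ha : 0 < a) (h : ∀ ρ > 0, A * μ₁ (Metric.ball ξ ρ) ≤ μ₂ (Metric.ball ξ (6 * ρ))) :
    A * ∫⁻ x, ENNReal.ofReal (kq q a ‖x - ξ‖) ∂μ₁ ≤ ∫⁻ x, ENNReal.ofReal (kq q a (‖x - ξ‖ / 6)) ∂μ₂ := by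
  have c1 := continuous_kq' (q := q) ha ξ
  have c2 : Continuous (fun x => kq q a (‖x - ξ‖ / 6)) := by
    unfold kq
    refine Continuous.rpow_const (by fun_prop) (fun x => Or.inl (by positivity))
  rw [lintegral_eq_lintegral_meas_lt _ (Eventually.of_forall fun x => (kq_pos ha).le) c1.aemeasurable,
    lintegral_eq_lintegral_meas_lt _ (Eventually.of_forall fun x => (kq_pos ha).le) c2.aemeasurable,
    ← lintegral_const_mul' _ _ hA]
  refine setLIntegral_mono' measurableSet_Ioi fun τ hτ => ?_
  have hτ : 0 < τ := hτ
  set ρ := √(τ ^ (-2 / q) - a ^ 2)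
  have e1 : {x | τ < kq q a ‖x - ξ‖} = Metric.ball ξ ρ := by
    ext x; simp only [mem_setOf_eq, Metric.mem_ball, dist_eq_norm]
    exact kq_lt_iff hq ha hτ (norm_nonneg _)
  have e2 : {x | τ < kq q a (‖x - ξ‖ / 6)} = Metric.ball ξ (6 * ρ) := by
    ext x; simp only [mem_setOf_eq, Metric.mem_ball, dist_eq_norm]
    rw [kq_lt_iff hq ha hτ (by positivity), div_lt_iff₀ (by norm_num), mul_comm]
  rw [e1, e2]
  rcases (Real.sqrt_nonneg (τ ^ (-2 / q) - a ^ 2)).eq_or_lt with h0 | h0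
  · have : ρ = 0 := h0.symm
    simp [this]
  · exact h ρ h0

lemma kq_div_six {q a r : ℝ} (hq : 0 < q) (ha : 0 < a) : kq q a (r / 6) ≤ 6 ^ q * kq q a r := by
  unfold kq
  have e : (6:ℝ) ^ q * (r ^ 2 + a ^ 2) ^ (-q / 2) = ((r ^ 2 + a ^ 2) / 36) ^ (-q / 2) := by
    rw [Real.div_rpow (by positivity) (by norm_num), show (36:ℝ) = 6 ^ (2:ℝ) by norm_num,
      ← Real.rpow_mul (by norm_num), show (2 * (-q / 2)) = -q by ring, Real.rpow_neg (by norm_num)]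
    field_simp
  rw [e]
  refine Real.rpow_le_rpow_of_nonpos (by positivity) (by nlinarith [sq_nonneg a]) (by linarith)

end HS

namespace HS
open Set Filter Topology Module

variable {M : Hypersurface n}

lemma sq_rpow_half {b s : ℝ} (hb : 0 < b) : (b ^ 2) ^ (s / 2) = b ^ s := by
  rw [← Real.rpow_natCast, ← Real.rpow_mul hb.le]; congr 1; push_cast; ring

lemma kq_le_of_le {q a r z : ℝ} (hq : 0 ≤ q) (hz : 0 < z) (h : z ^ 2 ≤ r ^ 2 + a ^ 2) : kq q a r ≤ z ^ (-q) := by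
  unfold kq
  rw [← sq_rpow_half hz]
  exact Real.rpow_le_rpow_of_nonpos (by positivity) h (by linarith)

lemma le_kq_of_le {q a r z : ℝ} (hq : 0 ≤ q) (ha : 0 < a) (hz : 0 < z) (h : r ^ 2 + a ^ 2 ≤ z ^ 2) : z ^ (-q) ≤ kq q a r := by
  unfold kq
  rw [← sq_rpow_half hz]
  exact Real.rpow_le_rpow_of_nonpos (by positivity) h (by linarith)

lemma kq_term {m a b r : ℝ} (hm : 1 ≤ m) (hb : 0 < b) (h1 : b ^ 2 ≤ r ^ 2 + a ^ 2)
    (h2 : r ^ 2 + a ^ 2 ≤ (2 * b) ^ 2) :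
    kq (m - 1) a r ≤ 3 ^ (m + 2) * b * (b ^ 2 * kq (m + 2) b r) := by
  have e1 := kq_le_of_le (q := m - 1) (by linarith) hb h1
  have e2 := le_kq_of_le (q := m + 2) (a := b) (r := r) (z := 3 * b) (by linarith) hb (by positivity)
    (by nlinarith [sq_nonneg a, sq_nonneg b])
  refine e1.trans ?_
  have e3 : b ^ (-(m-1)) = 3 ^ (m + 2) * b * (b ^ 2 * (3 * b) ^ (-(m+2))) := by
    rw [Real.mul_rpow (by norm_num) hb.le, Real.rpow_neg (x := 3) (by norm_num), 
      show -(m-1) = -(m+2) + 3 by ring, Real.rpow_add hb]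
    have : (3:ℝ) ^ (m+2) ≠ 0 := by positivity
    field_simp
    norm_num
  rw [e3]; gcongr

lemma kq_dyadic {m a R : ℝ} (hm : 1 ≤ m) (ha : 0 < a) (hR : a < R) :
    ∃ N : ℕ, 2 ^ (N + 1) * a ≤ 2 * R ∧ ∀ r : ℝ, 
      kq (m - 1) a r ≤ ∑ k ∈ Finset.range (N + 1), 3 ^ (m + 2) * (2 ^ k * a) * ((2 ^ k * a) ^ 2 * kq (m + 2) (2 ^ k * a) r)
        + R ^ (1 - m) := by
  obtain ⟨N, hN1, hN2⟩ := exists_nat_pow_near (x := R / a) (y := 2) (by rw [le_div_iff₀ ha]; linarith) (by norm_num)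
  rw [le_div_iff₀ ha] at hN1
  rw [div_lt_iff₀ ha] at hN2
  refine ⟨N, by rw [pow_succ]; linarith, fun r => ?_⟩
  have hpos : ∀ k : ℕ, 0 ≤ 3 ^ (m + 2) * (2 ^ k * a) * ((2 ^ k * a) ^ 2 * kq (m + 2) (2 ^ k * a) r) := fun k => by
    have := kq_pos (q := m + 2) (a := 2 ^ k * a) (r := r) (by positivity)
    positivity
  have hR0 : 0 < R := by linarith
  by_cases hz : R ^ 2 ≤ r ^ 2 + a ^ 2
  · have := kq_le_of_le (q := m - 1) (by linarith) hR0 hz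
    rw [neg_sub] at this
    have := Finset.sum_nonneg (fun k (_ : k ∈ Finset.range (N+1)) => hpos k)
    linarith
  · push Not at hz
    set z := √(r ^ 2 + a ^ 2)
    have hz2 : z ^ 2 = r ^ 2 + a ^ 2 := Real.sq_sqrt (by positivity)
    have hza : a ≤ z := Real.le_sqrt_of_sq_le (by nlinarith [sq_nonneg r])
    have hzR : z < R := by
      rw [← hz2] at hz; exact lt_of_pow_lt_pow_left₀ 2 hR0.le hz
    obtain ⟨k, hk1, hk2⟩ := exists_nat_pow_near (x := z / a) (y := 2) (by rw [le_div_iff₀ ha]; linarith) (by norm_num)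
    rw [le_div_iff₀ ha] at hk1
    rw [div_lt_iff₀ ha] at hk2
    have hkN : k < N + 1 := by
      have : (2:ℝ) ^ k < 2 ^ (N+1) := by
        by_contra hc; push Not at hc
        have := mul_le_mul_of_nonneg_right hc ha.le
        linarith
      exact (pow_lt_pow_iff_right₀ (by norm_num)).1 this
    have ht := kq_term (m := m) (a := a) (r := r) (b := 2 ^ k * a) hm (by positivity)
      (by rw [← hz2]; exact pow_le_pow_left₀ (by positivity) hk1 2)
      (by rw [← hz2]; exact pow_le_pow_left₀ (by linarith) (by rw [pow_succ] at hk2; linarith) 2)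
    have := Finset.single_le_sum (fun k (_ : k ∈ Finset.range (N+1)) => hpos k) (Finset.mem_range.2 hkN)
    have : 0 ≤ R ^ (1 - m) := by positivity
    linarith

lemma J_bound (hn : 1 ≤ n) {φ : Eu n → ℝ} (hφ : Continuous φ) (ξ : Eu n) {a R : ℝ} (ha : 0 < a) (hR : 0 < R)
    {S : ENNReal} (hS : ∀ b, a ≤ b → Pav M φ ξ b ≤ S) :
    ∫⁻ x, ENNReal.ofReal |φ x| * ENNReal.ofReal (kq (n - 1) a ‖x - ξ‖) ∂surfMeasure M ≤
      ENNReal.ofReal (3 ^ ((n:ℝ) + 2) * (2 * R)) * S + ENNReal.ofReal (R ^ (1 - (n:ℝ))) * ∫⁻ x, ENNReal.ofReal |φ x| ∂surfMeasure M := by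
  have hm : (1:ℝ) ≤ n := by exact_mod_cast hn
  have hmφ : Measurable (fun x => ENNReal.ofReal |φ x|) := by fun_prop
  rcases lt_or_ge a R with h | h
  · obtain ⟨N, hN, hk⟩ := kq_dyadic hm ha h
    have hpos : ∀ (k : ℕ), 0 < 2 ^ k * a := fun k => by positivity
    have hmk : ∀ k : ℕ, Measurable (fun x => ENNReal.ofReal ((2 ^ k * a) ^ 2 * kq (n + 2) (2 ^ k * a) ‖x - ξ‖)) := fun k =>
      ENNReal.measurable_ofReal.comp ((continuous_kq' (hpos k) ξ).measurable.const_mul _)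
    calc _ ≤ ∫⁻ x, ∑ k ∈ Finset.range (N + 1), ENNReal.ofReal (3 ^ ((n:ℝ) + 2) * (2 ^ k * a)) * 
            (ENNReal.ofReal |φ x| * ENNReal.ofReal ((2 ^ k * a) ^ 2 * kq (n + 2) (2 ^ k * a) ‖x - ξ‖))
             + ENNReal.ofReal (R ^ (1 - (n:ℝ))) * ENNReal.ofReal |φ x| ∂surfMeasure M := by
          refine lintegral_mono fun x => ?_
          refine (mul_le_mul_right (ENNReal.ofReal_le_ofReal (hk ‖x - ξ‖)) _).trans (le_of_eq ?_)
          rw [ENNReal.ofReal_add _ (by positivity), ENNReal.ofReal_sum_of_nonneg, mul_add, Finset.mul_sum]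
          · congr 1
            · refine Finset.sum_congr rfl fun k _ => ?_
              rw [ENNReal.ofReal_mul (by positivity)]; ring
            · ring
          · intro k _
            have := kq_pos (q := (n:ℝ) + 2) (r := ‖x - ξ‖) (hpos k)
            positivity
          · refine Finset.sum_nonneg fun k _ => ?_
            have := kq_pos (q := (n:ℝ) + 2) (r := ‖x - ξ‖) (hpos k)
            positivity
      _ = ∑ k ∈ Finset.range (N + 1), ENNReal.ofReal (3 ^ ((n:ℝ) + 2) * (2 ^ k * a)) * Pav M φ ξ (2 ^ k * a)
            + ENNReal.ofReal (R ^ (1 - (n:ℝ))) * ∫⁻ x, ENNReal.ofReal |φ x| ∂surfMeasure M := by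
          rw [lintegral_add_right _ (hmφ.const_mul _), lintegral_const_mul _ hmφ, lintegral_finsetSum _ (fun k _ => Measurable.const_mul (Measurable.fun_mul hmφ (hmk k)) _)]
          congr 1
          refine Finset.sum_congr rfl fun k _ => ?_
          rw [lintegral_const_mul _ (Measurable.fun_mul hmφ (hmk k))]; rfl
      _ ≤ ∑ k ∈ Finset.range (N + 1), ENNReal.ofReal (3 ^ ((n:ℝ) + 2) * (2 ^ k * a)) * S
            + ENNReal.ofReal (R ^ (1 - (n:ℝ))) * ∫⁻ x, ENNReal.ofReal |φ x| ∂surfMeasure M := by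
          gcongr with k _
          exact hS _ (le_mul_of_one_le_left ha.le (one_le_pow₀ (by norm_num)))
      _ ≤ _ := by
          rw [← Finset.sum_mul, ← ENNReal.ofReal_sum_of_nonneg (fun k _ => by positivity)]
          gcongr
          rw [← Finset.mul_sum, ← Finset.sum_mul, geom_sum_eq (by norm_num)]
          have : (2 ^ (N+1) - 1) / (2 - 1) * a ≤ 2 * R := by
            norm_num; nlinarith
          gcongr
  · refine le_add_left ?_
    rw [← lintegral_const_mul _ hmφ]
    refine lintegral_mono fun x => ?_
    rw [mul_comm]
    gcongr
    have := kq_le_of_le (q := (n:ℝ) - 1) (a := a) (r := ‖x - ξ‖) (by linarith) hR (by nlinarith [sq_nonneg ‖x - ξ‖])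
    rwa [neg_sub] at this

lemma Pav_le {φ : Eu n → ℝ} (ξ : Eu n) {a₀ a : ℝ} (h0 : 0 < a₀) (ha : a₀ ≤ a) (hφ : Continuous φ) :
    Pav M φ ξ a ≤ ENNReal.ofReal (a₀ ^ (-(n:ℝ))) * ∫⁻ x, ENNReal.ofReal |φ x| ∂surfMeasure M := by
  rw [← lintegral_const_mul _ (by fun_prop), Pav]
  refine lintegral_mono fun x => ?_
  rw [mul_comm]
  gcongr
  have hpa : 0 < a := by linarith
  have := kq_le_of_le (q := (n:ℝ) + 2) (a := a) (r := ‖x - ξ‖) (by positivity) hpa (by nlinarith [sq_nonneg ‖x - ξ‖])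
  calc _ ≤ a ^ 2 * a ^ (-((n:ℝ) + 2)) := by gcongr
    _ = a ^ (-(n:ℝ)) := by
      rw [← Real.rpow_natCast a 2, ← Real.rpow_add hpa]; congr 1; push_cast; ring
    _ ≤ _ := Real.rpow_le_rpow_of_nonpos h0 ha (by simp)

/-- lower density constant -/
def cdens (n : ℕ) : ENNReal := ENNReal.ofReal (2⁻¹ * 2 ^ (-((n:ℝ) + 2)) * (4⁻¹) ^ n) * μH[(n:ℝ)] (Metric.ball (0 : Fu n) 1)

lemma cdens_pos : 0 < cdens n := by
  have := haar_Fu (n := n)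
  exact ENNReal.mul_pos (ENNReal.ofReal_pos.2 (by positivity)).ne' (Metric.measure_ball_pos _ _ one_pos).ne'

lemma cdens_lt : cdens n < ⊤ := by
  have := haar_Fu (n := n)
  exact ENNReal.mul_lt_top ENNReal.ofReal_lt_top measure_ball_lt_top

lemma Pav_lower {φ : Eu n → ℝ} (hφ : Continuous φ) {ξ : Eu n} (hξ : ξ ∈ M.carrier) (h1 : 1 ≤ |φ ξ|) :
    ∃ a > 0, cdens n ≤ Pav M φ ξ a := by
  obtain ⟨r0, hr0, hd⟩ := surf_density M hξ
  have hev : ∀ᶠ x in 𝓝 ξ, 2⁻¹ < |φ x| := hφ.abs.continuousAt.eventually (lt_mem_nhds (by linarith [show (2:ℝ)⁻¹ < 1 by norm_num]))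
  obtain ⟨δ, hδ, hb⟩ := Metric.eventually_nhds_iff_ball.1 hev
  have hm : 0 < min r0 δ := lt_min hr0 hδ
  obtain ⟨a, hadef⟩ : ∃ a, a = min r0 δ / 2 := ⟨_, rfl⟩
  have ha : 0 < a := by rw [hadef]; positivity
  refine ⟨a, ha, ?_⟩
  have har : a < r0 := hadef ▸ lt_of_lt_of_le (half_lt_self hm) (min_le_left _ _)
  have haδ : a < δ := hadef ▸ lt_of_lt_of_le (half_lt_self hm) (min_le_right _ _)
  calc cdens n = ENNReal.ofReal (2⁻¹ * (2 ^ (-((n:ℝ) + 2)) * a ^ (-(n:ℝ)))) * (ENNReal.ofReal (a/4)^n * μH[(n:ℝ)] (Metric.ball (0:Fu n) 1)) := by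
        rw [← mul_assoc, ← ENNReal.ofReal_pow (by positivity), ← ENNReal.ofReal_mul (by positivity), cdens]
        congr 2
        rw [Real.rpow_neg ha.le, Real.rpow_natCast, div_pow]
        field_simp
        rw [div_pow, one_pow]; field_simp
    _ ≤ ENNReal.ofReal (2⁻¹ * (2 ^ (-((n:ℝ) + 2)) * a ^ (-(n:ℝ)))) * surfMeasure M (Metric.closedBall ξ a) := by
        gcongr; exact hd a ha har
    _ = ∫⁻ x in Metric.closedBall ξ a, ENNReal.ofReal (2⁻¹ * (2 ^ (-((n:ℝ) + 2)) * a ^ (-(n:ℝ)))) ∂surfMeasure M := by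
        rw [setLIntegral_const]
    _ ≤ ∫⁻ x in Metric.closedBall ξ a, ENNReal.ofReal (|φ x|) * ENNReal.ofReal (a ^ 2 * kq (n + 2) a ‖x - ξ‖) ∂surfMeasure M := by
        refine setLIntegral_mono' Metric.isClosed_closedBall.measurableSet fun x hx => ?_
        rw [ENNReal.ofReal_mul (by norm_num)]
        rw [Metric.mem_closedBall, dist_eq_norm] at hx
        have hk := le_kq_of_le (q := (n:ℝ) + 2) (a := a) (r := ‖x - ξ‖) (z := 2 * a) (by positivity) ha (by positivity)
          (by nlinarith [norm_nonneg (x - ξ)])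
        refine mul_le_mul' (ENNReal.ofReal_le_ofReal ?_) (ENNReal.ofReal_le_ofReal ?_)
        · exact (hb x (by rw [Metric.mem_ball, dist_eq_norm]; linarith)).le
        · refine le_trans (le_of_eq ?_) (mul_le_mul_of_nonneg_left hk (sq_nonneg a))
          rw [Real.mul_rpow (by norm_num) ha.le, show -(n:ℝ) = -((n:ℝ)+2) + (2:ℕ) by push_cast; ring, Real.rpow_add ha,
            Real.rpow_natCast]
          push_cast; ring_nf
    _ ≤ _ := setLIntegral_le_lintegral _ _

end HS

namespace HS
open Set Filter Topology Module

variable {M : Hypersurface n}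

/-- The constant in the good radius lemma -/
def Kn (n : ℕ) : ℝ := 6 ^ ((n:ℝ) - 1) * (2 * 3 ^ ((n:ℝ) + 2) + 1) * (cdens n).toReal ^ (-(1 / (n:ℝ)))

lemma Kn_pos : 0 < Kn n := by
  have := ENNReal.toReal_pos (cdens_pos (n := n)).ne' cdens_lt.ne
  unfold Kn; positivity

lemma c1c_lintegral_lt {φ : Eu n → ℝ} (hφ : C1cOn M.carrier φ) : ∫⁻ x, ENNReal.ofReal |φ x| ∂surfMeasure M < ⊤ := by
  have h := c1c_integrable (F := fun x => |φ x|) hφ hφ.1.continuous.abs (fun x _ h _ => by simp [h])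
  rw [← ofReal_integral_eq_lintegral_ofReal h (Eventually.of_forall fun x => abs_nonneg _)]
  exact ENNReal.ofReal_lt_top

lemma bad_radius (hn : 2 ≤ n) {φ : Eu n → ℝ} (hφ : C1cOn M.carrier φ) {ξ : Eu n} {A : ENNReal} (hA : A ≠ ⊤)
    (h : ∀ ρ > 0, A * ∫⁻ x in Metric.ball ξ ρ, ENNReal.ofReal (Gf M φ x) ∂surfMeasure M ≤ 
      ∫⁻ x in Metric.ball ξ (6 * ρ), ENNReal.ofReal |φ x| ∂surfMeasure M) {a : ℝ} (ha : 0 < a) :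
    A * (ENNReal.ofReal n * Pav M φ ξ a) ≤ ENNReal.ofReal (6 ^ ((n:ℝ) - 1)) * 
      ∫⁻ x, ENNReal.ofReal |φ x| * ENNReal.ofReal (kq (n - 1) a ‖x - ξ‖) ∂surfMeasure M := by
  have hn' : (2:ℝ) ≤ n := by exact_mod_cast hn
  have mG : Measurable (fun x => ENNReal.ofReal (Gf M φ x)) := ENNReal.measurable_ofReal.comp (continuous_Gf M hφ.1).measurable
  have cφ := hφ.1.continuous
  have mφ : Measurable (fun x => ENNReal.ofReal |φ x|) := by fun_prop
  have mk : Measurable (fun x => ENNReal.ofReal (kq (n - 1) a ‖x - ξ‖)) := ENNReal.measurable_ofReal.comp (continuous_kq' ha ξ).measurable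
  have mk6 : Measurable (fun x => ENNReal.ofReal (kq (n - 1) a (‖x - ξ‖ / 6))) := by
    unfold kq; fun_prop
  have hl := layer_cake ((surfMeasure M).withDensity (fun x => ENNReal.ofReal (Gf M φ x)))
    ((surfMeasure M).withDensity (fun x => ENNReal.ofReal |φ x|)) ξ hA (q := n - 1) (by linarith) ha (fun ρ hρ => by
      rw [withDensity_apply _ measurableSet_ball, withDensity_apply _ measurableSet_ball]; exact h ρ hρ)
  rw [lintegral_withDensity_eq_lintegral_mul _ mG mk, lintegral_withDensity_eq_lintegral_mul _ mφ mk6] at hl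
  refine (mul_le_mul_right (star_kernel hφ ξ ha) A).trans (hl.trans ?_)
  rw [← lintegral_const_mul _ (Measurable.fun_mul mφ mk)]
  refine lintegral_mono fun x => ?_
  simp only [Pi.mul_apply]
  rw [mul_left_comm, ← ENNReal.ofReal_mul (p := 6 ^ ((n:ℝ) - 1)) (by positivity)]
  refine mul_le_mul_right (ENNReal.ofReal_le_ofReal ?_) _
  exact kq_div_six (by linarith) ha

lemma good_radius (hn : 2 ≤ n) {φ : Eu n → ℝ} (hφ : C1cOn M.carrier φ) {ξ : Eu n} (hξ : ξ ∈ M.carrier) (h1 : 1 ≤ |φ ξ|) :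
    ∃ ρ > 0, ∫⁻ x in Metric.ball ξ (6 * ρ), ENNReal.ofReal |φ x| ∂surfMeasure M <
      ENNReal.ofReal (Kn n * (∫⁻ x, ENNReal.ofReal |φ x| ∂surfMeasure M).toReal ^ (1 / (n:ℝ))) * 
        ∫⁻ x in Metric.ball ξ ρ, ENNReal.ofReal (Gf M φ x) ∂surfMeasure M := by
  by_contra hc
  push Not at hc
  have hn' : (2:ℝ) ≤ n := by exact_mod_cast hn
  have cφ := hφ.1.continuous
  obtain ⟨a₀, ha₀, hlow⟩ := Pav_lower cφ hξ h1
  have hTlt := c1c_lintegral_lt hφ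
  set T := ∫⁻ x, ENNReal.ofReal |φ x| ∂surfMeasure M with hT
  set S : ENNReal := ⨆ b : Ici a₀, Pav M φ ξ b with hS
  have hSle : S ≤ ENNReal.ofReal (a₀ ^ (-(n:ℝ))) * T := iSup_le fun b => Pav_le ξ ha₀ b.2 cφ
  have hSlt : S < ⊤ := hSle.trans_lt (ENNReal.mul_lt_top ENNReal.ofReal_lt_top hTlt)
  have hcS : cdens n ≤ S := hlow.trans (le_iSup (fun b : Ici a₀ => Pav M φ ξ b) ⟨a₀, le_refl a₀⟩)
  have hSpos : 0 < S := cdens_pos.trans_le hcS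
  have hTpos : 0 < T := by
    rcases eq_or_ne T 0 with h0 | h0
    · rw [h0, mul_zero] at hSle; exact absurd hSle (not_le.2 hSpos)
    · exact pos_iff_ne_zero.2 h0
  have hc' := ENNReal.toReal_pos (cdens_pos (n := n)).ne' cdens_lt.ne
  have hτ := ENNReal.toReal_pos hTpos.ne' hTlt.ne
  have hs := ENNReal.toReal_pos hSpos.ne' hSlt.ne
  have hcs : (cdens n).toReal ≤ S.toReal := ENNReal.toReal_mono hSlt.ne hcS
  set c := (cdens n).toReal with hcdef
  set τ := T.toReal with hτdef
  set s := S.toReal with hsdef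
  have eT : T = ENNReal.ofReal τ := (ENNReal.ofReal_toReal hTlt.ne).symm
  have eS : S = ENNReal.ofReal s := (ENNReal.ofReal_toReal hSlt.ne).symm
  set R := (τ / c) ^ (1 / (n:ℝ)) with hRdef
  have hR : 0 < R := by positivity
  have hAR : Kn n * τ ^ (1 / (n:ℝ)) = 6 ^ ((n:ℝ) - 1) * (2 * 3 ^ ((n:ℝ) + 2) + 1) * R := by
    rw [Kn, hRdef, Real.div_rpow hτ.le hc'.le, Real.rpow_neg hc'.le]; field_simp
  rw [hAR] at hc
  set A := 6 ^ ((n:ℝ) - 1) * (2 * 3 ^ ((n:ℝ) + 2) + 1) * R with hA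
  have hA0 : 0 < A := by positivity
  have hRn : R ^ (1 - (n:ℝ)) * τ = R * c := by
    have : R ^ (-(n:ℝ)) = c / τ := by
      rw [hRdef, ← Real.rpow_mul (by positivity), show 1 / (n:ℝ) * -(n:ℝ) = -1 by field_simp, Real.rpow_neg_one, inv_div]
    rw [sub_eq_add_neg, Real.rpow_add hR, Real.rpow_one, this]; field_simp
  have key : ∀ b : Ici a₀, 2 * Pav M φ ξ b ≤ S := by
    rintro ⟨a, ha⟩
    have ha' : 0 < a := lt_of_lt_of_le ha₀ ha
    have h2 := bad_radius hn hφ ENNReal.ofReal_ne_top hc ha'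
    have h3 := J_bound (M := M) (by omega) cφ ξ ha' hR (S := S) (fun b hb => le_iSup (fun b : Ici a₀ => Pav M φ ξ b) ⟨b, le_trans ha hb⟩)
    have h4 := h2.trans (mul_le_mul_right h3 _)
    have h5 : ENNReal.ofReal A * (ENNReal.ofReal n * Pav M φ ξ a) ≤ ENNReal.ofReal A * S := by
      refine h4.trans ?_
      rw [← hT, eT, eS, ← ENNReal.ofReal_mul (by positivity), ← ENNReal.ofReal_mul (by positivity), 
        ← ENNReal.ofReal_add (by positivity) (by positivity), ← ENNReal.ofReal_mul (by positivity),
        ← ENNReal.ofReal_mul (by positivity), hRn]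
      refine ENNReal.ofReal_le_ofReal ?_
      rw [hA]
      have hP : (0:ℝ) ≤ 6 ^ ((n:ℝ) - 1) := by positivity
      have hRc : R * c ≤ R * s := mul_le_mul_of_nonneg_left hcs hR.le
      refine (mul_le_mul_of_nonneg_left (add_le_add_right hRc _) hP).trans (le_of_eq ?_)
      ring
    have h6 := (ENNReal.mul_le_mul_iff_right (a := ENNReal.ofReal A) (ne_of_gt (ENNReal.ofReal_pos.2 hA0)) ENNReal.ofReal_ne_top).1 h5
    refine le_trans ?_ h6
    gcongr
    rw [show (2:ENNReal) = ENNReal.ofReal 2 by simp]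
    exact ENNReal.ofReal_le_ofReal hn'
  have h7 : 2 * S ≤ S := by
    rw [hS, ENNReal.mul_iSup]; exact iSup_le key
  have h8 := ENNReal.toReal_mono hSlt.ne h7
  rw [ENNReal.toReal_mul] at h8
  norm_num at h8
  linarith

end HS

namespace HS
open Set Filter Topology Module

variable {M : Hypersurface n}

lemma good_radius_bdd (hn : 2 ≤ n) {φ : Eu n → ℝ} (hφ : C1cOn M.carrier φ) :
    ∃ R₀ : ℝ, ∀ ξ ∈ M.carrier, 1 ≤ |φ ξ| → 
    ∃ ρ > 0, ρ ≤ R₀ ∧ ∫⁻ x in Metric.ball ξ (6 * ρ), ENNReal.ofReal |φ x| ∂surfMeasure M ≤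
      ENNReal.ofReal (Kn n * (∫⁻ x, ENNReal.ofReal |φ x| ∂surfMeasure M).toReal ^ (1 / (n:ℝ))) * 
        ∫⁻ x in Metric.ball ξ ρ, ENNReal.ofReal (Gf M φ x) ∂surfMeasure M := by
  obtain ⟨K, hK, hKM, h0⟩ := hφ.2
  obtain ⟨B, hB⟩ := hK.isBounded.exists_norm_le
  refine ⟨2 * |B| + 1, fun ξ hξ h1 => ?_⟩
  obtain ⟨ρ, hρ, h⟩ := good_radius hn hφ hξ h1
  rcases le_or_gt ρ (2 * |B| + 1) with hl | hl
  · exact ⟨ρ, hρ, hl, h.le⟩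
  refine ⟨2 * |B| + 1, by positivity, le_rfl, ?_⟩
  have hξK : ξ ∈ K := by
    by_contra hc; rw [h0 ξ hξ hc] at h1; norm_num at h1
  have hKb : ∀ x ∈ K, x ∈ Metric.ball ξ (2 * |B| + 1) := fun x hx => by
    rw [Metric.mem_ball, dist_eq_norm]
    have := norm_sub_le x ξ
    have := hB x hx
    have := hB ξ hξK
    have := le_abs_self B
    linarith
  calc _ ≤ ∫⁻ x in Metric.ball ξ (6 * ρ), ENNReal.ofReal |φ x| ∂surfMeasure M := 
        lintegral_mono_set (Metric.ball_subset_ball (by linarith))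
    _ ≤ _ := h.le
    _ ≤ _ := by
        gcongr _ * ?_
        refine (setLIntegral_le_lintegral _ _).trans (le_of_eq ?_)
        rw [← lintegral_indicator measurableSet_ball]
        refine lintegral_congr_ae ?_
        filter_upwards [ae_mem M] with x hx
        by_cases hxK : x ∈ K
        · rw [indicator_of_mem (hKb x hxK)]
        · have : Gf M φ x = 0 := by
            simp [Gf, h0 x hx hxK, tgrad_zero_of_supp M hK hφ.1 h0 hx hxK]
          simp [indicator, this]

lemma weak_ineq (hn : 2 ≤ n) {φ : Eu n → ℝ} (hφ : C1cOn M.carrier φ) :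
    surfMeasure M {x | 1 ≤ |φ x|} ≤ 
      ENNReal.ofReal (Kn n * (∫⁻ x, ENNReal.ofReal |φ x| ∂surfMeasure M).toReal ^ (1 / (n:ℝ))) * 
        ∫⁻ x, ENNReal.ofReal (Gf M φ x) ∂surfMeasure M := by
  obtain ⟨R₀, hR⟩ := good_radius_bdd hn hφ
  have cφ := hφ.1.continuous
  have hEm : MeasurableSet {x | 1 ≤ |φ x|} := (isClosed_le continuous_const cφ.abs).measurableSet
  set A := ENNReal.ofReal (Kn n * (∫⁻ x, ENNReal.ofReal |φ x| ∂surfMeasure M).toReal ^ (1 / (n:ℝ)))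
  choose! ρ hρ hρR hineq using hR
  set E := {x | x ∈ M.carrier ∧ 1 ≤ |φ x|}
  obtain ⟨u, huE, hdisj, hcov⟩ := Vitali.exists_disjoint_subfamily_covering_enlargement_closedBall E id ρ R₀
    (fun x hx => hρR x hx.1 hx.2) 5 (by norm_num)
  simp only [id] at hdisj hcov
  have hcount : u.Countable := hdisj.countable_of_nonempty_interior (fun x hx => by
    refine ⟨x, ?_⟩
    exact Metric.ball_subset_interior_closedBall (Metric.mem_ball_self (hρ x (huE hx).1 (huE hx).2)))
  have h1 : surfMeasure M {x | 1 ≤ |φ x|} ≤ surfMeasure M (⋃ x ∈ u, ({y | 1 ≤ |φ y|} ∩ Metric.closedBall x (5 * ρ x))) := by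
    refine measure_mono_ae ?_
    filter_upwards [ae_mem M] with x hx hx1
    obtain ⟨b, hb, hs⟩ := hcov x ⟨hx, hx1⟩
    refine mem_iUnion₂.2 ⟨b, hb, hx1, hs ?_⟩
    exact Metric.mem_closedBall_self (hρ x hx hx1).le
  refine h1.trans ((measure_biUnion_le _ hcount _).trans ?_)
  have h2 : ∀ x : u, surfMeasure M ({y | 1 ≤ |φ y|} ∩ Metric.closedBall (x : Eu n) (5 * ρ x)) ≤ 
      A * ∫⁻ y in Metric.closedBall (x : Eu n) (ρ x), ENNReal.ofReal (Gf M φ y) ∂surfMeasure M := by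
    rintro ⟨x, hx⟩
    have hxE := huE hx
    have hpos := hρ x hxE.1 hxE.2
    calc _ = ∫⁻ y in {y | 1 ≤ |φ y|} ∩ Metric.closedBall x (5 * ρ x), 1 ∂surfMeasure M := by simp
      _ ≤ ∫⁻ y in {y | 1 ≤ |φ y|} ∩ Metric.closedBall x (5 * ρ x), ENNReal.ofReal |φ y| ∂surfMeasure M := by
          refine setLIntegral_mono' (hEm.inter Metric.isClosed_closedBall.measurableSet) fun y hy => ?_
          rw [ENNReal.one_le_ofReal]; exact hy.1
      _ ≤ ∫⁻ y in Metric.ball x (6 * ρ x), ENNReal.ofReal |φ y| ∂surfMeasure M := by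
          refine lintegral_mono_set (inter_subset_right.trans (Metric.closedBall_subset_ball (by linarith)))
      _ ≤ _ := hineq x hxE.1 hxE.2
      _ ≤ _ := by
          gcongr _ * ?_
          exact lintegral_mono_set Metric.ball_subset_closedBall
  refine (ENNReal.tsum_le_tsum h2).trans ?_
  rw [ENNReal.tsum_mul_left]
  gcongr _ * ?_
  rw [← lintegral_biUnion hcount (fun x _ => Metric.isClosed_closedBall.measurableSet) hdisj]
  exact setLIntegral_le_lintegral _ _

end HS

namespace HS
open Set Filter Topology Module

variable {M : Hypersurface n}

lemma exists_cutoff : ∃ (β : ℝ → ℝ) (L : ℝ), ContDiff ℝ 1 β ∧ 0 ≤ L ∧ (∀ s, 0 ≤ β s) ∧ (∀ s, β s ≤ 1) ∧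
    (∀ s, |s| ≤ 1 / 2 → β s = 0) ∧ (∀ s, 1 ≤ |s| → β s = 1) ∧ (∀ s, |deriv β s| ≤ L) ∧
    (∀ s, |s| ≤ 1 / 2 → deriv β s = 0) ∧ (∀ s, 1 ≤ |s| → deriv β s = 0) := by
  let β : ℝ → ℝ := fun s => Real.smoothTransition ((4 * s ^ 2 - 1) / 3)
  have hβ : ContDiff ℝ 1 β := Real.smoothTransition.contDiff.comp (by fun_prop)
  have h0 : ∀ s, 0 ≤ β s := fun s => Real.smoothTransition.nonneg _
  have h1 : ∀ s, β s ≤ 1 := fun s => Real.smoothTransition.le_one _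
  have h2 : ∀ s, |s| ≤ 1 / 2 → β s = 0 := fun s hs => Real.smoothTransition.zero_of_nonpos (by
    have := sq_abs s; nlinarith [abs_nonneg s])
  have h3 : ∀ s, 1 ≤ |s| → β s = 1 := fun s hs => Real.smoothTransition.one_of_one_le (by
    have := sq_abs s; nlinarith [abs_nonneg s])
  have d2 : ∀ s, |s| ≤ 1 / 2 → deriv β s = 0 := fun s hs => 
    IsLocalMin.deriv_eq_zero (Eventually.of_forall fun t => by rw [h2 s hs]; exact h0 t)
  have d3 : ∀ s, 1 ≤ |s| → deriv β s = 0 := fun s hs => 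
    IsLocalMax.deriv_eq_zero (Eventually.of_forall fun t => by rw [h3 s hs]; exact h1 t)
  obtain ⟨L, hL⟩ := isCompact_Icc.exists_bound_of_continuousOn (s := Icc (-1:ℝ) 1) (hβ.continuous_deriv le_rfl).continuousOn
  refine ⟨β, |L|, hβ, abs_nonneg L, h0, h1, h2, h3, fun s => ?_, d2, d3⟩
  rcases le_or_gt |s| 1 with h | h
  · exact (hL s (abs_le.1 h)).trans (le_abs_self L)
  · rw [d3 s h.le]; simp

lemma dyadic_sum_le {s t : ℝ} (hs : 1 ≤ s) (ht : 0 < t) :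
    ∑' k : ℤ, (if (2:ℝ) ^ k ≤ t then ENNReal.ofReal (((2:ℝ) ^ k) ^ s) else 0) ≤ ENNReal.ofReal (2 * t ^ s) := by
  obtain ⟨m, hm1, hm2⟩ := exists_mem_Ico_zpow ht (one_lt_two)
  have hinj : Function.Injective (fun j : ℕ => m - (j : ℤ)) := fun i j h => by simpa using h
  rw [← hinj.tsum_eq]
  · calc _ ≤ ∑' j : ℕ, ENNReal.ofReal (t ^ s * (1 / 2) ^ j) := by
          refine ENNReal.tsum_le_tsum fun j => ?_
          split_ifs
          · refine ENNReal.ofReal_le_ofReal ?_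
            have e : (2:ℝ) ^ (m - (j:ℤ)) = 2 ^ m * (1/2) ^ j := by
              rw [zpow_sub₀ two_ne_zero, zpow_natCast]; field_simp
              rw [← mul_pow]; norm_num
            rw [e, Real.mul_rpow (by positivity) (by positivity)]
            have e2 : (((1:ℝ)/2) ^ j) ^ s ≤ (1/2) ^ j := by
              have := Real.rpow_le_rpow_of_exponent_ge (x := (1/2:ℝ) ^ j) (by positivity) (pow_le_one₀ (by norm_num) (by norm_num)) hs
              rwa [Real.rpow_one] at this
            gcongr
          · simp
      _ = ENNReal.ofReal (2 * t ^ s) := by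
          rw [← ENNReal.ofReal_tsum_of_nonneg (fun j => by positivity) (summable_geometric_two.mul_left _), tsum_mul_left, tsum_geometric_two, mul_comm]
  · intro k hk
    rw [Function.mem_support] at hk
    have hk' : (2:ℝ) ^ k ≤ t := by
      by_contra hc; simp [hc] at hk
    have : k < m + 1 := (zpow_lt_zpow_iff_right₀ one_lt_two).1 (hk'.trans_lt hm2)
    refine ⟨(m - k).toNat, ?_⟩
    simp only
    omega

lemma le_dyadic_sum {s t : ℝ} (hs : 0 ≤ s) (ht : 0 < t) :
    ENNReal.ofReal (t ^ s) ≤ ENNReal.ofReal (2 ^ s) * ∑' k : ℤ, (if (2:ℝ) ^ k ≤ t then ENNReal.ofReal (((2:ℝ) ^ k) ^ s) else 0) := by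
  obtain ⟨m, hm1, hm2⟩ := exists_mem_Ico_zpow ht (one_lt_two)
  refine le_trans ?_ (mul_le_mul_right (ENNReal.le_tsum m) _)
  rw [if_pos hm1, ← ENNReal.ofReal_mul (by positivity), ← Real.mul_rpow (by positivity) (by positivity)]
  refine ENNReal.ofReal_le_ofReal (Real.rpow_le_rpow ht.le ?_ hs)
  rw [zpow_add_one₀ two_ne_zero] at hm2; linarith

lemma dyadic_sum_le_shift {t : ℝ} (ht : 0 < t) :
    ∑' k : ℤ, (if (2:ℝ) ^ (k - 1) ≤ t then ENNReal.ofReal ((2:ℝ) ^ k) else 0) ≤ ENNReal.ofReal (4 * t) := by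
  rw [← (Equiv.addRight (1:ℤ)).tsum_eq]
  have h := dyadic_sum_le (s := 1) le_rfl ht
  calc _ = ENNReal.ofReal 2 * ∑' k : ℤ, (if (2:ℝ) ^ k ≤ t then ENNReal.ofReal (((2:ℝ) ^ k) ^ (1:ℝ)) else 0) := by
        rw [← ENNReal.tsum_mul_left]
        refine tsum_congr fun k => ?_
        simp only [Equiv.coe_addRight, add_sub_cancel_right, Real.rpow_one, mul_ite, mul_zero]
        congr 1
        rw [← ENNReal.ofReal_mul (by norm_num), zpow_add_one₀ two_ne_zero, mul_comm]
    _ ≤ _ := by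
        refine (mul_le_mul_right h _).trans (le_of_eq ?_)
        rw [← ENNReal.ofReal_mul (by norm_num), Real.rpow_one]; ring_nf

/-- truncation step -/
lemma trunc_step (hn : 2 ≤ n) {β : ℝ → ℝ} (hβ : ContDiff ℝ 1 β) (h0 : ∀ s, 0 ≤ β s) (h1 : ∀ s, β s ≤ 1)
    (h2 : ∀ s, |s| ≤ 1 / 2 → β s = 0) (h3 : ∀ s, 1 ≤ |s| → β s = 1)
    {φ : Eu n → ℝ} (hφ : C1cOn M.carrier φ) {l : ℝ} (hl : 0 < l) :
    surfMeasure M {x | l ≤ |φ x|} ≤ ENNReal.ofReal (Kn n) * surfMeasure M {x | l / 2 ≤ |φ x|} ^ (1 / (n:ℝ)) *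
      ∫⁻ x, ENNReal.ofReal (Gf M (fun x => β (l⁻¹ * φ x)) x) ∂surfMeasure M := by
  have cφ := hφ.1.continuous
  have hh : C1cOn M.carrier (fun x => β (l⁻¹ * φ x)) := by
    obtain ⟨K, hK, hKM, h⟩ := hφ.2
    refine ⟨hβ.comp (contDiff_const.mul hφ.1), K, hK, hKM, fun x hx hxK => ?_⟩
    simp only [h x hx hxK]; exact h2 _ (by norm_num)
  have hw := weak_ineq hn hh
  have hT := c1c_lintegral_lt hh
  have hTle : ∫⁻ x, ENNReal.ofReal |β (l⁻¹ * φ x)| ∂surfMeasure M ≤ surfMeasure M {x | l / 2 ≤ |φ x|} := by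
    have hm : MeasurableSet {x | l / 2 ≤ |φ x|} := (isClosed_le continuous_const cφ.abs).measurableSet
    rw [← lintegral_indicator_one hm]
    refine lintegral_mono fun x => ?_
    by_cases hx : l / 2 ≤ |φ x|
    · rw [indicator_of_mem (by exact hx), abs_of_nonneg (h0 _)]
      simpa using h1 _
    · rw [h2]; · simp
      rw [abs_mul, abs_of_pos (inv_pos.2 hl), inv_mul_le_iff₀ hl]; linarith
  rw [ENNReal.ofReal_mul Kn_pos.le, ← ENNReal.ofReal_rpow_of_nonneg ENNReal.toReal_nonneg (by positivity), ENNReal.ofReal_toReal hT.ne] at hw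
  refine le_trans (measure_mono fun x hx => ?_) (hw.trans ?_)
  · have hx : l ≤ |φ x| := hx
    show 1 ≤ |β (l⁻¹ * φ x)|
    rw [h3]; · simp
    rw [abs_mul, abs_of_pos (inv_pos.2 hl), le_inv_mul_iff₀ hl]; linarith
  · gcongr

lemma Gf_trunc {β : ℝ → ℝ} {L : ℝ} (hβ : ContDiff ℝ 1 β) (hL : 0 ≤ L) (h0 : ∀ s, 0 ≤ β s) (h1 : ∀ s, β s ≤ 1)
    (h2 : ∀ s, |s| ≤ 1 / 2 → β s = 0) (d : ∀ s, |deriv β s| ≤ L)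
    (d2 : ∀ s, |s| ≤ 1 / 2 → deriv β s = 0) (d3 : ∀ s, 1 ≤ |s| → deriv β s = 0)
    {φ : Eu n → ℝ} (hφ : ContDiff ℝ 1 φ) {l : ℝ} (hl : 0 < l) (x : Eu n) :
    l * Gf M (fun x => β (l⁻¹ * φ x)) x * |φ x| ≤ if l / 2 ≤ |φ x| then l * ((L + 1) * Gf M φ x) else 0 := by
  have e : tgrad M.nu (fun x => β (l⁻¹ * φ x)) x = (deriv β (l⁻¹ * φ x) * l⁻¹) • tgrad M.nu φ x := by
    refine tgrad_comp M.nu (β := fun s => β (l⁻¹ * s)) (hφ.differentiable one_ne_zero x) ?_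
    have := (hβ.differentiable one_ne_zero (l⁻¹ * φ x)).hasDerivAt.comp (φ x) ((hasDerivAt_id (φ x)).const_mul l⁻¹)
    rw [mul_one] at this; exact this
  have ea : |l⁻¹ * φ x| = l⁻¹ * |φ x| := by rw [abs_mul, abs_of_pos (inv_pos.2 hl)]
  have nt := norm_nonneg (tgrad M.nu φ x)
  have na := abs_nonneg (φ x)
  simp only [Gf]
  rw [e, norm_smul, Real.norm_eq_abs, abs_mul, abs_of_pos (inv_pos.2 hl)]
  split_ifs with hx
  · have a1 : |deriv β (l⁻¹ * φ x)| * |φ x| ≤ L * l := by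
      by_cases hc : 1 ≤ |l⁻¹ * φ x|
      · rw [d3 _ hc]; simp; positivity
      · rw [ea, le_inv_mul_iff₀ hl] at hc
        exact mul_le_mul (d _) (by linarith) na hL
    have a2 : |meanCurv M x * β (l⁻¹ * φ x)| * |φ x| ≤ |meanCurv M x * φ x| := by
      rw [abs_mul, abs_mul, abs_of_nonneg (h0 _)]
      have := mul_le_mul_of_nonneg_right (mul_le_mul_of_nonneg_left (h1 (l⁻¹ * φ x)) (abs_nonneg (meanCurv M x))) na
      linarith
    have a3 := abs_nonneg (meanCurv M x * φ x)
    calc _ = ‖tgrad M.nu φ x‖ * (|deriv β (l⁻¹ * φ x)| * |φ x|) + l * (|meanCurv M x * β (l⁻¹ * φ x)| * |φ x|) := by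
          field_simp
      _ ≤ ‖tgrad M.nu φ x‖ * (L * l) + l * |meanCurv M x * φ x| := by gcongr
      _ ≤ _ := by
          have := mul_nonneg hl.le (mul_nonneg hL a3)
          have := mul_nonneg hl.le nt
          nlinarith
  · have : |l⁻¹ * φ x| ≤ 1 / 2 := by
      rw [ea, inv_mul_le_iff₀ hl]; linarith
    rw [d2 _ this, h2 _ this]; simp

end HS

namespace HS
open Set Filter Topology Module

variable {M : Hypersurface n}

lemma sobolev_one (hn : 2 ≤ n) : ∃ C : ℝ, 0 < C ∧ ∀ (M : Hypersurface n) (φ : Eu n → ℝ), C1cOn M.carrier φ →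
    (∫⁻ x, ENNReal.ofReal (|φ x| ^ ((n:ℝ) / (n - 1))) ∂surfMeasure M) ^ (((n:ℝ) - 1) / n) ≤
      ENNReal.ofReal C * ∫⁻ x, ENNReal.ofReal (Gf M φ x) ∂surfMeasure M := by
  have hn' : (2:ℝ) ≤ n := by exact_mod_cast hn
  obtain ⟨β, L, hβ, hL, h0, h1, h2, h3, d, d2, d3⟩ := exists_cutoff
  set s := (n:ℝ) / (n - 1) with hsdef
  have hn1 : (0:ℝ) < n - 1 := by linarith
  have hs1 : 1 ≤ s := by rw [hsdef, le_div_iff₀ hn1]; linarith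
  have hs0 : 0 < s := by linarith
  have hsn : s = s / n + 1 := by rw [hsdef]; field_simp; ring
  have K1 := Kn_pos (n := n)
  refine ⟨2 * (Kn n * 2 ^ (s / n)) * (4 * (L + 1)), by positivity, fun M φ hφ => ?_⟩
  have cφ := hφ.1.continuous
  set μ := surfMeasure M
  set a : ℤ → ENNReal := fun k => μ {x | (2:ℝ) ^ k ≤ |φ x|} with ha
  set X : ℤ → ENNReal := fun k => ENNReal.ofReal (((2:ℝ) ^ k) ^ s) * a k with hX
  set I : ℤ → ENNReal := fun k => ∫⁻ x, ENNReal.ofReal (Gf M (fun x => β (((2:ℝ) ^ k)⁻¹ * φ x)) x) ∂μ with hI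
  set A := ∑' k, X k with hA
  have hms : ∀ k : ℤ, MeasurableSet {x | (2:ℝ) ^ k ≤ |φ x|} := fun k => (isClosed_le continuous_const cφ.abs).measurableSet
  -- A as an integral
  have eA : A = ∫⁻ x, ∑' k : ℤ, (if (2:ℝ) ^ k ≤ |φ x| then ENNReal.ofReal (((2:ℝ) ^ k) ^ s) else 0) ∂μ := by
    rw [lintegral_tsum]
    · refine tsum_congr fun k => ?_
      rw [hX]; simp only [ha]
      rw [← setLIntegral_const, ← lintegral_indicator (hms k)]
      rfl
    · intro k
      exact (Measurable.ite (hms k) measurable_const measurable_const).aemeasurable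
  have hfin : A ≠ ⊤ := by
    have hint : Integrable (fun x => 2 * |φ x| ^ s) μ := c1c_integrable hφ 
      (continuous_const.mul (cφ.abs.rpow_const fun x => Or.inr hs0.le)) (fun x _ h _ => by simp [h, hs0.ne'])
    have : A ≤ ∫⁻ x, ENNReal.ofReal (2 * |φ x| ^ s) ∂μ := by
      rw [eA]
      refine lintegral_mono fun x => ?_
      rcases (abs_nonneg (φ x)).eq_or_lt with h | h
      · simp only [← h]
        rw [ENNReal.tsum_eq_zero.2]; · simp
        intro k; rw [if_neg]; exact not_le.2 (by positivity)
      · exact dyadic_sum_le hs1 h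
    refine (this.trans_lt ?_).ne
    rw [← ofReal_integral_eq_lintegral_ofReal hint (Eventually.of_forall fun x => by positivity)]
    exact ENNReal.ofReal_lt_top
  have hup : ∫⁻ x, ENNReal.ofReal (|φ x| ^ s) ∂μ ≤ ENNReal.ofReal (2 ^ s) * A := by
    rw [eA, ← lintegral_const_mul' _ _ ENNReal.ofReal_ne_top]
    refine lintegral_mono fun x => ?_
    rcases (abs_nonneg (φ x)).eq_or_lt with h | h
    · simp only [← h]; rw [Real.zero_rpow hs0.ne']; simp
    · exact le_dyadic_sum hs0.le h
  -- the step
  have step : ∀ k : ℤ, X k ≤ ENNReal.ofReal (Kn n * 2 ^ (s / n)) * A ^ (1 / (n:ℝ)) * (ENNReal.ofReal (2 ^ k) * I k) := by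
    intro k
    have hk : (0:ℝ) < 2 ^ k := by positivity
    have ht := trunc_step (M := M) hn hβ h0 h1 h2 h3 hφ hk
    have ek : (2:ℝ) ^ k / 2 = 2 ^ (k - 1) := by rw [zpow_sub_one₀ two_ne_zero]; ring
    have hk1 : (0:ℝ) < 2 ^ (k - 1) := by positivity
    rw [ek] at ht
    have hXA : X (k - 1) ^ (1 / (n:ℝ)) ≤ A ^ (1 / (n:ℝ)) := ENNReal.rpow_le_rpow (ENNReal.le_tsum _) (by positivity)
    have e1 : ((2:ℝ) ^ k) ^ s = ((2:ℝ) ^ (k - 1)) ^ (s / n) * 2 ^ (s / n) * 2 ^ k := by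
      rw [← Real.mul_rpow hk1.le two_pos.le, ← ek, div_mul_cancel₀ _ two_ne_zero]
      conv_lhs => rw [hsn, Real.rpow_add hk, Real.rpow_one]
    have e2 : X (k - 1) ^ (1 / (n:ℝ)) = ENNReal.ofReal (((2:ℝ) ^ (k - 1)) ^ (s / n)) * a (k - 1) ^ (1 / (n:ℝ)) := by
      rw [hX]; simp only
      rw [ENNReal.mul_rpow_of_nonneg _ _ (by positivity), ENNReal.ofReal_rpow_of_nonneg (by positivity) (by positivity),
        ← Real.rpow_mul hk1.le, mul_one_div]
    calc X k = ENNReal.ofReal (((2:ℝ) ^ k) ^ s) * a k := rfl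
      _ ≤ ENNReal.ofReal (((2:ℝ) ^ k) ^ s) * (ENNReal.ofReal (Kn n) * a (k - 1) ^ (1 / (n:ℝ)) * I k) := by
          gcongr
      _ = ENNReal.ofReal (Kn n * 2 ^ (s / n)) * X (k - 1) ^ (1 / (n:ℝ)) * (ENNReal.ofReal (2 ^ k) * I k) := by
          rw [e2, e1, ENNReal.ofReal_mul (by positivity), ENNReal.ofReal_mul (by positivity), ENNReal.ofReal_mul K1.le]; ring
      _ ≤ _ := by gcongr
  have hIsum : ∑' k, ENNReal.ofReal (2 ^ k) * I k ≤ ENNReal.ofReal (4 * (L + 1)) * ∫⁻ x, ENNReal.ofReal (Gf M φ x) ∂μ := by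
    have cT : ∀ k : ℤ, ContDiff ℝ 1 (fun x => β (((2:ℝ) ^ k)⁻¹ * φ x)) := fun k => hβ.comp (contDiff_const.mul hφ.1)
    have mT : ∀ k : ℤ, Measurable (fun x => ENNReal.ofReal (Gf M (fun x => β (((2:ℝ) ^ k)⁻¹ * φ x)) x)) := fun k =>
      ENNReal.measurable_ofReal.comp (continuous_Gf M (cT k)).measurable
    have : ∑' k, ENNReal.ofReal (2 ^ k) * I k = ∫⁻ x, ∑' k : ℤ, ENNReal.ofReal (2 ^ k) * ENNReal.ofReal (Gf M (fun x => β (((2:ℝ) ^ k)⁻¹ * φ x)) x) ∂μ := by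
      rw [lintegral_tsum (fun k => ((mT k).const_mul _).aemeasurable)]
      refine tsum_congr fun k => ?_
      rw [lintegral_const_mul _ (mT k)]
    rw [this, ← lintegral_const_mul' _ _ ENNReal.ofReal_ne_top]
    refine lintegral_mono fun x => ?_
    rcases (abs_nonneg (φ x)).eq_or_lt with h | h
    · rw [ENNReal.tsum_eq_zero.2]; · simp
      intro k
      have hz : φ x = 0 := abs_eq_zero.1 h.symm
      have e : tgrad M.nu (fun x => β (((2:ℝ) ^ k)⁻¹ * φ x)) x = (0:ℝ) • tgrad M.nu φ x := by
        refine tgrad_comp M.nu (β := fun s => β (((2:ℝ) ^ k)⁻¹ * s)) (hφ.1.differentiable one_ne_zero x) ?_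
        have := (hβ.differentiable one_ne_zero (((2:ℝ) ^ k)⁻¹ * φ x)).hasDerivAt.comp (φ x) ((hasDerivAt_id (φ x)).const_mul ((2:ℝ) ^ k)⁻¹)
        rw [d2 _ (by rw [hz]; norm_num), zero_mul] at this; exact this
      have : Gf M (fun x => β (((2:ℝ) ^ k)⁻¹ * φ x)) x = 0 := by
        simp only [Gf]
        rw [e, hz, mul_zero, h2 0 (by norm_num)]; simp
      rw [this]; simp
    · have hpt : ∀ k : ℤ, ENNReal.ofReal (2 ^ k) * ENNReal.ofReal (Gf M (fun x => β (((2:ℝ) ^ k)⁻¹ * φ x)) x) ≤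
          ENNReal.ofReal ((L + 1) * Gf M φ x / |φ x|) * (if (2:ℝ) ^ (k - 1) ≤ |φ x| then ENNReal.ofReal ((2:ℝ) ^ k) else 0) := by
        intro k
        have ek : (2:ℝ) ^ k / 2 = 2 ^ (k - 1) := by rw [zpow_sub_one₀ two_ne_zero]; ring
        have hg := Gf_trunc (M := M) hβ hL h0 h1 h2 d d2 d3 hφ.1 (l := 2 ^ k) (by positivity) x
        rw [ek] at hg
        have hG := Gf_nonneg M φ x
        rw [← ENNReal.ofReal_mul (by positivity)]
        split_ifs at hg ⊢
        · rw [← ENNReal.ofReal_mul (by positivity)]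
          refine ENNReal.ofReal_le_ofReal ?_
          rw [div_mul_eq_mul_div, le_div_iff₀ h]; linarith
        · rw [mul_zero, nonpos_iff_eq_zero, ENNReal.ofReal_eq_zero]
          exact nonpos_of_mul_nonpos_left hg h
      refine (ENNReal.tsum_le_tsum hpt).trans ?_
      rw [ENNReal.tsum_mul_left]
      refine (mul_le_mul_right (dyadic_sum_le_shift h) _).trans (le_of_eq ?_)
      have hG := Gf_nonneg M φ x
      rw [← ENNReal.ofReal_mul (by positivity), ← ENNReal.ofReal_mul (by positivity)]
      congr 1; field_simp
  have hAA : A ≤ ENNReal.ofReal (Kn n * 2 ^ (s / n)) * A ^ (1 / (n:ℝ)) * (ENNReal.ofReal (4 * (L + 1)) * ∫⁻ x, ENNReal.ofReal (Gf M φ x) ∂μ) := by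
    calc A ≤ ∑' k, ENNReal.ofReal (Kn n * 2 ^ (s / n)) * A ^ (1 / (n:ℝ)) * (ENNReal.ofReal (2 ^ k) * I k) := ENNReal.tsum_le_tsum step
      _ = ENNReal.ofReal (Kn n * 2 ^ (s / n)) * A ^ (1 / (n:ℝ)) * ∑' k, (ENNReal.ofReal (2 ^ k) * I k) := ENNReal.tsum_mul_left
      _ ≤ _ := by gcongr
  have hexp : ((n:ℝ) - 1) / n = 1 - 1 / n := by field_simp
  have hexp0 : 0 < ((n:ℝ) - 1) / n := by positivity
  have hA2 : A ^ (((n:ℝ) - 1) / n) ≤ ENNReal.ofReal (Kn n * 2 ^ (s / n)) * (ENNReal.ofReal (4 * (L + 1)) * ∫⁻ x, ENNReal.ofReal (Gf M φ x) ∂μ) := by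
    rcases eq_or_ne A 0 with h | h
    · rw [h, ENNReal.zero_rpow_of_pos hexp0]; simp
    · rw [hexp, ENNReal.rpow_sub _ _ h hfin, ENNReal.rpow_one]
      refine ENNReal.div_le_of_le_mul (hAA.trans (le_of_eq ?_))
      ring
  calc _ ≤ (ENNReal.ofReal (2 ^ s) * A) ^ (((n:ℝ) - 1) / n) := ENNReal.rpow_le_rpow hup hexp0.le
    _ = ENNReal.ofReal 2 * A ^ (((n:ℝ) - 1) / n) := by
        rw [ENNReal.mul_rpow_of_nonneg _ _ hexp0.le, ENNReal.ofReal_rpow_of_nonneg (by positivity) hexp0.le, ← Real.rpow_mul two_pos.le,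
          show s * (((n:ℝ) - 1) / n) = 1 by rw [hsdef]; field_simp, Real.rpow_one]
    _ ≤ _ := by
        refine (mul_le_mul_right hA2 _).trans (le_of_eq ?_)
        rw [ENNReal.ofReal_mul (p := 2 * (Kn n * 2 ^ (s / n))) (by positivity), ENNReal.ofReal_mul (p := 2) (by positivity)]; ring

end HS

namespace HS
open Set Filter Topology Module

variable {M : Hypersurface n}

lemma c1c_power {φ : Eu n → ℝ} (hφ : C1cOn M.carrier φ) {γ : ℝ} (hγ : 1 ≤ γ) :
    ∃ ψ : Eu n → ℝ, C1cOn M.carrier ψ ∧ (∀ x, |ψ x| = |φ x| ^ γ) ∧ ∀ x, Gf M ψ x ≤ γ * (|φ x| ^ (γ - 1) * Gf M φ x) := by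
  rcases hγ.eq_or_lt with rfl | h1
  · exact ⟨φ, hφ, fun x => by simp, fun x => by simp⟩
  · have hγ0 : 0 < γ := by linarith
    refine ⟨fun x => |φ x| ^ γ, ⟨?_, ?_⟩, fun x => abs_of_nonneg (by positivity), fun x => ?_⟩
    · exact (contDiff_norm_rpow h1).comp hφ.1
    · obtain ⟨K, hK, hKM, h⟩ := hφ.2
      exact ⟨K, hK, hKM, fun x hx hxK => by simp [h x hx hxK, hγ0.ne']⟩
    · have e := tgrad_comp M.nu (hφ.1.differentiable one_ne_zero x) (hasDerivAt_abs_rpow (φ x) h1)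
      have e2 : |φ x| ^ (γ - 2) * |φ x| = |φ x| ^ (γ - 1) := by
        rcases (abs_nonneg (φ x)).eq_or_lt with h | h
        · rw [← h, mul_zero, Real.zero_rpow (by linarith)]
        · rw [show γ - 1 = γ - 2 + 1 by ring, Real.rpow_add h, Real.rpow_one]
      have e3 : |φ x| ^ γ = |φ x| ^ (γ - 1) * |φ x| := by
        rcases (abs_nonneg (φ x)).eq_or_lt with h | h
        · rw [← h, Real.zero_rpow (by linarith)]; simp
        · conv_lhs => rw [show γ = γ - 1 + 1 by ring, Real.rpow_add h, Real.rpow_one]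
      unfold Gf
      rw [e, norm_smul, Real.norm_eq_abs, abs_mul, abs_mul, abs_of_pos hγ0, abs_of_nonneg (by positivity : 0 ≤ |φ x| ^ (γ - 2)),
        mul_assoc γ, e2, abs_mul, abs_of_nonneg (by positivity : 0 ≤ |φ x| ^ γ), e3, abs_mul]
      have : 0 ≤ |φ x| ^ (γ - 1) * (|meanCurv M x| * |φ x|) := by positivity
      nlinarith

lemma holder_G {W G : Eu n → ℝ} (hW : Continuous W) (hG : Continuous G) (hW0 : ∀ x, 0 ≤ W x) (hG0 : ∀ x, 0 ≤ G x)
    {p : ℝ} (hp : 1 ≤ p) (μ : Measure (Eu n)) :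
    ∫⁻ x, ENNReal.ofReal (W x ^ (1 - 1 / p) * G x) ∂μ ≤ 
      (∫⁻ x, ENNReal.ofReal (W x) ∂μ) ^ (1 - 1 / p) * (∫⁻ x, ENNReal.ofReal (G x ^ p) ∂μ) ^ (1 / p) := by
  have hp0 : 0 < p := by linarith
  have h1 : 0 ≤ 1 - 1 / p := by
    rw [sub_nonneg, div_le_one hp0]; exact hp
  have h := ENNReal.lintegral_mul_norm_pow_le (μ := μ) (f := fun x => ENNReal.ofReal (W x)) (g := fun x => ENNReal.ofReal (G x ^ p))
    (by fun_prop) (by fun_prop) h1 (q := 1 / p) (by positivity) (by ring)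
  refine le_trans (lintegral_mono fun x => le_of_eq ?_) h
  have := hW0 x
  have := hG0 x
  rw [ENNReal.ofReal_rpow_of_nonneg (by positivity) h1, ENNReal.ofReal_rpow_of_nonneg (by positivity) (by positivity),
    ← Real.rpow_mul (by positivity), mul_one_div_cancel hp0.ne', Real.rpow_one, ← ENNReal.ofReal_mul (by positivity)]

lemma absorb {Y E : ENNReal} {K : ℝ} (hK : 0 ≤ K) (hY : Y ≠ ⊤) {u v p : ℝ} (hp : 0 < p) (huv : v < u)
    (h : Y ^ u ≤ ENNReal.ofReal K * (Y ^ v * E ^ (1 / p))) : Y ^ ((u - v) * p) ≤ ENNReal.ofReal (K ^ p) * E := by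
  have h1 : Y ^ (u - v) ≤ ENNReal.ofReal K * E ^ (1 / p) := by
    rcases eq_or_ne Y 0 with h0 | h0
    · rw [h0, ENNReal.zero_rpow_of_pos (by linarith)]; simp
    · rw [ENNReal.rpow_sub _ _ h0 hY]
      exact ENNReal.div_le_of_le_mul (h.trans (le_of_eq (by ring)))
  rw [ENNReal.rpow_mul]
  refine (ENNReal.rpow_le_rpow h1 hp.le).trans (le_of_eq ?_)
  rw [ENNReal.mul_rpow_of_nonneg _ _ hp.le, ← ENNReal.rpow_mul, one_div_mul_cancel hp.ne', ENNReal.rpow_one,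
    ENNReal.ofReal_rpow_of_nonneg hK hp.le]

lemma c1c_pow_lt {φ : Eu n → ℝ} (hφ : C1cOn M.carrier φ) {q : ℝ} (hq : 0 < q) {F : Eu n → ℝ} (hF : Continuous F) (hF0 : ∀ x, 0 ≤ F x) :
    ∫⁻ x, ENNReal.ofReal (|φ x| ^ q * F x) ∂surfMeasure M ≠ ⊤ := by
  have hint : Integrable (fun x => |φ x| ^ q * F x) (surfMeasure M) := c1c_integrable hφ 
    ((hφ.1.continuous.abs.rpow_const fun x => Or.inr hq.le).mul hF) (fun x _ h _ => by simp [h, hq.ne'])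
  rw [← ofReal_integral_eq_lintegral_ofReal hint (Eventually.of_forall fun x => mul_nonneg (by positivity) (hF0 x))]
  exact ENNReal.ofReal_ne_top

lemma sobolev_p {p : ℝ} (hp : 1 ≤ p) (hpn : p < n) : ∃ C : ℝ, 0 < C ∧ ∀ (M : Hypersurface n) (φ : Eu n → ℝ), C1cOn M.carrier φ →
    (∫⁻ x, ENNReal.ofReal (|φ x| ^ (n * p / (n - p))) ∂surfMeasure M) ^ (((n:ℝ) - p) / n) ≤
      ENNReal.ofReal C * ∫⁻ x, ENNReal.ofReal (Gf M φ x ^ p) ∂surfMeasure M := by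
  have hn : 2 ≤ n := by
    have : (1:ℝ) < n := by linarith
    exact_mod_cast this
  have hn' : (2:ℝ) ≤ n := by exact_mod_cast hn
  have hn1 : (0:ℝ) < n - 1 := by linarith
  have hnp : (0:ℝ) < n - p := by linarith
  have hp0 : 0 < p := by linarith
  obtain ⟨C, hC, h⟩ := sobolev_one hn
  set γ := p * (n - 1) / (n - p) with hγ
  have hγ1 : 1 ≤ γ := by rw [hγ, le_div_iff₀ hnp]; nlinarith
  have hγ0 : 0 < γ := by linarith
  refine ⟨(C * γ) ^ p, by positivity, fun M φ hφ => ?_⟩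
  obtain ⟨ψ, hψ, e1, e2⟩ := c1c_power hφ hγ1
  have h1 := h M ψ hψ
  set Q := n * p / (n - p) with hQ
  have hQ0 : 0 < Q := by positivity
  have eQ : γ * (n / (n - 1)) = Q := by rw [hγ, hQ]; field_simp
  have eQ2 : Q * (1 - 1 / p) = γ - 1 := by rw [hγ, hQ]; field_simp; ring
  have i1 : ∀ x, |ψ x| ^ ((n:ℝ) / (n - 1)) = |φ x| ^ Q := fun x => by
    rw [e1, ← Real.rpow_mul (abs_nonneg _), eQ]
  simp only [i1] at h1
  have cφ := hφ.1.continuous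
  have hH := holder_G (W := fun x => |φ x| ^ Q) (G := Gf M φ) (cφ.abs.rpow_const fun x => Or.inr hQ0.le) (continuous_Gf M hφ.1)
    (fun x => by positivity) (Gf_nonneg M φ) hp (surfMeasure M)
  have hfin := c1c_pow_lt hφ hQ0 (F := fun _ => 1) continuous_const (fun _ => zero_le_one)
  simp only [mul_one] at hfin
  have h2 : ∫⁻ x, ENNReal.ofReal (Gf M ψ x) ∂surfMeasure M ≤ ENNReal.ofReal γ * ∫⁻ x, ENNReal.ofReal ((|φ x| ^ Q) ^ (1 - 1 / p) * Gf M φ x) ∂surfMeasure M := by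
    rw [← lintegral_const_mul' _ _ ENNReal.ofReal_ne_top]
    refine lintegral_mono fun x => ?_
    rw [← ENNReal.ofReal_mul hγ0.le, ← Real.rpow_mul (abs_nonneg _), eQ2]
    exact ENNReal.ofReal_le_ofReal (e2 x)
  have h3 := absorb (K := C * γ) (by positivity) hfin (u := ((n:ℝ) - 1) / n) (v := 1 - 1 / p) (p := p) 
    (E := ∫⁻ x, ENNReal.ofReal (Gf M φ x ^ p) ∂surfMeasure M) hp0 (by
      have : 1 / (n:ℝ) < 1 / p := one_div_lt_one_div_of_lt hp0 hpn
      have : ((n:ℝ) - 1) / n = 1 - 1 / n := by field_simp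
      linarith) (by
      refine h1.trans ((mul_le_mul_right (h2.trans (mul_le_mul_right hH _)) _).trans (le_of_eq ?_))
      rw [ENNReal.ofReal_mul hC.le]; ring)
  rwa [show (((n:ℝ) - 1) / n - (1 - 1 / p)) * p = (n - p) / n by field_simp; ring] at h3

lemma hardy_eps {p : ℝ} (hp : 1 ≤ p) (hpn : p < n) {φ : Eu n → ℝ} (hφ : C1cOn M.carrier φ) {ε : ℝ} (hε : 0 < ε) :
    ∫⁻ x, ENNReal.ofReal (|φ x| ^ p * kq p ε ‖x‖) ∂surfMeasure M ≤ 
      ENNReal.ofReal ((p / (n - p)) ^ p) * ∫⁻ x, ENNReal.ofReal (Gf M φ x ^ p) ∂surfMeasure M := by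
  have hp0 : 0 < p := by linarith
  have hnp : (0:ℝ) < n - p := by linarith
  obtain ⟨ψ, hψ, e1, e2⟩ := c1c_power hφ hp
  have hs := star_q hψ 0 hε hp0.le
  simp only [sub_zero] at hs
  have cφ := hφ.1.continuous
  have cψ := hψ.1.continuous
  have cG := continuous_Gf M hφ.1
  have cGψ := continuous_Gf M hψ.1
  have ck := fun q => continuous_kq (n := n) (q := q) hε
  have kp : ∀ q r, 0 < kq q ε r := fun q r => kq_pos hε
  have i1 : Integrable (fun x => |ψ x| * (n * kq p ε ‖x‖ - p * ‖x‖ ^ 2 * kq (p + 2) ε ‖x‖)) (surfMeasure M) :=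
    c1c_integrable hψ (by have := ck p; have := ck (p+2); fun_prop) (fun x _ h0 _ => by simp [h0])
  have i2 : Integrable (fun x => kq p ε ‖x‖ * ‖x‖ * Gf M ψ x) (surfMeasure M) :=
    c1c_integrable hψ (by have := ck p; fun_prop) (fun x _ h0 h1 => by simp [Gf, h0, h1])
  have lb : ∀ x : Eu n, (n - p) * (|φ x| ^ p * kq p ε ‖x‖) ≤ |ψ x| * (n * kq p ε ‖x‖ - p * ‖x‖ ^ 2 * kq (p + 2) ε ‖x‖) := fun x => by
    rw [e1]
    have : ‖x‖ ^ 2 * kq (p + 2) ε ‖x‖ ≤ kq p ε ‖x‖ := by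
      rw [kq_succ (q := p) hε]
      have := kp (p + 2) ‖x‖
      have := sq_nonneg ε
      gcongr; linarith
    have h2 : (n - p) * kq p ε ‖x‖ ≤ n * kq p ε ‖x‖ - p * ‖x‖ ^ 2 * kq (p + 2) ε ‖x‖ := by nlinarith
    have : 0 ≤ |φ x| ^ p := by positivity
    nlinarith [mul_le_mul_of_nonneg_left h2 this]
  have kpow : ∀ r, kq (p - 1) ε r = kq p ε r ^ (1 - 1 / p) := fun r => by
    unfold kq; rw [← Real.rpow_mul (by positivity)]; congr 1; field_simp
  have ub : ∀ x : Eu n, kq p ε ‖x‖ * ‖x‖ * Gf M ψ x ≤ p * ((|φ x| ^ p * kq p ε ‖x‖) ^ (1 - 1 / p) * Gf M φ x) := fun x => by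
    have h1 := kq_mul_le (q := p) hε (norm_nonneg x)
    have h2 := Gf_nonneg M ψ x
    have h3 := kp (p - 1) ‖x‖
    calc _ ≤ kq (p - 1) ε ‖x‖ * (p * (|φ x| ^ (p - 1) * Gf M φ x)) := mul_le_mul h1 (e2 x) h2 h3.le
      _ = _ := by
        rw [Real.mul_rpow (by positivity) (kp _ _).le, ← Real.rpow_mul (abs_nonneg _), ← kpow, 
          show p * (1 - 1 / p) = p - 1 by field_simp]; ring
  have h2 := ENNReal.ofReal_le_ofReal hs
  rw [ofReal_integral_eq_lintegral_ofReal i1, ofReal_integral_eq_lintegral_ofReal i2] at h2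
  rotate_left
  · exact Eventually.of_forall fun x => mul_nonneg (mul_nonneg (kp _ _).le (norm_nonneg _)) (Gf_nonneg M ψ x)
  · refine Eventually.of_forall fun x => le_trans ?_ (lb x)
    have := kp p ‖x‖
    simp only [Pi.zero_apply]; positivity
  have hfin := c1c_pow_lt hφ hp0 (ck p) (fun x => (kp p ‖x‖).le)
  set Z := ∫⁻ x, ENNReal.ofReal (|φ x| ^ p * kq p ε ‖x‖) ∂surfMeasure M with hZ
  have hH := holder_G (W := fun x => |φ x| ^ p * kq p ε ‖x‖) (G := Gf M φ) ((cφ.abs.rpow_const fun x => Or.inr hp0.le).mul (ck p)) cG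
    (fun x => mul_nonneg (by positivity) (kp p ‖x‖).le) (Gf_nonneg M φ) hp (surfMeasure M)
  have h3 : ENNReal.ofReal (n - p) * Z ≤ ENNReal.ofReal p * (Z ^ (1 - 1 / p) * (∫⁻ x, ENNReal.ofReal (Gf M φ x ^ p) ∂surfMeasure M) ^ (1 / p)) := by
    refine le_trans ?_ (h2.trans (le_trans ?_ (mul_le_mul_right hH _)))
    · rw [hZ, ← lintegral_const_mul' _ _ ENNReal.ofReal_ne_top]
      refine lintegral_mono fun x => ?_
      rw [← ENNReal.ofReal_mul hnp.le]
      exact ENNReal.ofReal_le_ofReal (lb x)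
    · rw [← lintegral_const_mul' _ _ ENNReal.ofReal_ne_top]
      refine lintegral_mono fun x => ?_
      rw [← ENNReal.ofReal_mul hp0.le]
      exact ENNReal.ofReal_le_ofReal (ub x)
  have h4 := absorb (K := p / (n - p)) (by positivity) hfin (u := 1) (v := 1 - 1 / p) (p := p) 
    (E := ∫⁻ x, ENNReal.ofReal (Gf M φ x ^ p) ∂surfMeasure M) hp0 (by
      have : 0 < 1 / p := by positivity
      linarith) (by
      rw [ENNReal.rpow_one, ENNReal.ofReal_div_of_pos hnp, ENNReal.mul_comm_div, ← mul_div_assoc, ENNReal.le_div_iff_mul_le 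
        (Or.inl (ENNReal.ofReal_pos.2 hnp).ne') (Or.inl ENNReal.ofReal_ne_top), mul_comm]
      exact h3)
  rwa [show (1 - (1 - 1 / p)) * p = 1 by field_simp; ring, ENNReal.rpow_one] at h4

lemma hardy_p {p : ℝ} (hp : 1 ≤ p) (hpn : p < n) {φ : Eu n → ℝ} (hφ : C1cOn M.carrier φ) :
    ∫⁻ x, ENNReal.ofReal (|φ x| ^ p / ‖x‖ ^ p) ∂surfMeasure M ≤ 
      ENNReal.ofReal ((p / (n - p)) ^ p) * ∫⁻ x, ENNReal.ofReal (Gf M φ x ^ p) ∂surfMeasure M := by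
  have hp0 : 0 < p := by linarith
  have cφ := hφ.1.continuous
  have hpos : ∀ k : ℕ, (0:ℝ) < 1 / ((k:ℝ) + 1) := fun k => by positivity
  calc _ ≤ ∫⁻ x, liminf (fun k : ℕ => ENNReal.ofReal (|φ x| ^ p * kq p (1 / ((k:ℝ) + 1)) ‖x‖)) atTop ∂surfMeasure M := by
        refine lintegral_mono fun x => ?_
        rcases eq_or_ne x 0 with rfl | hx
        · rw [norm_zero, Real.zero_rpow hp0.ne']; simp
        · have hx' : 0 < ‖x‖ := norm_pos_iff.2 hx
          have : Tendsto (fun k : ℕ => ENNReal.ofReal (|φ x| ^ p * kq p (1 / ((k:ℝ) + 1)) ‖x‖)) atTop (𝓝 (ENNReal.ofReal (|φ x| ^ p / ‖x‖ ^ p))) := by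
            refine ENNReal.tendsto_ofReal ?_
            rw [div_eq_mul_inv, ← Real.rpow_neg hx'.le, ← sq_rpow_half hx']
            refine Tendsto.const_mul _ ?_
            unfold kq
            refine Tendsto.rpow_const ?_ (Or.inl (by positivity))
            have := (tendsto_one_div_add_atTop_nhds_zero_nat (𝕜 := ℝ)).pow 2
            simpa using this.const_add (‖x‖ ^ 2)
          exact this.liminf_eq.ge
    _ ≤ liminf (fun k : ℕ => ∫⁻ x, ENNReal.ofReal (|φ x| ^ p * kq p (1 / ((k:ℝ) + 1)) ‖x‖) ∂surfMeasure M) atTop := by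
        refine lintegral_liminf_le fun k => ?_
        refine ENNReal.measurable_ofReal.comp (Continuous.measurable ?_)
        exact (cφ.abs.rpow_const fun x => Or.inr hp0.le).mul (continuous_kq (hpos k))
    _ ≤ liminf (fun _ : ℕ => ENNReal.ofReal ((p / (n - p)) ^ p) * ∫⁻ x, ENNReal.ofReal (Gf M φ x ^ p) ∂surfMeasure M) atTop := by
        refine liminf_le_liminf (Eventually.of_forall fun k => hardy_eps hp hpn hφ (hpos k))
    _ = _ := by simp

end HS

/-- General Hardy–Sobolev (Caffarelli–Kohn–Nirenberg type) inequality on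
hypersurfaces, `p ∈ [1,n)`, `b ∈ [0,1]`. -/
theorem hardy_sobolev_general (n : ℕ) (p : ℝ) (hp : 1 ≤ p) (hpn : p < n) :
    ∃ C : ℝ, 0 < C ∧ ∀ (M : Hypersurface n) (b : ℝ), 0 ≤ b → b ≤ 1 →
      ∀ φ : Eu n → ℝ, C1cOn M.carrier φ →
      (∫ x, |φ x| ^ (p * ((n : ℝ) - b * p) / (n - p)) / ‖x‖ ^ (b * p) ∂surfMeasure M)
          ^ (((n : ℝ) - p) / (n - b * p))
        ≤ C * ∫ x, ‖tgrad M.nu φ x‖ ^ p + |meanCurv M x * φ x| ^ p ∂surfMeasure M := by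
  obtain ⟨C₂, hC₂, hS⟩ := HS.sobolev_p hp hpn
  have hp0 : 0 < p := by linarith
  have hnp : (0:ℝ) < n - p := by linarith
  have hn0 : (0:ℝ) < n := by linarith
  have hC₁ : 0 < (p / ((n:ℝ) - p)) ^ p := by positivity
  refine ⟨max ((p / ((n:ℝ) - p)) ^ p) C₂ * 2 ^ p, mul_pos (lt_max_of_lt_right hC₂) (by positivity), fun M b hb0 hb1 φ hφ => ?_⟩
  set C₀ := max ((p / ((n:ℝ) - p)) ^ p) C₂ with hC₀
  have hC₀pos : 0 < C₀ := lt_max_of_lt_right hC₂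
  have hbp : b * p ≤ p := by nlinarith
  have hnb : (0:ℝ) < n - b * p := by linarith
  have h1b : 0 ≤ 1 - b := by linarith
  have cφ := hφ.1.continuous
  set E := ∫⁻ x, ENNReal.ofReal (HS.Gf M φ x ^ p) ∂surfMeasure M with hE
  have hHardy : ∫⁻ x, ENNReal.ofReal (|φ x| ^ p / ‖x‖ ^ p) ∂surfMeasure M ≤ ENNReal.ofReal C₀ * E :=
    (HS.hardy_p hp hpn hφ).trans (by gcongr; exact le_max_left _ _)
  have hSob := (hS M φ hφ).trans (show _ ≤ ENNReal.ofReal C₀ * E by gcongr; exact le_max_right _ _)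
  have cT : Continuous fun x => ‖tgrad M.nu φ x‖ := (HS.continuous_tgrad M hφ.1).norm
  have cH : Continuous fun x => |meanCurv M x * φ x| := ((HS.continuous_meanCurv M).mul cφ).abs
  have hB : Integrable (fun x => ‖tgrad M.nu φ x‖ ^ p + |meanCurv M x * φ x| ^ p) (surfMeasure M) :=
    HS.c1c_integrable hφ ((cT.rpow_const fun x => Or.inr hp0.le).add (cH.rpow_const fun x => Or.inr hp0.le))
      (fun x _ h0 h1 => by simp [h0, h1, hp0.ne'])
  set B := ∫ x, ‖tgrad M.nu φ x‖ ^ p + |meanCurv M x * φ x| ^ p ∂surfMeasure M with hBdef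
  have hB0 : 0 ≤ B := integral_nonneg fun x => by positivity
  have hEB : E ≤ ENNReal.ofReal (2 ^ p * B) := by
    rw [ENNReal.ofReal_mul (by positivity), hBdef, ofReal_integral_eq_lintegral_ofReal hB (Filter.Eventually.of_forall fun x => by positivity),
      ← lintegral_const_mul' _ _ ENNReal.ofReal_ne_top]
    refine lintegral_mono fun x => ?_
    rw [← ENNReal.ofReal_mul (by positivity)]
    refine ENNReal.ofReal_le_ofReal ?_
    have key : ∀ u v : ℝ, 0 ≤ u → 0 ≤ v → (u + v) ^ p ≤ 2 ^ p * (u ^ p + v ^ p) := by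
      intro u v hu hv
      have hu' : 0 ≤ u ^ p := by positivity
      have hv' : 0 ≤ v ^ p := by positivity
      rcases le_total u v with h | h
      · calc (u + v) ^ p ≤ (2 * v) ^ p := Real.rpow_le_rpow (by positivity) (by linarith) hp0.le
          _ = 2 ^ p * v ^ p := Real.mul_rpow (by norm_num) hv
          _ ≤ _ := by gcongr; linarith
      · calc (u + v) ^ p ≤ (2 * u) ^ p := Real.rpow_le_rpow (by positivity) (by linarith) hp0.le
          _ = 2 ^ p * u ^ p := Real.mul_rpow (by norm_num) hu
          _ ≤ _ := by gcongr; linarith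
    exact key _ _ (norm_nonneg _) (abs_nonneg _)
  have hpt : ∀ x : Eu n, |φ x| ^ (p * ((n : ℝ) - b * p) / (n - p)) / ‖x‖ ^ (b * p) =
      (|φ x| ^ p / ‖x‖ ^ p) ^ b * (|φ x| ^ (n * p / (n - p))) ^ (1 - b) := fun x => by
    rw [Real.div_rpow (by positivity) (by positivity), ← Real.rpow_mul (abs_nonneg _), ← Real.rpow_mul (norm_nonneg _),
      ← Real.rpow_mul (abs_nonneg _), div_mul_eq_mul_div, ← Real.rpow_add_of_nonneg (abs_nonneg _) (by positivity) (by positivity),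
      mul_comm p b]
    congr 2
    field_simp; ring
  have hθ : 0 < ((n:ℝ) - p) / (n - b * p) := by positivity
  have hmain : (∫⁻ x, ENNReal.ofReal (|φ x| ^ (p * ((n : ℝ) - b * p) / (n - p)) / ‖x‖ ^ (b * p)) ∂surfMeasure M) ^ (((n : ℝ) - p) / (n - b * p))
      ≤ ENNReal.ofReal C₀ * E := by
    have hH := ENNReal.lintegral_mul_norm_pow_le (μ := surfMeasure M) (f := fun x => ENNReal.ofReal (|φ x| ^ p / ‖x‖ ^ p)) 
      (g := fun x => ENNReal.ofReal (|φ x| ^ (n * p / (n - p)))) (by fun_prop) (by fun_prop) hb0 h1b (by ring)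
    have h2 : ∫⁻ x, ENNReal.ofReal (|φ x| ^ (n * p / (n - p))) ∂surfMeasure M ≤ (ENNReal.ofReal C₀ * E) ^ ((n:ℝ) / (n - p)) := by
      have := ENNReal.rpow_le_rpow hSob (z := (n:ℝ) / (n - p)) (by positivity)
      rwa [← ENNReal.rpow_mul, show ((n:ℝ) - p) / n * (n / (n - p)) = 1 by field_simp, ENNReal.rpow_one] at this
    have h3 : ∫⁻ x, ENNReal.ofReal (|φ x| ^ (p * ((n : ℝ) - b * p) / (n - p)) / ‖x‖ ^ (b * p)) ∂surfMeasure M ≤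
        (ENNReal.ofReal C₀ * E) ^ (((n:ℝ) - b * p) / (n - p)) := by
      calc _ = ∫⁻ x, ENNReal.ofReal (|φ x| ^ p / ‖x‖ ^ p) ^ b * ENNReal.ofReal (|φ x| ^ (n * p / (n - p))) ^ (1 - b) ∂surfMeasure M := by
            refine lintegral_congr fun x => ?_
            rw [hpt, ENNReal.ofReal_mul (by positivity), ENNReal.ofReal_rpow_of_nonneg (by positivity) hb0, ENNReal.ofReal_rpow_of_nonneg (by positivity) h1b]
        _ ≤ _ := hH
        _ ≤ (ENNReal.ofReal C₀ * E) ^ b * ((ENNReal.ofReal C₀ * E) ^ ((n:ℝ) / (n - p))) ^ (1 - b) := by gcongr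
        _ = _ := by
            rw [← ENNReal.rpow_mul, ← ENNReal.rpow_add_of_nonneg _ _ hb0 (by positivity)]
            congr 1; field_simp; ring
    refine (ENNReal.rpow_le_rpow h3 hθ.le).trans (le_of_eq ?_)
    rw [← ENNReal.rpow_mul, show ((n:ℝ) - b * p) / (n - p) * ((n - p) / (n - b * p)) = 1 by field_simp, ENNReal.rpow_one]
  rw [integral_eq_lintegral_of_nonneg_ae (Filter.Eventually.of_forall fun x => by positivity) 
    (Measurable.aestronglyMeasurable (by fun_prop)), ENNReal.toReal_rpow]
  refine ENNReal.toReal_le_of_le_ofReal (by positivity) (hmain.trans ?_)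
  refine (mul_le_mul_right hEB _).trans (le_of_eq ?_)
  rw [← ENNReal.ofReal_mul hC₀pos.le, mul_assoc]
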